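/- Let Ω ⊂ ℝ^d (d ≥ 2) be a bounded domain, I and J open intervals of ℝ, a ∈ C^∞(Ω×I×J, ℝ) and b ∈ C^∞(Ω×I×J, ℝ^d) bounded, and let v = v(x,t,τ) satisfy ∂_t v = Δ_x v + a v + b·∇_x v on Ω×I for every τ ∈ J, be C^∞ in (x,t) and C^r in τ for some r ≥ 1. For q ≥ 1, let M_q be the set of (x,t,τ) ∈ Ω×I×J such that D_x^α v(x,t,τ) = 0 for every spatial multi-index α with |α| ≤ q, while D_x^α v(x,t,τ) ≠ 0 for some α with |α| = q+1. Then for every (x₀,t₀,τ₀) ∈ M_q there exists ρ > 0 and an embedded C^r submanifold of ℝ^{d+2} of dimension d which contains M_q ∩ B((x₀,t₀,τ₀), ρ); this submanifold is either the graph of a C^r map expressing two coordinates (x_i, x_j) as functions of ((x_k)_{k≠i,j}, t, τ), or the graph of a C^r map expressing (x_i, t) as functions of ((x_k)_{k≠i}, τ). -/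

import Mathlib

open Set MeasureTheory

/-- The partial derivative of `f` in the `i`-th coordinate direction. -/
noncomputable def pd {d : ℕ} (i : Fin d) (f : (Fin d → ℝ) → ℝ) (x : Fin d → ℝ) : ℝ :=
  fderiv ℝ f x (Pi.single i 1)

/-- The Laplacian of `f`. -/
noncomputable def lap {d : ℕ} (f : (Fin d → ℝ) → ℝ) (x : Fin d → ℝ) : ℝ :=
  ∑ i, pd i (pd i f) x

/-- Iterated spatial partial derivative along a list of directions (a multi-index). -/
noncomputable def pdList {d : ℕ} : List (Fin d) → ((Fin d → ℝ) → ℝ) → ((Fin d → ℝ) → ℝ)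
  | [] => id
  | i :: l => fun f => pd i (pdList l f)

/-- The stratum `M_q` of the singular nodal set: all spatial derivatives of order `≤ q`
vanish while some derivative of order `q+1` does not. -/
def Mstratum {d : ℕ} (Ω : Set (Fin d → ℝ)) (I J : Set ℝ)
    (v : (Fin d → ℝ) → ℝ → ℝ → ℝ) (q : ℕ) : Set ((Fin d → ℝ) × ℝ × ℝ) :=
  {p | p ∈ Ω ×ˢ (I ×ˢ J) ∧
    (∀ α : List (Fin d), α.length ≤ q → pdList α (fun y => v y p.2.1 p.2.2) p.1 = 0) ∧
    ∃ α : List (Fin d), α.length = q + 1 ∧ pdList α (fun y => v y p.2.1 p.2.2) p.1 ≠ 0}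


section
open scoped Topology ContDiff
open Filter Asymptotics

set_option linter.unusedSectionVars false

namespace PR

section basics
variable {E : Type*} [NormedAddCommGroup E] [NormedSpace ℝ E]

/-- directional derivative -/
noncomputable def Dv (v : E) (g : E → ℝ) : E → ℝ := fun p => fderiv ℝ g p v

theorem Sm.diff {O : Set E} (hO : IsOpen O) {g : E → ℝ} (hg : ContDiffOn ℝ ∞ g O) {p : E}
    (hp : p ∈ O) : DifferentiableAt ℝ g p :=
  (hg.contDiffAt (hO.mem_nhds hp)).differentiableAt (by simp)

theorem Dv_smooth {O : Set E} (hO : IsOpen O) {g : E → ℝ} (hg : ContDiffOn ℝ ∞ g O) (v : E) :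
    ContDiffOn ℝ ∞ (Dv v g) O :=
  ((contDiffOn_infty_iff_fderiv_of_isOpen hO).1 hg).2.clm_apply contDiffOn_const

theorem Dv_congr {O : Set E} (hO : IsOpen O) {f g : E → ℝ} (h : Set.EqOn f g O) (v : E) :
    Set.EqOn (Dv v f) (Dv v g) O := fun p hp => by
  have : f =ᶠ[𝓝 p] g := by
    filter_upwards [hO.mem_nhds hp] with q hq using h hq
  simp only [Dv, this.fderiv_eq]

theorem Dv_comm {O : Set E} (hO : IsOpen O) {g : E → ℝ} (hg : ContDiffOn ℝ ∞ g O) (v w : E) :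
    Set.EqOn (Dv v (Dv w g)) (Dv w (Dv v g)) O := fun p hp => by
  have hd : DifferentiableAt ℝ (fderiv ℝ g) p :=
    ((((contDiffOn_infty_iff_fderiv_of_isOpen hO).1 hg).2).contDiffAt
      (hO.mem_nhds hp)).differentiableAt (by simp)
  have hs : IsSymmSndFDerivAt ℝ g p :=
    (hg.contDiffAt (hO.mem_nhds hp)).isSymmSndFDerivAt
      (by simp only [minSmoothness_of_isRCLikeNormedField]; exact WithTop.coe_le_coe.2 (le_top : (2:ℕ∞) ≤ ⊤))
  have key : ∀ a b : E, Dv a (Dv b g) p = fderiv ℝ (fderiv ℝ g) p a b := by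
    intro a b
    have : HasFDerivAt (fun q => fderiv ℝ g q b)
      ((fderiv ℝ (fderiv ℝ g) p).flip b) p := by
      have := hd.hasFDerivAt.clm_apply (hasFDerivAt_const b p)
      simpa using this
    change fderiv ℝ (fun q => fderiv ℝ g q b) p a = _
    rw [this.fderiv]; rfl
  rw [key, key]; exact hs v w

theorem Dv_add {f g : E → ℝ} {p : E} (hf : DifferentiableAt ℝ f p)
    (hg : DifferentiableAt ℝ g p) (v : E) :
    Dv v (fun q => f q + g q) p = Dv v f p + Dv v g p := by
  simp only [Dv]; rw [fderiv_fun_add hf hg]; rfl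

theorem Dv_mul {f g : E → ℝ} {p : E} (hf : DifferentiableAt ℝ f p)
    (hg : DifferentiableAt ℝ g p) (v : E) :
    Dv v (fun q => f q * g q) p = f p * Dv v g p + Dv v f p * g p := by
  simp only [Dv]; rw [fderiv_fun_mul hf hg]; simp [mul_comm]

theorem Dv_sum {ι : Type*} (s : Finset ι) {f : ι → E → ℝ} {p : E}
    (hf : ∀ i ∈ s, DifferentiableAt ℝ (f i) p) (v : E) :
    Dv v (fun q => ∑ i ∈ s, f i q) p = ∑ i ∈ s, Dv v (f i) p := by
  simp only [Dv]; rw [fderiv_fun_sum hf]; simp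

theorem Dv_const (c : ℝ) (v p : E) : Dv v (fun _ => c) p = 0 := by simp [Dv]

theorem Dv_line {g : E → ℝ} {p : E} (v : E) (s : ℝ) (hg : DifferentiableAt ℝ g (p + s • v)) :
    HasDerivAt (fun s : ℝ => g (p + s • v)) (Dv v g (p + s • v)) s := by
  have h1 : HasDerivAt (fun s : ℝ => p + s • v) v s := by
    simpa using ((hasDerivAt_id s).smul_const v).const_add p
  exact hg.hasFDerivAt.comp_hasDerivAt s h1

end basics

section LB
variable {E : Type*} [NormedAddCommGroup E] [NormedSpace ℝ E] {Λ : Type*}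

/-- locally uniformly bounded derivatives up to order n along a filter of parameters -/
def LB (l : Filter Λ) (O : Set E) : ℕ → (Λ → E → ℝ) → Prop
  | 0, g => ∀ p ∈ O, (fun z : E × Λ => g z.2 z.1) =O[𝓝 p ×ˢ l] (fun _ => (1:ℝ))
  | n+1, g => (∀ p ∈ O, (fun z : E × Λ => g z.2 z.1) =O[𝓝 p ×ˢ l] (fun _ => (1:ℝ))) ∧
      ∀ v, LB l O n (fun a => Dv v (g a))

theorem LB.zero {l : Filter Λ} {O : Set E} {n : ℕ} {g : Λ → E → ℝ} (h : LB l O n g) :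
    LB l O 0 g := by
  cases n with
  | zero => exact h
  | succ n => exact h.1

theorem LB.pred {l : Filter Λ} {O : Set E} {n : ℕ} {g : Λ → E → ℝ} (h : LB l O (n+1) g) :
    LB l O n g := by
  induction n generalizing g with
  | zero => exact h.zero
  | succ n ih => exact ⟨h.1, fun v => ih (h.2 v)⟩

theorem ev_prod {l : Filter Λ} {O : Set E} (hO : IsOpen O) {p : E} (hp : p ∈ O)
    {P : Λ → E → Prop} (h : ∀ᶠ a in l, ∀ q ∈ O, P a q) :
    ∀ᶠ z : E × Λ in 𝓝 p ×ˢ l, P z.2 z.1 := by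
  filter_upwards [Filter.Eventually.prod_inl (hO.eventually_mem hp) l,
    (Filter.Eventually.prod_inr h (𝓝 p))] with z h1 h2
  exact h2 _ h1

theorem LB.congr {l : Filter Λ} {O : Set E} (hO : IsOpen O) {n : ℕ} {g g' : Λ → E → ℝ}
    (h : LB l O n g) (e : ∀ᶠ a in l, Set.EqOn (g a) (g' a) O) : LB l O n g' := by
  have h0 : ∀ {g g' : Λ → E → ℝ}, LB l O 0 g → (∀ᶠ a in l, Set.EqOn (g a) (g' a) O) →
      LB l O 0 g' := by
    intro g g' h e p hp
    refine (h p hp).congr' ?_ (EventuallyEq.refl _ _)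
    exact ev_prod hO hp (P := fun a q => g a q = g' a q) e
  induction n generalizing g g' with
  | zero => exact h0 h e
  | succ n ih =>
    exact ⟨h0 h.zero e, fun v => ih (h.2 v) (e.mono fun a ha => Dv_congr hO ha v)⟩

/-- smooth for eventually all parameters, with all derivatives locally bounded -/
def LBI (l : Filter Λ) (O : Set E) (g : Λ → E → ℝ) : Prop :=
  (∀ᶠ a in l, ContDiffOn ℝ ∞ (g a) O) ∧ ∀ n, LB l O n g

theorem LBI.Dv {l : Filter Λ} {O : Set E} (hO : IsOpen O) {g : Λ → E → ℝ} (h : LBI l O g) (v : E) :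
    LBI l O (fun a => Dv v (g a)) :=
  ⟨h.1.mono fun _ ha => Dv_smooth hO ha v, fun n => (h.2 (n+1)).2 v⟩

theorem LBI.congr {l : Filter Λ} {O : Set E} (hO : IsOpen O) {g g' : Λ → E → ℝ}
    (h : LBI l O g) (e : ∀ᶠ a in l, Set.EqOn (g a) (g' a) O) : LBI l O g' :=
  ⟨by filter_upwards [h.1, e] with a h1 h2 using h1.congr fun x hx => (h2 hx).symm,
   fun n => (h.2 n).congr hO e⟩

theorem LB.zero_fun {l : Filter Λ} {O : Set E} (n : ℕ) :
    LB l O n (fun _ _ => (0:ℝ)) := by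
  induction n with
  | zero => intro p hp; exact isBigO_zero _ _
  | succ n ih =>
    refine ⟨fun p hp => isBigO_zero _ _, fun v => ?_⟩
    have : (fun (_ : Λ) => PR.Dv v (fun _ : E => (0:ℝ))) = fun _ _ => 0 := by
      funext a p; exact Dv_const 0 v p
    rw [this]; exact ih

theorem LBI.zero {l : Filter Λ} {O : Set E} : LBI l O (fun _ _ => (0:ℝ)) :=
  ⟨Eventually.of_forall fun _ => contDiffOn_const, LB.zero_fun⟩

theorem LB.add {l : Filter Λ} {O : Set E} (hO : IsOpen O) {n : ℕ} {f g : Λ → E → ℝ}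
    (sf : ∀ᶠ a in l, ContDiffOn ℝ ∞ (f a) O) (sg : ∀ᶠ a in l, ContDiffOn ℝ ∞ (g a) O)
    (hf : LB l O n f) (hg : LB l O n g) : LB l O n (fun a q => f a q + g a q) := by
  induction n generalizing f g with
  | zero => exact fun p hp => (hf p hp).add (hg p hp)
  | succ n ih =>
    refine ⟨fun p hp => (hf.zero p hp).add (hg.zero p hp), fun v => ?_⟩
    refine (ih (sf.mono fun a ha => Dv_smooth hO ha v) (sg.mono fun a ha => Dv_smooth hO ha v)
      (hf.2 v) (hg.2 v)).congr hO ?_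
    filter_upwards [sf, sg] with a h1 h2 p hp
    exact (Dv_add (Sm.diff hO h1 hp) (Sm.diff hO h2 hp) v).symm

theorem LBI.add {l : Filter Λ} {O : Set E} (hO : IsOpen O) {f g : Λ → E → ℝ}
    (hf : LBI l O f) (hg : LBI l O g) : LBI l O (fun a q => f a q + g a q) :=
  ⟨by filter_upwards [hf.1, hg.1] with a h1 h2 using h1.add h2,
    fun n => (hf.2 n).add hO hf.1 hg.1 (hg.2 n)⟩

theorem LB.mul {l : Filter Λ} {O : Set E} (hO : IsOpen O) {n : ℕ} {f g : Λ → E → ℝ}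
    (sf : ∀ᶠ a in l, ContDiffOn ℝ ∞ (f a) O) (sg : ∀ᶠ a in l, ContDiffOn ℝ ∞ (g a) O)
    (hf : LB l O n f) (hg : LB l O n g) : LB l O n (fun a q => f a q * g a q) := by
  have h0 : ∀ {f g : Λ → E → ℝ}, LB l O 0 f → LB l O 0 g → LB l O 0 (fun a q => f a q * g a q) := by
    intro f g hf hg p hp
    simpa using (hf p hp).mul (hg p hp)
  induction n generalizing f g with
  | zero => exact h0 hf hg
  | succ n ih =>
    refine ⟨h0 hf.zero hg.zero, fun v => ?_⟩
    have sf' := sf.mono fun a ha => Dv_smooth hO ha v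
    have sg' := sg.mono fun a ha => Dv_smooth hO ha v
    refine (LB.add hO ?_ ?_ (ih sf sg' hf.pred (hg.2 v)) (ih sf' sg (hf.2 v) hg.pred)).congr hO ?_
    · filter_upwards [sf, sg'] with a h1 h2 using h1.mul h2
    · filter_upwards [sf', sg] with a h1 h2 using h1.mul h2
    filter_upwards [sf, sg] with a h1 h2 p hp
    exact (Dv_mul (Sm.diff hO h1 hp) (Sm.diff hO h2 hp) v).symm

theorem LBI.mul {l : Filter Λ} {O : Set E} (hO : IsOpen O) {f g : Λ → E → ℝ}
    (hf : LBI l O f) (hg : LBI l O g) : LBI l O (fun a q => f a q * g a q) :=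
  ⟨by filter_upwards [hf.1, hg.1] with a h1 h2 using h1.mul h2,
    fun n => (hf.2 n).mul hO hf.1 hg.1 (hg.2 n)⟩

theorem LB.sum {l : Filter Λ} {O : Set E} (hO : IsOpen O) {ι : Type*} (s : Finset ι) {n : ℕ}
    {f : ι → Λ → E → ℝ} (sf : ∀ i ∈ s, ∀ᶠ a in l, ContDiffOn ℝ ∞ (f i a) O)
    (hf : ∀ i ∈ s, LB l O n (f i)) : LB l O n (fun a q => ∑ i ∈ s, f i a q) := by
  classical
  induction s using Finset.induction_on with
  | empty => simpa using LB.zero_fun n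
  | insert i s hi ih =>
    simp only [Finset.sum_insert hi]
    refine LB.add hO (sf i (by simp)) ?_ (hf i (by simp))
      (ih (fun j hj => sf j (by simp [hj])) (fun j hj => hf j (by simp [hj])))
    have : ∀ᶠ a in l, ∀ j ∈ s, ContDiffOn ℝ ∞ (f j a) O := by
      rw [Filter.eventually_all_finset]; exact fun j hj => sf j (by simp [hj])
    filter_upwards [this] with a ha
    exact ContDiffOn.sum ha

end LB

end PR
end


section
open scoped Topology ContDiff
open Filter Asymptotics
set_option linter.unusedSectionVars false
namespace PR

section limit
variable {E : Type*} [NormedAddCommGroup E] [NormedSpace ℝ E] [FiniteDimensional ℝ E] {Λ : Type*}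

theorem opnorm_basis : ∃ K : ℝ, 0 ≤ K ∧ ∀ L : E →L[ℝ] ℝ,
    ‖L‖ ≤ K * ∑ i, |L (Module.finBasis ℝ E i)| := by
  classical
  let b := Module.finBasis ℝ E
  let c : Fin _ → (E →L[ℝ] ℝ) := fun i => LinearMap.toContinuousLinearMap (b.coord i)
  refine ⟨∑ i, ‖c i‖, Finset.sum_nonneg fun _ _ => norm_nonneg _, fun L => ?_⟩
  refine ContinuousLinearMap.opNorm_le_bound _ (by positivity) fun x => ?_
  have hx : L x = ∑ i, c i x * L (b i) := by
    conv_lhs => rw [← b.sum_repr x]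
    rw [map_sum]; simp [c]
  rw [hx]
  calc ‖∑ i, c i x * L (b i)‖ ≤ ∑ i, ‖c i x * L (b i)‖ := norm_sum_le _ _
    _ ≤ ∑ i, (‖c i‖ * ‖x‖) * ∑ j, |L (b j)| := by
        refine Finset.sum_le_sum fun i _ => ?_
        rw [norm_mul]
        gcongr
        · exact (c i).le_opNorm x
        · rw [Real.norm_eq_abs]
          exact Finset.single_le_sum (f := fun j => |L (b j)|) (fun _ _ => abs_nonneg _)
            (Finset.mem_univ i)
    _ = _ := by rw [← Finset.sum_mul, ← Finset.sum_mul]; ring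

theorem LB.fderiv_bound {l : Filter Λ} {O : Set E} {g : Λ → E → ℝ} (h : LB l O 1 g) {p : E}
    (hp : p ∈ O) : (fun z : E × Λ => ‖fderiv ℝ (g z.2) z.1‖) =O[𝓝 p ×ˢ l] (fun _ => (1:ℝ)) := by
  obtain ⟨K, hK, hL⟩ := opnorm_basis (E := E)
  have : (fun z : E × Λ => ∑ i, |Dv (Module.finBasis ℝ E i) (g z.2) z.1|)
      =O[𝓝 p ×ˢ l] (fun _ => (1:ℝ)) :=
    IsBigO.fun_sum fun i _ => (h.2 _ p hp).abs_left
  refine IsBigO.trans (IsBigO.of_bound K (Eventually.of_forall fun z => ?_)) this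
  rw [norm_norm, Real.norm_of_nonneg (Finset.sum_nonneg fun _ _ => abs_nonneg _)]
  exact hL _

/-- turning `O(1)` along the product filter into explicit bounds -/
theorem bound_of_isBigO {l : Filter Λ} {p : E} {F : E × Λ → ℝ}
    (h : F =O[𝓝 p ×ˢ l] (fun _ => (1:ℝ))) :
    ∃ K : ℝ, 0 ≤ K ∧ ∃ δ > 0, ∀ᶠ a in l, ∀ q ∈ Metric.ball p δ, |F (q, a)| ≤ K := by
  obtain ⟨K, hK, hb⟩ := h.exists_nonneg
  have := hb.bound
  rw [Filter.eventually_prod_iff] at this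
  obtain ⟨pa, ha, pb, hb, hab⟩ := this
  obtain ⟨δ, hδ, hs⟩ := Metric.eventually_nhds_iff_ball.1 ha
  refine ⟨K, hK, δ, hδ, hb.mono fun a h q hq => ?_⟩
  simpa using hab (hs q hq) h

theorem lip_of_LB {l : Filter Λ} {O : Set E} (hO : IsOpen O) {g : Λ → E → ℝ}
    (sg : ∀ᶠ a in l, ContDiffOn ℝ ∞ (g a) O) (h : LB l O 1 g) {p : E} (hp : p ∈ O) :
    ∃ K : ℝ, 0 ≤ K ∧ ∃ δ > 0, ∀ᶠ a in l, ∀ q ∈ Metric.ball p δ, ∀ q' ∈ Metric.ball p δ,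
      |g a q - g a q'| ≤ K * ‖q - q'‖ := by
  obtain ⟨K, hK, δ, hδ, hb⟩ := bound_of_isBigO (h.fderiv_bound hp)
  obtain ⟨δ', hδ', hs⟩ := Metric.isOpen_iff.1 hO p hp
  refine ⟨K, hK, min δ δ', lt_min hδ hδ', ?_⟩
  filter_upwards [hb, sg] with a ha hsm q hq q' hq'
  rw [← Real.norm_eq_abs]
  refine Convex.norm_image_sub_le_of_norm_fderiv_le (𝕜 := ℝ) (s := Metric.ball p (min δ δ'))
    (fun x hx => Sm.diff hO hsm (hs (Metric.ball_subset_ball (min_le_right _ _) hx)))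
    (fun x hx => ?_) (convex_ball _ _) hq' hq
  have := ha x (Metric.ball_subset_ball (min_le_left _ _) hx)
  simpa using this

theorem taylor_of_LB {l : Filter Λ} {O : Set E} (hO : IsOpen O) {g : Λ → E → ℝ}
    (sg : ∀ᶠ a in l, ContDiffOn ℝ ∞ (g a) O) (h : LB l O 2 g) {p : E} (hp : p ∈ O) :
    ∃ K : ℝ, 0 ≤ K ∧ ∃ δ > 0, Metric.ball p δ ⊆ O ∧ ∀ᶠ a in l, ∀ y : E, ‖y‖ < δ →
      |g a (p + y) - g a p - fderiv ℝ (g a) p y| ≤ K * ‖y‖ ^ 2 := by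
  obtain ⟨C, hC, hL⟩ := opnorm_basis (E := E)
  have h1 := fun i => lip_of_LB hO (sg.mono fun a ha => Dv_smooth hO ha (Module.finBasis ℝ E i))
    (h.2 (Module.finBasis ℝ E i)) hp
  choose K hK δ hδ hlip using h1
  obtain ⟨δ', hδ', hs⟩ := Metric.isOpen_iff.1 hO p hp
  obtain ⟨ε, hε, hεs⟩ : ∃ ε > 0, ∀ i, ε ≤ δ i := by
    rcases isEmpty_or_nonempty (Fin (Module.finrank ℝ E)) with hE | hE
    · exact ⟨1, one_pos, fun i => isEmptyElim i⟩
    · obtain ⟨i0, hi0⟩ := Finite.exists_min δ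
      exact ⟨δ i0, hδ i0, hi0⟩
  refine ⟨C * ∑ i, K i, mul_nonneg hC (Finset.sum_nonneg fun i _ => hK i), min ε δ',
    lt_min hε hδ', (Metric.ball_subset_ball (min_le_right _ _)).trans hs, ?_⟩
  filter_upwards [sg, Filter.eventually_all.2 hlip] with a hsm hl y hy
  have hsub : Metric.closedBall p ‖y‖ ⊆ Metric.ball p (min ε δ') :=
    Metric.closedBall_subset_ball hy
  have hdiff : ∀ x ∈ Metric.closedBall p ‖y‖, DifferentiableAt ℝ (g a) x := fun x hx =>
    Sm.diff hO hsm (hs (Metric.ball_subset_ball (min_le_right _ _) (hsub hx)))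
  have hfd : ∀ x ∈ Metric.closedBall p ‖y‖, ‖fderiv ℝ (g a) x - fderiv ℝ (g a) p‖ ≤
      C * (∑ i, K i) * ‖y‖ := by
    intro x hx
    refine (hL _).trans ?_
    rw [mul_assoc, Finset.sum_mul]
    refine mul_le_mul_of_nonneg_left (Finset.sum_le_sum fun i _ => ?_) hC
    have hb : Metric.ball p (min ε δ') ⊆ Metric.ball p (δ i) :=
      Metric.ball_subset_ball ((min_le_left _ _).trans (hεs i))
    have := hl i x (hb (hsub hx)) p (Metric.mem_ball_self (hδ i))
    refine this.trans (mul_le_mul_of_nonneg_left ?_ (hK i))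
    rw [← dist_eq_norm]; exact hx
  have := Convex.norm_image_sub_le_of_norm_fderiv_le' (𝕜 := ℝ) (f := g a)
    (s := Metric.closedBall p ‖y‖) (x := p) (y := p + y) (φ := fderiv ℝ (g a) p)
    hdiff hfd (convex_closedBall _ _) (by simp) (by simp)
  rw [Real.norm_eq_abs] at this
  simp only [add_sub_cancel_left] at this
  calc _ ≤ _ := this
    _ = _ := by ring

theorem limit_step {l : Filter Λ} [l.NeBot] {O : Set E} (hO : IsOpen O) {g : Λ → E → ℝ}
    {G : E → ℝ}
    (sg : ∀ᶠ a in l, ContDiffOn ℝ ∞ (g a) O) (h : LB l O 2 g)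
    (hG : ∀ p ∈ O, Tendsto (fun a => g a p) l (𝓝 (G p))) {p : E} (hp : p ∈ O) :
    DifferentiableAt ℝ G p ∧ ∀ v, Tendsto (fun a => Dv v (g a) p) l (𝓝 (Dv v G p)) := by
  classical
  obtain ⟨K, hK, δ, hδ, hball, ht⟩ := taylor_of_LB hO sg h hp
  -- convergence of directional derivatives
  have hconv : ∀ v : E, ∃ L : ℝ, Tendsto (fun a => fderiv ℝ (g a) p v) l (𝓝 L) := by
    intro v
    refine cauchy_map_iff_exists_tendsto.1 ?_
    rw [Metric.cauchy_iff]
    refine ⟨inferInstance, fun ε hε => ?_⟩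
    -- choose step s
    obtain ⟨s, hs, hs1, hs2⟩ : ∃ s : ℝ, 0 < s ∧ s * ‖v‖ < δ ∧ K * s * ‖v‖ ^ 2 < ε / 4 := by
      have t1 : Tendsto (fun s : ℝ => s * ‖v‖) (𝓝[>] 0) (𝓝 0) := by
        have : Tendsto (fun s : ℝ => s * ‖v‖) (𝓝 0) (𝓝 (0 * ‖v‖)) := by
          apply Continuous.tendsto; fun_prop
        rw [zero_mul] at this; exact this.mono_left nhdsWithin_le_nhds
      have t2 : Tendsto (fun s : ℝ => K * s * ‖v‖ ^ 2) (𝓝[>] 0) (𝓝 0) := by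
        have : Tendsto (fun s : ℝ => K * s * ‖v‖ ^ 2) (𝓝 0) (𝓝 (K * 0 * ‖v‖ ^ 2)) := by
          apply Continuous.tendsto; fun_prop
        rw [mul_zero, zero_mul] at this; exact this.mono_left nhdsWithin_le_nhds
      obtain ⟨s, h1, h2, h3⟩ := ((self_mem_nhdsWithin : Set.Ioi (0:ℝ) ∈ 𝓝[>] 0) |> fun h =>
        (Filter.Eventually.and h ((t1.eventually_lt_const hδ).and
          (t2.eventually_lt_const (by positivity : (0:ℝ) < ε / 4))))).exists
      exact ⟨s, h1, h2, h3⟩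
    have hpv : p + s • v ∈ O := hball (by
      rw [Metric.mem_ball, dist_eq_norm]; simpa [norm_smul, abs_of_pos hs] using hs1)
    -- the quotient converges
    have hq : Tendsto (fun a => (g a (p + s • v) - g a p) / s) l
        (𝓝 ((G (p + s • v) - G p) / s)) := ((hG _ hpv).sub (hG p hp)).div_const s
    have hq' := (Metric.tendsto_nhds.1 hq) (ε / 4) (by positivity)
    refine ⟨Metric.ball ((G (p + s • v) - G p) / s) (ε / 2), ?_, fun x hx y hy => ?_⟩
    · rw [Filter.mem_map]
      filter_upwards [hq', ht] with a ha hta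
      have hy := hta (s • v) (by simpa [norm_smul, abs_of_pos hs] using hs1)
      rw [Set.mem_preimage, Metric.mem_ball]
      have h1 : dist (fderiv ℝ (g a) p v) ((g a (p + s • v) - g a p) / s) ≤ ε / 4 := by
        rw [Real.dist_eq]
        have e : fderiv ℝ (g a) p v - (g a (p + s • v) - g a p) / s
            = -((g a (p + s • v) - g a p - fderiv ℝ (g a) p (s • v)) / s) := by
          rw [map_smul, smul_eq_mul]; field_simp; ring
        rw [e, abs_neg, abs_div, abs_of_pos hs, div_le_iff₀ hs]
        refine hy.trans ?_
        rw [norm_smul, Real.norm_eq_abs, abs_of_pos hs]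
        have : K * (s * ‖v‖) ^ 2 = (K * s * ‖v‖ ^ 2) * s := by ring
        rw [this]; gcongr
      calc _ ≤ _ := dist_triangle _ ((g a (p + s • v) - g a p) / s) _
        _ < ε / 4 + ε / 4 := add_lt_add_of_le_of_lt h1 ha
        _ = ε / 2 := by ring
    · calc dist x y ≤ _ := dist_triangle_right x y _
        _ < ε / 2 + ε / 2 := add_lt_add hx hy
        _ = ε := by ring
  let b := Module.finBasis ℝ E
  choose ℓ hℓ using fun i => hconv (b i)
  let L : E →L[ℝ] ℝ := LinearMap.toContinuousLinearMap (b.constr ℝ ℓ)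
  have hL : ∀ v, Tendsto (fun a => fderiv ℝ (g a) p v) l (𝓝 (L v)) := by
    intro v
    have e1 : ∀ M : E →L[ℝ] ℝ, M v = ∑ i, b.repr v i * M (b i) := by
      intro M
      conv_lhs => rw [← b.sum_repr v]
      rw [map_sum]; simp
    have e2 : L v = ∑ i, b.repr v i * ℓ i := by
      rw [e1 L]; simp [L]
    simp_rw [e2, e1 (fderiv ℝ (g _) p)]
    exact tendsto_finsetSum _ fun i _ => (hℓ i).const_mul _
  have hder : HasFDerivAt G L p := by
    rw [hasFDerivAt_iff_isLittleO_nhds_zero]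
    have hb : ∀ y : E, ‖y‖ < δ → |G (p + y) - G p - L y| ≤ K * ‖y‖ ^ 2 := by
      intro y hy
      have hpy : p + y ∈ O := hball (by rw [Metric.mem_ball, dist_eq_norm]; simpa using hy)
      refine le_of_tendsto ((((hG _ hpy).sub (hG p hp)).sub (hL y)).abs) ?_
      filter_upwards [ht] with a ha using ha y hy
    have h1 : (fun y => G (p + y) - G p - L y) =O[𝓝 0] fun y : E => ‖y‖ ^ 2 := by
      refine IsBigO.of_bound K ?_
      filter_upwards [Metric.ball_mem_nhds (0:E) hδ] with y hy
      have := hb y (by simpa using hy)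
      simpa using this
    refine h1.trans_isLittleO ?_
    have : (fun y : E => ‖y‖ ^ 2) =o[𝓝 0] fun y : E => ‖y‖ ^ 1 :=
      (isLittleO_pow_pow (by norm_num : 1 < 2)).comp_tendsto tendsto_norm_zero
    simp only [pow_one] at this
    exact this.of_norm_right
  refine ⟨hder.differentiableAt, fun v => ?_⟩
  have : Dv v G p = L v := by simp only [Dv, hder.fderiv]
  rw [this]; exact hL v

theorem contDiff_of_Dv {O : Set E} (hO : IsOpen O) {n : ℕ} {G : E → ℝ}
    (hd : ∀ p ∈ O, DifferentiableAt ℝ G p) (h : ∀ v, ContDiffOn ℝ n (Dv v G) O) :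
    ContDiffOn ℝ (n + 1) G O := by
  rw [contDiffOn_succ_iff_fderiv_of_isOpen hO]
  exact ⟨fun p hp => (hd p hp).differentiableWithinAt, by simp, contDiffOn_clm_apply.2 h⟩

theorem limit_smooth {l : Filter Λ} [l.NeBot] {O : Set E} (hO : IsOpen O) {g : Λ → E → ℝ}
    {G : E → ℝ} (h : LBI l O g)
    (hG : ∀ p ∈ O, Tendsto (fun a => g a p) l (𝓝 (G p))) :
    ContDiffOn ℝ ∞ G O ∧ ∀ p ∈ O, ∀ v, Tendsto (fun a => Dv v (g a) p) l (𝓝 (Dv v G p)) := by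
  refine ⟨?_, fun p hp => (limit_step hO h.1 (h.2 2) hG hp).2⟩
  rw [contDiffOn_infty]
  intro n
  induction n generalizing g G with
  | zero =>
    have : ContinuousOn G O := fun p hp =>
      (limit_step hO h.1 (h.2 2) hG hp).1.continuousAt.continuousWithinAt
    simpa [contDiffOn_zero] using this
  | succ n ih =>
    have := contDiff_of_Dv hO (n := n) (G := G)
      (fun p hp => (limit_step hO h.1 (h.2 2) hG hp).1)
      (fun v => ih (h.Dv hO v) fun p hp => (limit_step hO h.1 (h.2 2) hG hp).2 v)
    exact_mod_cast this

theorem tendsto_joint {l : Filter Λ} {O : Set E} (hO : IsOpen O) {g : Λ → E → ℝ} {c : ℝ}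
    (sg : ∀ᶠ a in l, ContDiffOn ℝ ∞ (g a) O) (h : LB l O 1 g) {p : E} (hp : p ∈ O)
    (hc : Tendsto (fun a => g a p) l (𝓝 c)) :
    Tendsto (fun z : E × Λ => g z.2 z.1) (𝓝 p ×ˢ l) (𝓝 c) := by
  obtain ⟨K, hK, δ, hδ, hl⟩ := lip_of_LB hO sg h hp
  have h1 : Tendsto (fun z : E × Λ => g z.2 p) (𝓝 p ×ˢ l) (𝓝 c) := hc.comp tendsto_snd
  have h2 : Tendsto (fun z : E × Λ => g z.2 z.1 - g z.2 p) (𝓝 p ×ˢ l) (𝓝 0) := by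
    have h3 : Tendsto (fun z : E × Λ => K * ‖z.1 - p‖) (𝓝 p ×ˢ l) (𝓝 0) := by
      have : Tendsto (fun q : E => K * ‖q - p‖) (𝓝 p) (𝓝 (K * ‖p - p‖)) := by
        apply Continuous.tendsto; fun_prop
      rw [sub_self, norm_zero, mul_zero] at this
      exact this.comp tendsto_fst
    refine squeeze_zero_norm' ?_ h3
    filter_upwards [Filter.Eventually.prod_inl (Metric.ball_mem_nhds p hδ) l,
      Filter.Eventually.prod_inr hl (𝓝 p)] with z hz1 hz2
    exact hz2 _ hz1 _ (Metric.mem_ball_self hδ)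
  simpa using h2.add h1

end limit
end PR
end


section
open scoped Topology ContDiff
open Filter Asymptotics
namespace PR

abbrev E2 (d : ℕ) := (Fin d → ℝ) × ℝ

def ex {d : ℕ} (i : Fin d) : E2 d := (Pi.single i 1, 0)
def et {d : ℕ} : E2 d := (0, 1)

section bern

theorem Dv_sq {E : Type*} [NormedAddCommGroup E] [NormedSpace ℝ E] {O : Set E} (hO : IsOpen O)
    {y : E → ℝ} (hy : ContDiffOn ℝ ∞ y O) (v : E) :
    Set.EqOn (Dv v (fun p => y p * y p)) (fun p => 2 * y p * Dv v y p) O := fun p hp => by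
  rw [Dv_mul (Sm.diff hO hy hp) (Sm.diff hO hy hp)]; ring

theorem Dv_sq2 {E : Type*} [NormedAddCommGroup E] [NormedSpace ℝ E] {O : Set E} (hO : IsOpen O)
    {y : E → ℝ} (hy : ContDiffOn ℝ ∞ y O) (v : E) :
    Set.EqOn (Dv v (Dv v (fun p => y p * y p)))
      (fun p => 2 * (Dv v y p) ^ 2 + 2 * y p * Dv v (Dv v y) p) O := fun p hp => by
  rw [Dv_congr hO (Dv_sq hO hy v) v hp]
  have h1 := Sm.diff hO hy hp
  have h2 := Sm.diff hO (Dv_smooth hO hy v) hp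
  rw [Dv_mul (h1.const_mul 2) h2]
  have : Dv v (fun q => 2 * y q) p = 2 * Dv v y p := by
    rw [Dv_mul (differentiableAt_const _) h1, Dv_const]; ring
  rw [this]; ring

theorem Dv_mul2 {E : Type*} [NormedAddCommGroup E] [NormedSpace ℝ E] {O : Set E} (hO : IsOpen O)
    {f g : E → ℝ} (hf : ContDiffOn ℝ ∞ f O) (hg : ContDiffOn ℝ ∞ g O) (v : E) :
    Set.EqOn (Dv v (Dv v (fun p => f p * g p)))
      (fun p => f p * Dv v (Dv v g) p + 2 * Dv v f p * Dv v g p + Dv v (Dv v f) p * g p) O :=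
    fun p hp => by
  have e : Set.EqOn (Dv v (fun p => f p * g p)) (fun p => f p * Dv v g p + Dv v f p * g p) O :=
    fun q hq => Dv_mul (Sm.diff hO hf hq) (Sm.diff hO hg hq) v
  rw [Dv_congr hO e v hp]
  have h1 := Sm.diff hO hf hp
  have h2 := Sm.diff hO hg hp
  have h3 := Sm.diff hO (Dv_smooth hO hf v) hp
  have h4 := Sm.diff hO (Dv_smooth hO hg v) hp
  rw [Dv_add (h1.fun_mul h4) (h3.fun_mul h2), Dv_mul h1 h4, Dv_mul h3 h2]
  ring

theorem max_test {E : Type*} [NormedAddCommGroup E] [NormedSpace ℝ E] {O : Set E} (hO : IsOpen O)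
    {y : E → ℝ} (hy : ContDiffOn ℝ ∞ y O) {z : E} (hz : z ∈ O) (hm : IsLocalMax y z) (v : E) :
    Dv v y z = 0 ∧ Dv v (Dv v y) z ≤ 0 := by
  have h0 : Dv v y z = 0 := by simp [Dv, hm.fderiv_eq_zero]
  refine ⟨h0, ?_⟩
  by_contra hpos
  push Not at hpos
  have hc : Continuous (fun s : ℝ => z + s • v) := by fun_prop
  have hnear : ∀ᶠ s in 𝓝 (0:ℝ), z + s • v ∈ O :=
    hc.continuousAt.eventually (by simpa using hO.mem_nhds hz)
  have hd1 : deriv (fun s : ℝ => y (z + s • v)) =ᶠ[𝓝 0] fun s => Dv v y (z + s • v) := by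
    filter_upwards [hnear] with s hs
    exact (Dv_line v s (Sm.diff hO hy hs)).deriv
  have hz0 : z + (0:ℝ) • v = z := by simp
  have hd2 : deriv (deriv (fun s : ℝ => y (z + s • v))) 0 = Dv v (Dv v y) z := by
    rw [hd1.deriv_eq]
    have := (Dv_line (g := Dv v y) (p := z) v 0
      (by rw [hz0]; exact Sm.diff hO (Dv_smooth hO hy v) hz)).deriv
    rw [this, hz0]
  have hdd : deriv (fun s : ℝ => y (z + s • v)) 0 = 0 := by
    rw [hd1.eq_of_nhds, hz0, h0]
  have hcont : ContinuousAt (fun s : ℝ => y (z + s • v)) 0 :=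
    (Dv_line v 0 (by rw [hz0]; exact Sm.diff hO hy hz)).continuousAt
  have hmin := isLocalMin_of_deriv_deriv_pos (f := fun s : ℝ => y (z + s • v)) (x₀ := 0)
    (by rw [hd2]; exact hpos) hdd hcont
  have hmax : IsLocalMax (fun s : ℝ => y (z + s • v)) 0 := by
    have := (hc.tendsto 0).eventually (p := fun q => y q ≤ y z)
      (by rw [hz0]; exact hm)
    simpa [IsLocalMax, IsMaxFilter] using this
  have hcst : (fun s : ℝ => y (z + s • v)) =ᶠ[𝓝 0] fun _ => y z := by
    filter_upwards [hmin, hmax] with s h1 h2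
    simp only [hz0] at h1 h2
    exact le_antisymm h2 h1
  have : deriv (deriv (fun s : ℝ => y (z + s • v))) 0 = 0 := by
    rw [hcst.deriv.deriv_eq]; simp
  rw [hd2] at this
  exact hpos.ne' this

theorem alg4 {χ x v w : ℝ} (h0 : 0 ≤ χ) (h1 : χ ≤ 1) (hx : |x| ≤ 2) :
    -(2 * (x * v + χ * w) ^ 2 + 2 * χ * (-2) * v ^ 2 + 4 * χ * x * v * w)
      ≤ 60 * v ^ 2 - χ ^ 2 * w ^ 2 := by
  have h1 : x ^ 2 ≤ 4 := by
    rw [← sq_abs]; nlinarith [abs_nonneg x]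
  have h2 : (x * v) ^ 2 ≤ 4 * v ^ 2 := by
    rw [mul_pow]; exact mul_le_mul_of_nonneg_right h1 (sq_nonneg _)
  have h3 : χ * v ^ 2 ≤ v ^ 2 := by nlinarith [sq_nonneg v]
  have h4 := sq_nonneg (χ * w + 4 * (x * v))
  have e : -(2 * (x * v + χ * w) ^ 2 + 2 * χ * (-2) * v ^ 2 + 4 * χ * x * v * w)
    = - χ ^ 2 * w ^ 2 + 14 * (x * v) ^ 2 + 4 * (χ * v ^ 2) - (χ * w + 4 * (x * v)) ^ 2 := by ring
  rw [e]; linarith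

theorem young {T a b P Q : ℝ} (hP : a ^ 2 = P) (hQ : b ^ 2 = Q) :
    2 * (T * (a * b)) ≤ Q + T ^ 2 * P := by
  rw [← hP, ← hQ]; nlinarith [sq_nonneg (b - T * a)]

theorem le_of_le_one {x y : ℝ} (hx : x ≤ 1) (hy : 0 ≤ y) : x * y ≤ y :=
  mul_le_of_le_one_left hy hx

theorem bern_alg {κ ι : Type*} [Fintype κ] [Fintype ι] {c A M S T d χ χt : ℝ} (u F : κ → ℝ)
    (V G : κ → ι → ℝ) (W : κ → ι → ι → ℝ) (χj : ι → ℝ)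
    (hd : d = Fintype.card ι) (hM : 0 ≤ M) (hS : 0 ≤ S)
    (hT1 : T = S * Fintype.card κ * (1 + d))
    (hA : A = 4 + 60 * d + 2 * T ^ 2 + 2 * T)
    (hχ0 : 0 ≤ χ) (hχ1 : χ ≤ 1) (hχt : |χt| ≤ 2) (hχj : ∀ j, |χj j| ≤ 2)
    (hu : ∀ k, |u k| ≤ M)
    (hF : ∀ k, |F k| ≤ S * (√(∑ k, ∑ i, V k i ^ 2) + √(∑ k, u k ^ 2)))
    (hG : ∀ k i, |G k i| ≤ S * (√(∑ k, ∑ i, ∑ j, W k i j ^ 2) + √(∑ k, ∑ i, V k i ^ 2)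
        + √(∑ k, u k ^ 2)))
    (h : c ≤ (∑ k, ∑ i, (2 * χ * χt * V k i ^ 2 + 2 * χ ^ 2 * V k i * G k i))
      + A * ∑ k, 2 * u k * F k
      - (∑ k, ∑ i, ∑ j, (2 * (χj j * V k i + χ * W k i j) ^ 2 + 2 * χ * (-2) * V k i ^ 2
          + 4 * χ * χj j * V k i * W k i j))
      - 2 * A * ∑ k, ∑ i, V k i ^ 2) :
    c ≤ Fintype.card κ * M ^ 2 * (1 + A * T ^ 2 + 2 * A * T) := by
  set P2 := ∑ k, ∑ i, ∑ j, W k i j ^ 2 with hP2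
  set P1 := ∑ k, ∑ i, V k i ^ 2 with hP1
  set P0 := ∑ k, u k ^ 2 with hP0
  have hP2n : 0 ≤ P2 := by positivity
  have hP1n : 0 ≤ P1 := by positivity
  have hP0n : 0 ≤ P0 := by positivity
  have hdn : 0 ≤ d := by rw [hd]; positivity
  have hTn : 0 ≤ T := by rw [hT1]; positivity
  have hAn : 0 ≤ A := by rw [hA]; positivity
  have s2 := Real.sq_sqrt hP2n
  have s1 := Real.sq_sqrt hP1n
  have s0 := Real.sq_sqrt hP0n
  have n2 := Real.sqrt_nonneg P2
  have n1 := Real.sqrt_nonneg P1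
  have n0 := Real.sqrt_nonneg P0
  have hVle : ∀ k i, |V k i| ≤ √P1 := by
    intro k i
    refine Real.abs_le_sqrt ?_
    calc V k i ^ 2 ≤ ∑ i, V k i ^ 2 :=
          Finset.single_le_sum (f := fun i => V k i ^ 2) (fun _ _ => sq_nonneg _) (Finset.mem_univ i)
      _ ≤ P1 := Finset.single_le_sum (f := fun k => ∑ i, V k i ^ 2)
          (fun _ _ => by positivity) (Finset.mem_univ k)
  have hule : ∀ k, |u k| ≤ √P0 := by
    intro k
    refine Real.abs_le_sqrt ?_
    exact Finset.single_le_sum (f := fun k => u k ^ 2) (fun _ _ => sq_nonneg _) (Finset.mem_univ k)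
  have hP0M : P0 ≤ Fintype.card κ * M ^ 2 := by
    calc P0 ≤ ∑ _k : κ, M ^ 2 := Finset.sum_le_sum fun k _ => by
          rw [← sq_abs]; exact pow_le_pow_left₀ (abs_nonneg _) (hu k) 2
      _ = _ := by simp
  have hchi2 : χ ^ 2 ≤ 1 := pow_le_one₀ hχ0 hχ1
  -- first sum
  have e1 : ∑ k, ∑ i, (2 * χ * χt * V k i ^ 2 + 2 * χ ^ 2 * V k i * G k i)
      = 2 * χ * χt * P1 + 2 * χ ^ 2 * ∑ k, ∑ i, V k i * G k i := by
    rw [hP1, Finset.mul_sum, Finset.mul_sum, ← Finset.sum_add_distrib]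
    refine Finset.sum_congr rfl fun k _ => ?_
    rw [Finset.mul_sum, Finset.mul_sum, ← Finset.sum_add_distrib]
    exact Finset.sum_congr rfl fun i _ => by ring
  have b1 : 2 * χ * χt * P1 ≤ 4 * P1 := by
    have h1 : χ * χt ≤ 2 := by
      have := (abs_le.1 hχt).2
      calc χ * χt ≤ χ * 2 := mul_le_mul_of_nonneg_left this hχ0
        _ ≤ 2 := by linarith
    calc 2 * χ * χt * P1 = 2 * (χ * χt) * P1 := by ring
      _ ≤ 2 * 2 * P1 := mul_le_mul_of_nonneg_right (by linarith) hP1n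
      _ = _ := by ring
  have b2 : ∑ k, ∑ i, V k i * G k i ≤ T * (√P1 * (√P2 + √P1 + √P0)) := by
    have : ∀ k i, V k i * G k i ≤ √P1 * (S * (√P2 + √P1 + √P0)) := fun k i =>
      calc V k i * G k i ≤ |V k i * G k i| := le_abs_self _
        _ = |V k i| * |G k i| := abs_mul _ _
        _ ≤ _ := mul_le_mul (hVle k i) (hG k i) (abs_nonneg _) n1
    calc _ ≤ ∑ _k : κ, ∑ _i : ι, √P1 * (S * (√P2 + √P1 + √P0)) :=
          Finset.sum_le_sum fun k _ => Finset.sum_le_sum fun i _ => this k i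
      _ = (S * Fintype.card κ * d) * (√P1 * (√P2 + √P1 + √P0)) := by
          simp [hd]; ring
      _ ≤ _ := by
          refine mul_le_mul_of_nonneg_right ?_ (by positivity)
          rw [hT1]; refine mul_le_mul_of_nonneg_left (by linarith) (by positivity)
  have b3 : ∑ k, 2 * u k * F k ≤ 2 * T * (√P0 * (√P1 + √P0)) := by
    have : ∀ k, 2 * u k * F k ≤ 2 * (√P0 * (S * (√P1 + √P0))) := fun k =>
      calc 2 * u k * F k = 2 * (u k * F k) := by ring
        _ ≤ 2 * |u k * F k| := by linarith [le_abs_self (u k * F k)]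
        _ = 2 * (|u k| * |F k|) := by rw [abs_mul]
        _ ≤ _ := by
          have := mul_le_mul (hule k) (hF k) (abs_nonneg _) n0
          linarith
    calc _ ≤ ∑ _k : κ, 2 * (√P0 * (S * (√P1 + √P0))) := Finset.sum_le_sum fun k _ => this k
      _ = (S * Fintype.card κ) * (2 * (√P0 * (√P1 + √P0))) := by simp; ring
      _ ≤ T * (2 * (√P0 * (√P1 + √P0))) := by
          refine mul_le_mul_of_nonneg_right ?_ (by positivity)
          rw [hT1]
          have h1 : 0 ≤ S * Fintype.card κ := by positivity
          exact le_mul_of_one_le_right h1 (by linarith)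
      _ = _ := by ring
  have b4 : -(∑ k, ∑ i, ∑ j, (2 * (χj j * V k i + χ * W k i j) ^ 2 + 2 * χ * (-2) * V k i ^ 2
          + 4 * χ * χj j * V k i * W k i j)) ≤ 60 * d * P1 - χ ^ 2 * P2 := by
    have : ∀ k i j, -(2 * (χj j * V k i + χ * W k i j) ^ 2 + 2 * χ * (-2) * V k i ^ 2
          + 4 * χ * χj j * V k i * W k i j) ≤ 60 * V k i ^ 2 - χ ^ 2 * W k i j ^ 2 := by
      exact fun k i j => alg4 hχ0 hχ1 (hχj j)
    rw [← Finset.sum_neg_distrib]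
    calc _ ≤ ∑ k, ∑ i, ∑ j, (60 * V k i ^ 2 - χ ^ 2 * W k i j ^ 2) := by
          refine Finset.sum_le_sum fun k _ => ?_
          rw [← Finset.sum_neg_distrib]
          refine Finset.sum_le_sum fun i _ => ?_
          rw [← Finset.sum_neg_distrib]
          exact Finset.sum_le_sum fun j _ => this k i j
      _ = _ := by
          simp only [Finset.sum_sub_distrib, hP1, hP2, Finset.mul_sum]
          simp only [Finset.sum_const, Finset.card_univ, nsmul_eq_mul, hd]
          congr 1
          exact Finset.sum_congr rfl fun k _ => Finset.sum_congr rfl fun i _ => by ring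
  -- combine
  have c1 : 2 * χ ^ 2 * (∑ k, ∑ i, V k i * G k i) ≤
      χ ^ 2 * P2 + (2 * T ^ 2 + 2 * T) * P1 + P0 := by
    have : 2 * χ ^ 2 * (∑ k, ∑ i, V k i * G k i) ≤
        2 * χ ^ 2 * (T * (√P1 * (√P2 + √P1 + √P0))) :=
      mul_le_mul_of_nonneg_left b2 (by positivity)
    refine this.trans ?_
    have y1 : 2 * (T * (√P1 * √P2)) ≤ P2 + T ^ 2 * P1 := young s1 s2
    have y2 : 2 * (T * (√P1 * √P0)) ≤ P0 + T ^ 2 * P1 := young s1 s0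
    have y3 : χ ^ 2 * (T ^ 2 * P1) ≤ T ^ 2 * P1 := le_of_le_one hchi2 (by positivity)
    have y4 : χ ^ 2 * (P0 + T ^ 2 * P1) ≤ P0 + T ^ 2 * P1 := le_of_le_one hchi2 (by positivity)
    have y5 : χ ^ 2 * (2 * T * P1) ≤ 2 * T * P1 := le_of_le_one hchi2 (by positivity)
    have y6 := mul_le_mul_of_nonneg_left y1 (sq_nonneg χ)
    have y7 := mul_le_mul_of_nonneg_left y2 (sq_nonneg χ)
    have e : 2 * χ ^ 2 * (T * (√P1 * (√P2 + √P1 + √P0))) =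
      χ ^ 2 * (2 * (T * (√P1 * √P2))) + χ ^ 2 * (2 * T * (√P1 ^ 2))
        + χ ^ 2 * (2 * (T * (√P1 * √P0))) := by ring
    rw [e, s1]
    linarith
  have c2 : A * ∑ k, 2 * u k * F k ≤ A * P1 + (A * T ^ 2 + 2 * A * T) * P0 := by
    have y1 : 2 * T * (√P0 * (√P1 + √P0)) ≤ P1 + (T ^ 2 + 2 * T) * P0 := by
      have := young (T := T) s0 s1
      have e : 2 * T * (√P0 * (√P1 + √P0)) = 2 * (T * (√P0 * √P1)) + 2 * T * (√P0 ^ 2) := by ring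
      rw [e, s0]; linarith
    have := mul_le_mul_of_nonneg_left (b3.trans y1) hAn
    linarith
  have c3 : c ≤ P0 * (1 + A * T ^ 2 + 2 * A * T) := by
    rw [e1] at h
    have : (4 + 60 * d + 2 * T ^ 2 + 2 * T) * P1 = A * P1 := by rw [hA]
    linarith
  refine c3.trans (mul_le_mul_of_nonneg_right hP0M (by positivity))

end bern
end PR
end


section
open scoped Topology ContDiff
open Filter Asymptotics
namespace PR

section ops
variable {E : Type*} [NormedAddCommGroup E] [NormedSpace ℝ E] {O : Set E}

theorem Dv_add2 (hO : IsOpen O) {f g : E → ℝ} (hf : ContDiffOn ℝ ∞ f O) (hg : ContDiffOn ℝ ∞ g O)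
    (v w : E) : Set.EqOn (Dv v (Dv w (fun p => f p + g p)))
      (fun p => Dv v (Dv w f) p + Dv v (Dv w g) p) O := fun p hp => by
  have e : Set.EqOn (Dv w (fun p => f p + g p)) (fun p => Dv w f p + Dv w g p) O :=
    fun q hq => Dv_add (Sm.diff hO hf hq) (Sm.diff hO hg hq) w
  rw [Dv_congr hO e v hp, Dv_add (Sm.diff hO (Dv_smooth hO hf w) hp)
    (Sm.diff hO (Dv_smooth hO hg w) hp)]

theorem Dv_sum2 (hO : IsOpen O) {ι : Type*} (s : Finset ι) {f : ι → E → ℝ}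
    (hf : ∀ i, ContDiffOn ℝ ∞ (f i) O)
    (v w : E) : Set.EqOn (Dv v (Dv w (fun p => ∑ i ∈ s, f i p)))
      (fun p => ∑ i ∈ s, Dv v (Dv w (f i)) p) O := fun p hp => by
  have e : Set.EqOn (Dv w (fun p => ∑ i ∈ s, f i p)) (fun p => ∑ i ∈ s, Dv w (f i) p) O :=
    fun q hq => Dv_sum s (fun i _ => Sm.diff hO (hf i) hq) w
  rw [Dv_congr hO e v hp, Dv_sum s (fun i _ => Sm.diff hO (Dv_smooth hO (hf i) w) hp)]

theorem Dv_cmul {f : E → ℝ} {p : E} (hf : DifferentiableAt ℝ f p) (c : ℝ) (v : E) :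
    Dv v (fun q => c * f q) p = c * Dv v f p := by
  rw [Dv_mul (differentiableAt_const _) hf, Dv_const]; ring

theorem Dv_cmul2 (hO : IsOpen O) {f : E → ℝ} (hf : ContDiffOn ℝ ∞ f O) (c : ℝ)
    (v w : E) : Set.EqOn (Dv v (Dv w (fun p => c * f p)))
      (fun p => c * Dv v (Dv w f) p) O := fun p hp => by
  have e : Set.EqOn (Dv w (fun p => c * f p)) (fun p => c * Dv w f p) O :=
    fun q hq => Dv_cmul (Sm.diff hO hf hq) c w
  rw [Dv_congr hO e v hp, Dv_cmul (Sm.diff hO (Dv_smooth hO hf w) hp)]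

theorem Dv_of_quad {f : E → ℝ} {p v : E} (hf : DifferentiableAt ℝ f p) {b c : ℝ}
    (h : ∀ s : ℝ, f (p + s • v) = f p + b * s + c * s ^ 2) : Dv v f p = b := by
  have h1 := Dv_line (g := f) (p := p) v 0 (by simpa using hf)
  have h2 : HasDerivAt (fun s : ℝ => f p + b * s + c * s ^ 2) (b * 1 + c * (2 * 0 ^ 1 * 1)) 0 := by
    have := ((hasDerivAt_id (0:ℝ)).const_mul b).const_add (f p) |>.fun_add
      (((hasDerivAt_id (0:ℝ)).pow 2).const_mul c)
    simpa using this
  have h3 : (fun s : ℝ => f (p + s • v)) = fun s : ℝ => f p + b * s + c * s ^ 2 := funext h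
  rw [h3] at h1
  have := h1.unique h2
  simpa using this

end ops

variable {d : ℕ} {κ : Type*} [Fintype κ]

/-- the parabolic system -/
def PEq (O : Set (E2 d)) (B : κ → κ → Fin d → E2 d → ℝ) (C : κ → κ → E2 d → ℝ)
    (U : κ → E2 d → ℝ) : Prop :=
  ∀ p ∈ O, ∀ k, Dv et (U k) p = (∑ i, Dv (ex i) (Dv (ex i) (U k)) p)
    + (∑ l, ∑ j, B k l j p * Dv (ex j) (U l) p) + ∑ l, C k l p * U l p

theorem PEq.deriv {O : Set (E2 d)} (hO : IsOpen O) {B : κ → κ → Fin d → E2 d → ℝ}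
    {C : κ → κ → E2 d → ℝ} {U : κ → E2 d → ℝ} (hB : ∀ k l j, ContDiffOn ℝ ∞ (B k l j) O)
    (hC : ∀ k l, ContDiffOn ℝ ∞ (C k l) O) (hU : ∀ k, ContDiffOn ℝ ∞ (U k) O)
    (h : PEq O B C U) {p : E2 d} (hp : p ∈ O) (k : κ) (i : Fin d) :
    Dv et (Dv (ex i) (U k)) p = (∑ j, Dv (ex j) (Dv (ex j) (Dv (ex i) (U k))) p)
    + (∑ l, ∑ j, (B k l j p * Dv (ex j) (Dv (ex i) (U l)) p
        + Dv (ex i) (B k l j) p * Dv (ex j) (U l) p))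
    + ∑ l, (C k l p * Dv (ex i) (U l) p + Dv (ex i) (C k l) p * U l p) := by
  rw [Dv_comm hO (hU k) _ _ hp, Dv_congr hO (fun q hq => h q hq k) _ hp]
  have s1 : ∀ j, DifferentiableAt ℝ (Dv (ex j) (Dv (ex j) (U k))) p := fun j =>
    Sm.diff hO (Dv_smooth hO (Dv_smooth hO (hU k) _) _) hp
  have sB : ∀ l j, DifferentiableAt ℝ (B k l j) p := fun l j => Sm.diff hO (hB k l j) hp
  have sC : ∀ l, DifferentiableAt ℝ (C k l) p := fun l => Sm.diff hO (hC k l) hp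
  have sU : ∀ l, DifferentiableAt ℝ (U l) p := fun l => Sm.diff hO (hU l) hp
  have sV : ∀ l j, DifferentiableAt ℝ (Dv (ex j) (U l)) p := fun l j =>
    Sm.diff hO (Dv_smooth hO (hU l) _) hp
  have t1 : DifferentiableAt ℝ (fun q => ∑ j, Dv (ex j) (Dv (ex j) (U k)) q) p :=
    DifferentiableAt.fun_sum fun j _ => s1 j
  have t2' : ∀ l, DifferentiableAt ℝ (fun q => ∑ j, B k l j q * Dv (ex j) (U l) q) p :=
    fun l => DifferentiableAt.fun_sum fun j _ => (sB l j).fun_mul (sV l j)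
  have t2 : DifferentiableAt ℝ (fun q => ∑ l, ∑ j, B k l j q * Dv (ex j) (U l) q) p :=
    DifferentiableAt.fun_sum fun l _ => t2' l
  have t3 : DifferentiableAt ℝ (fun q => ∑ l, C k l q * U l q) p :=
    DifferentiableAt.fun_sum fun l _ => (sC l).fun_mul (sU l)
  rw [Dv_add (t1.fun_add t2) t3, Dv_add t1 t2, Dv_sum _ (fun j _ => s1 j), Dv_sum _ (fun l _ => t2' l),
    Dv_sum _ (fun l _ => (sC l).fun_mul (sU l))]
  congr 1
  · congr 1
    · refine Finset.sum_congr rfl fun j _ => ?_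
      rw [Dv_comm hO (Dv_smooth hO (hU k) _) _ _ hp]
      exact Dv_congr hO (Dv_comm hO (hU k) _ _) _ hp
    · refine Finset.sum_congr rfl fun l _ => ?_
      rw [Dv_sum _ (fun j _ => (sB l j).fun_mul (sV l j))]
      refine Finset.sum_congr rfl fun j _ => ?_
      rw [Dv_mul (sB l j) (sV l j), Dv_comm hO (hU l) _ _ hp]
  · refine Finset.sum_congr rfl fun l _ => ?_
    rw [Dv_mul (sC l) (sU l)]

/-- cutoff -/
def chi (R : ℝ) (p0 p : E2 d) : ℝ := R ^ 2 - ∑ i, (p.1 i - p0.1 i) ^ 2 - (p.2 - p0.2) ^ 2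

theorem chi_smooth (R : ℝ) (p0 : E2 d) : ContDiff ℝ ∞ (chi R p0) := by
  unfold chi; fun_prop

theorem chi_et (R : ℝ) (p0 p : E2 d) : Dv et (chi R p0) p = -2 * (p.2 - p0.2) := by
  refine Dv_of_quad (c := -1) ((chi_smooth R p0).differentiable (by simp) p) fun s => ?_
  simp only [chi, et, Prod.fst_add, Prod.snd_add, Prod.smul_fst, Prod.smul_snd, smul_zero, add_zero,
    smul_eq_mul, mul_one]
  ring

theorem chi_ex (R : ℝ) (p0 p : E2 d) (j : Fin d) :
    Dv (ex j) (chi R p0) p = -2 * (p.1 j - p0.1 j) := by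
  refine Dv_of_quad (c := -1) ((chi_smooth R p0).differentiable (by simp) p) fun s => ?_
  have : ∑ i, ((p + s • ex j).1 i - p0.1 i) ^ 2 = ∑ i, (p.1 i - p0.1 i) ^ 2
      + (2 * s * (p.1 j - p0.1 j) + s ^ 2) := by
    have e : ∀ i, ((p + s • ex j).1 i - p0.1 i) ^ 2 = (p.1 i - p0.1 i) ^ 2
        + (if i = j then 2 * s * (p.1 j - p0.1 j) + s ^ 2 else 0) := by
      intro i
      by_cases h : i = j
      · subst h; simp [ex]; ring
      · simp [ex, h]
    rw [Finset.sum_congr rfl fun i _ => e i, Finset.sum_add_distrib]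
    simp
  simp only [chi]
  rw [this]
  simp [ex]
  ring

theorem chi_exex (R : ℝ) (p0 p : E2 d) (j : Fin d) :
    Dv (ex j) (Dv (ex j) (chi R p0)) p = -2 := by
  have : Dv (ex j) (chi R p0) = fun p => -2 * (p.1 j - p0.1 j) := funext fun p => chi_ex R p0 p j
  rw [this]
  refine Dv_of_quad (c := 0) (by fun_prop) fun s => ?_
  simp [ex]; ring

theorem chi_nonneg_coord {R : ℝ} {p0 p : E2 d} (hR : 0 ≤ R) (h : 0 ≤ chi R p0 p) :
    (∀ j, |p.1 j - p0.1 j| ≤ R) ∧ |p.2 - p0.2| ≤ R := by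
  unfold chi at h
  have h1 : 0 ≤ ∑ i, (p.1 i - p0.1 i) ^ 2 := by positivity
  constructor
  · intro j
    have h2 : (p.1 j - p0.1 j) ^ 2 ≤ ∑ i, (p.1 i - p0.1 i) ^ 2 :=
      Finset.single_le_sum (f := fun i => (p.1 i - p0.1 i) ^ 2) (fun _ _ => sq_nonneg _)
        (Finset.mem_univ j)
    exact abs_le_of_sq_le_sq (by nlinarith [sq_nonneg (p.2 - p0.2)]) hR
  · exact abs_le_of_sq_le_sq (by nlinarith) hR

theorem chi_nonneg_ball {R : ℝ} {p0 p : E2 d} (hR : 0 ≤ R) (h : 0 ≤ chi R p0 p) :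
    p ∈ Metric.closedBall p0 R := by
  obtain ⟨h1, h2⟩ := chi_nonneg_coord hR h
  rw [Metric.mem_closedBall, Prod.dist_eq]
  refine max_le ((dist_pi_le_iff hR).2 fun j => ?_) ?_
  · rw [Real.dist_eq]; exact h1 j
  · rw [Real.dist_eq]; exact h2

theorem chi_lower {R : ℝ} {p0 p : E2 d} (hR : 0 < R)
    (h : p ∈ Metric.closedBall p0 (R / (2 * (d + 1)))) : R ^ 2 / 2 ≤ chi R p0 p := by
  set r := R / (2 * (d + 1)) with hr
  have hr0 : 0 ≤ r := by positivity
  rw [Metric.mem_closedBall, Prod.dist_eq, max_le_iff, dist_pi_le_iff hr0] at h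
  have h1 : ∑ i, (p.1 i - p0.1 i) ^ 2 ≤ d * r ^ 2 := by
    calc _ ≤ ∑ _i : Fin d, r ^ 2 := Finset.sum_le_sum fun i _ => by
          have := h.1 i
          rw [Real.dist_eq] at this
          rw [← sq_abs]; exact pow_le_pow_left₀ (abs_nonneg _) this 2
      _ = _ := by simp
  have h2 : (p.2 - p0.2) ^ 2 ≤ r ^ 2 := by
    have := h.2
    rw [Real.dist_eq] at this
    rw [← sq_abs]; exact pow_le_pow_left₀ (abs_nonneg _) this 2
  have h3 : ((d:ℝ) + 1) * r ^ 2 ≤ R ^ 2 / 2 := by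
    have hd1 : (1:ℝ) ≤ d + 1 := by have : (0:ℝ) ≤ d := by positivity
                                   linarith
    have : R = r * (2 * (d + 1)) := by rw [hr]; field_simp
    rw [this]
    have hx : ((d:ℝ)+1) * r^2 ≤ ((d:ℝ)+1)^2 * r^2 := by
      refine mul_le_mul_of_nonneg_right ?_ (sq_nonneg _)
      nlinarith
    nlinarith [mul_nonneg (sq_nonneg ((d:ℝ)+1)) (sq_nonneg r)]
  unfold chi
  linarith

theorem chi_le {R : ℝ} (p0 p : E2 d) : chi R p0 p ≤ R ^ 2 := by
  unfold chi
  have h1 : 0 ≤ ∑ i, (p.1 i - p0.1 i) ^ 2 := by positivity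
  linarith [sq_nonneg (p.2 - p0.2)]

end PR
end


section
open scoped Topology ContDiff
open Filter Asymptotics
namespace PR

variable {d : ℕ} {κ : Type*} [Fintype κ]

theorem sum_bound1 {ι : Type*} [Fintype ι] (f : ι → ℝ) (c : ℝ) (h : ∀ i, |f i| ≤ c) :
    |∑ i, f i| ≤ Fintype.card ι * c := by
  calc |∑ i, f i| ≤ ∑ i, |f i| := Finset.abs_sum_le_sum_abs _ _
    _ ≤ ∑ _i : ι, c := Finset.sum_le_sum fun i _ => h i
    _ = _ := by simp

theorem bern_point (M R c A S T : ℝ) (hM : 0 ≤ M) (hR : 0 < R) (hR1 : R ≤ 1)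
    (hS : S = 2 * Fintype.card κ * (d + 1) * M)
    (hT : T = S * Fintype.card κ * (1 + d))
    (hA : A = 4 + 60 * d + 2 * T ^ 2 + 2 * T)
    (p0 : E2 d) {O : Set (E2 d)} (hO : IsOpen O) {B : κ → κ → Fin d → E2 d → ℝ}
    {C : κ → κ → E2 d → ℝ} {U : κ → E2 d → ℝ} (hB : ∀ k l j, ContDiffOn ℝ ∞ (B k l j) O)
    (hC : ∀ k l, ContDiffOn ℝ ∞ (C k l) O) (hU : ∀ k, ContDiffOn ℝ ∞ (U k) O)
    (h : PEq O B C U) {z : E2 d} (hz : z ∈ O)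
    (bB : ∀ k l j, |B k l j z| ≤ M) (bC : ∀ k l, |C k l z| ≤ M)
    (bB' : ∀ k l j i, |Dv (ex i) (B k l j) z| ≤ M) (bC' : ∀ k l i, |Dv (ex i) (C k l) z| ≤ M)
    (bU : ∀ k, |U k z| ≤ M) (hchi : 0 ≤ chi R p0 z)
    (hmax : IsLocalMax (fun p => (∑ k, ∑ i, (chi R p0 p * Dv (ex i) (U k) p) *
        (chi R p0 p * Dv (ex i) (U k) p)) + A * (∑ k, U k p * U k p) + (-c) * (p.2 - p0.2)) z) :
    c ≤ Fintype.card κ * M ^ 2 * (1 + A * T ^ 2 + 2 * A * T) := by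
  have sχ : ContDiffOn ℝ ∞ (chi R p0) O := (chi_smooth R p0).contDiffOn
  have sV : ∀ k i, ContDiffOn ℝ ∞ (Dv (ex i) (U k)) O := fun k i => Dv_smooth hO (hU k) _
  have sy : ∀ k i, ContDiffOn ℝ ∞ (fun p => chi R p0 p * Dv (ex i) (U k) p) O :=
    fun k i => sχ.mul (sV k i)
  have syy : ∀ k i, ContDiffOn ℝ ∞ (fun p => (chi R p0 p * Dv (ex i) (U k) p) *
      (chi R p0 p * Dv (ex i) (U k) p)) O := fun k i => (sy k i).mul (sy k i)
  have sUU : ∀ k, ContDiffOn ℝ ∞ (fun p => U k p * U k p) O := fun k => (hU k).mul (hU k)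
  have sY' : ∀ k, ContDiffOn ℝ ∞ (fun p => ∑ i, (chi R p0 p * Dv (ex i) (U k) p) *
      (chi R p0 p * Dv (ex i) (U k) p)) O := fun k => ContDiffOn.sum fun i _ => syy k i
  have sY : ContDiffOn ℝ ∞ (fun p => ∑ k, ∑ i, (chi R p0 p * Dv (ex i) (U k) p) *
      (chi R p0 p * Dv (ex i) (U k) p)) O := ContDiffOn.sum fun k _ => sY' k
  have sX' : ContDiffOn ℝ ∞ (fun p => ∑ k, U k p * U k p) O := ContDiffOn.sum fun k _ => sUU k
  have sX : ContDiffOn ℝ ∞ (fun p => A * (∑ k, U k p * U k p)) O := contDiffOn_const.mul sX'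
  have sL : ContDiffOn ℝ ∞ (fun p : E2 d => (-c) * (p.2 - p0.2)) O := by fun_prop
  have hmt := max_test hO ((sY.add sX).add sL) hz hmax
  -- time derivative
  have ht : (∑ k, ∑ i, 2 * (chi R p0 z * Dv (ex i) (U k) z) *
        (chi R p0 z * Dv et (Dv (ex i) (U k)) z + Dv et (chi R p0) z * Dv (ex i) (U k) z))
      + A * (∑ k, 2 * U k z * Dv et (U k) z) + (-c) = 0 := by
    rw [← (hmt et).1, Dv_add (Sm.diff hO (sY.add sX) hz) (Sm.diff hO sL hz),
      Dv_add (Sm.diff hO sY hz) (Sm.diff hO sX hz), Dv_cmul (Sm.diff hO sX' hz),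
      Dv_sum _ (fun k _ => Sm.diff hO (sY' k) hz), Dv_sum _ (fun k _ => Sm.diff hO (sUU k) hz)]
    congr 1
    · congr 1
      · refine Finset.sum_congr rfl fun k _ => ?_
        rw [Dv_sum _ (fun i _ => Sm.diff hO (syy k i) hz)]
        refine Finset.sum_congr rfl fun i _ => ?_
        rw [Dv_sq hO (sy k i) et hz]
        simp only
        rw [Dv_mul (Sm.diff hO sχ hz) (Sm.diff hO (sV k i) hz)]
      · congr 1
        refine Finset.sum_congr rfl fun k _ => ?_
        rw [Dv_sq hO (hU k) et hz]
    · symm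
      refine Dv_of_quad (c := 0) (Sm.diff hO sL hz) fun s => ?_
      simp [et]; ring
  have hx : ∀ j, (∑ k, ∑ i, (2 * (chi R p0 z * Dv (ex j) (Dv (ex i) (U k)) z
          + Dv (ex j) (chi R p0) z * Dv (ex i) (U k) z) ^ 2
        + 2 * (chi R p0 z * Dv (ex i) (U k) z) *
          (chi R p0 z * Dv (ex j) (Dv (ex j) (Dv (ex i) (U k))) z
            + 2 * Dv (ex j) (chi R p0) z * Dv (ex j) (Dv (ex i) (U k)) z
            + (-2) * Dv (ex i) (U k) z)))
      + A * (∑ k, (2 * (Dv (ex j) (U k) z) ^ 2 + 2 * U k z * Dv (ex j) (Dv (ex j) (U k)) z)) ≤ 0 := by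
    intro j
    refine le_trans (le_of_eq ?_) (hmt (ex j)).2
    rw [Dv_add2 hO (sY.add sX) sL _ _ hz]
    simp only
    rw [Dv_add2 hO sY sX _ _ hz]
    simp only
    rw [Dv_cmul2 hO sX' _ _ _ hz, Dv_sum2 hO _ sY' _ _ hz]
    simp only
    rw [Dv_sum2 hO _ sUU _ _ hz]
    have e0 : Dv (ex j) (Dv (ex j) (fun p : E2 d => (-c) * (p.2 - p0.2))) z = 0 := by
      have : Dv (ex j) (fun p : E2 d => (-c) * (p.2 - p0.2)) = fun _ => 0 := by
        funext p
        refine Dv_of_quad (c := 0) (by fun_prop) fun s => ?_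
        simp [ex]
      rw [this, Dv_const]
    rw [e0, add_zero]
    congr 1
    · refine Finset.sum_congr rfl fun k _ => ?_
      rw [Dv_sum2 hO _ (syy k) _ _ hz]
      refine Finset.sum_congr rfl fun i _ => ?_
      rw [Dv_sq2 hO (sy k i) _ hz]
      simp only
      rw [Dv_mul2 hO sχ (sV k i) _ hz, Dv_mul (Sm.diff hO sχ hz) (Sm.diff hO (sV k i) hz)]
      simp only
      rw [chi_exex]
    · congr 1
      refine Finset.sum_congr rfl fun k _ => ?_
      rw [Dv_sq2 hO (hU k) _ hz]
  have hx' := Finset.sum_nonpos fun j (_ : j ∈ Finset.univ) => hx j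
  have hcoord := chi_nonneg_coord hR.le hchi
  have hdn : (0:ℝ) ≤ d := by positivity
  have hSn : 0 ≤ S := by rw [hS]; positivity
  set χ := chi R p0 z with hχdef
  -- the algebra lemma
  refine bern_alg (κ := κ) (ι := Fin d) (S := S) (T := T) (d := d) (A := A) (χ := χ)
    (χt := Dv et (chi R p0) z)
    (fun k => U k z) (fun k => Dv et (U k) z - ∑ j, Dv (ex j) (Dv (ex j) (U k)) z)
    (fun k i => Dv (ex i) (U k) z)
    (fun k i => Dv et (Dv (ex i) (U k)) z - ∑ j, Dv (ex j) (Dv (ex j) (Dv (ex i) (U k))) z)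
    (fun k i j => Dv (ex j) (Dv (ex i) (U k)) z)
    (fun j => Dv (ex j) (chi R p0) z) (by simp) hM hSn (by rw [hT]) hA hchi ?_ ?_ ?_ bU ?_ ?_ ?_
  · exact (chi_le p0 z).trans (pow_le_one₀ hR.le hR1)
  · rw [chi_et, abs_mul]
    have := hcoord.2
    norm_num; linarith
  · intro j
    rw [chi_ex, abs_mul]
    have := hcoord.1 j
    norm_num; linarith
  · intro k
    rw [h z hz k]
    set P1 := ∑ k, ∑ i, (Dv (ex i) (U k) z) ^ 2
    set P0 := ∑ k, (U k z) ^ 2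
    have n1 := Real.sqrt_nonneg P1
    have n0 := Real.sqrt_nonneg P0
    have hVle : ∀ k i, |Dv (ex i) (U k) z| ≤ √P1 := by
      intro k i
      refine Real.abs_le_sqrt ?_
      calc (Dv (ex i) (U k) z) ^ 2 ≤ ∑ i, (Dv (ex i) (U k) z) ^ 2 :=
            Finset.single_le_sum (f := fun i => (Dv (ex i) (U k) z) ^ 2)
              (fun _ _ => sq_nonneg _) (Finset.mem_univ i)
        _ ≤ P1 := Finset.single_le_sum (f := fun k => ∑ i, (Dv (ex i) (U k) z) ^ 2)
            (fun _ _ => by positivity) (Finset.mem_univ k)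
    have hule : ∀ k, |U k z| ≤ √P0 := by
      intro k
      refine Real.abs_le_sqrt ?_
      exact Finset.single_le_sum (f := fun k => (U k z) ^ 2) (fun _ _ => sq_nonneg _)
        (Finset.mem_univ k)
    have b1 : |∑ l, ∑ j, B k l j z * Dv (ex j) (U l) z| ≤
        Fintype.card κ * (d * (M * √P1)) := by
      refine sum_bound1 _ _ fun l => ?_
      have := sum_bound1 (fun j => B k l j z * Dv (ex j) (U l) z) (M * √P1) fun j => by
        rw [abs_mul]; exact mul_le_mul (bB k l j) (hVle l j) (abs_nonneg _) hM
      simpa using this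
    have b2 : |∑ l, C k l z * U l z| ≤ Fintype.card κ * (M * √P0) := by
      refine sum_bound1 _ _ fun l => ?_
      rw [abs_mul]; exact mul_le_mul (bC k l) (hule l) (abs_nonneg _) hM
    have e : ∀ a b c : ℝ, a + b + c - a = b + c := fun a b c => by ring
    rw [e]
    refine (abs_add_le _ _).trans ((add_le_add b1 b2).trans ?_)
    rw [hS]
    have hN : (0:ℝ) ≤ Fintype.card κ := by positivity
    have i1 : 0 ≤ (Fintype.card κ : ℝ) * M * √P1 := by positivity
    have i0 : 0 ≤ (Fintype.card κ : ℝ) * M * √P0 := by positivity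
    have i2 := mul_nonneg hdn i1
    have i3 := mul_nonneg hdn i0
    nlinarith
  · intro k i
    rw [h.deriv hO hB hC hU hz k i]
    set P2 := ∑ k, ∑ i, ∑ j, (Dv (ex j) (Dv (ex i) (U k)) z) ^ 2
    set P1 := ∑ k, ∑ i, (Dv (ex i) (U k) z) ^ 2
    set P0 := ∑ k, (U k z) ^ 2
    have n2 := Real.sqrt_nonneg P2
    have n1 := Real.sqrt_nonneg P1
    have n0 := Real.sqrt_nonneg P0
    have hVle : ∀ k i, |Dv (ex i) (U k) z| ≤ √P1 := by
      intro k i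
      refine Real.abs_le_sqrt ?_
      calc (Dv (ex i) (U k) z) ^ 2 ≤ ∑ i, (Dv (ex i) (U k) z) ^ 2 :=
            Finset.single_le_sum (f := fun i => (Dv (ex i) (U k) z) ^ 2)
              (fun _ _ => sq_nonneg _) (Finset.mem_univ i)
        _ ≤ P1 := Finset.single_le_sum (f := fun k => ∑ i, (Dv (ex i) (U k) z) ^ 2)
            (fun _ _ => by positivity) (Finset.mem_univ k)
    have hWle : ∀ k i j, |Dv (ex j) (Dv (ex i) (U k)) z| ≤ √P2 := by
      intro k i j
      refine Real.abs_le_sqrt ?_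
      calc (Dv (ex j) (Dv (ex i) (U k)) z) ^ 2 ≤ ∑ j, (Dv (ex j) (Dv (ex i) (U k)) z) ^ 2 :=
            Finset.single_le_sum (f := fun j => (Dv (ex j) (Dv (ex i) (U k)) z) ^ 2)
              (fun _ _ => sq_nonneg _) (Finset.mem_univ j)
        _ ≤ ∑ i, ∑ j, (Dv (ex j) (Dv (ex i) (U k)) z) ^ 2 :=
            Finset.single_le_sum (f := fun i => ∑ j, (Dv (ex j) (Dv (ex i) (U k)) z) ^ 2)
              (fun _ _ => by positivity) (Finset.mem_univ i)
        _ ≤ P2 := Finset.single_le_sum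
            (f := fun k => ∑ i, ∑ j, (Dv (ex j) (Dv (ex i) (U k)) z) ^ 2)
            (fun _ _ => by positivity) (Finset.mem_univ k)
    have hule : ∀ k, |U k z| ≤ √P0 := by
      intro k
      refine Real.abs_le_sqrt ?_
      exact Finset.single_le_sum (f := fun k => (U k z) ^ 2) (fun _ _ => sq_nonneg _)
        (Finset.mem_univ k)
    have b1 : |∑ l, ∑ j, (B k l j z * Dv (ex j) (Dv (ex i) (U l)) z
        + Dv (ex i) (B k l j) z * Dv (ex j) (U l) z)| ≤
        Fintype.card κ * (d * (M * √P2 + M * √P1)) := by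
      refine sum_bound1 _ _ fun l => ?_
      have := sum_bound1 (fun j => B k l j z * Dv (ex j) (Dv (ex i) (U l)) z
        + Dv (ex i) (B k l j) z * Dv (ex j) (U l) z) (M * √P2 + M * √P1) fun j => by
        refine (abs_add_le _ _).trans ?_
        rw [abs_mul, abs_mul]
        exact add_le_add (mul_le_mul (bB k l j) (hWle l i j) (abs_nonneg _) hM)
          (mul_le_mul (bB' k l j i) (hVle l j) (abs_nonneg _) hM)
      simpa using this
    have b2 : |∑ l, (C k l z * Dv (ex i) (U l) z + Dv (ex i) (C k l) z * U l z)| ≤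
        Fintype.card κ * (M * √P1 + M * √P0) := by
      refine sum_bound1 _ _ fun l => ?_
      refine (abs_add_le _ _).trans ?_
      rw [abs_mul, abs_mul]
      exact add_le_add (mul_le_mul (bC k l) (hVle l i) (abs_nonneg _) hM)
          (mul_le_mul (bC' k l i) (hule l) (abs_nonneg _) hM)
    have e : ∀ a b c : ℝ, a + b + c - a = b + c := fun a b c => by ring
    rw [e]
    refine (abs_add_le _ _).trans ((add_le_add b1 b2).trans ?_)
    rw [hS]
    have hN : (0:ℝ) ≤ Fintype.card κ := by positivity
    have j2 : 0 ≤ (Fintype.card κ : ℝ) * M * √P2 := by positivity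
    have i1 : 0 ≤ (Fintype.card κ : ℝ) * M * √P1 := by positivity
    have i0 : 0 ≤ (Fintype.card κ : ℝ) * M * √P0 := by positivity
    have j3 := mul_nonneg hdn j2
    have i2 := mul_nonneg hdn i1
    have i3 := mul_nonneg hdn i0
    nlinarith
  · -- rearrangement
    have key : (∑ k, ∑ i, 2 * (χ * Dv (ex i) (U k) z) *
        (χ * Dv et (Dv (ex i) (U k)) z + Dv et (chi R p0) z * Dv (ex i) (U k) z))
      + A * (∑ k, 2 * U k z * Dv et (U k) z) + (-c)
      - (∑ j, ((∑ k, ∑ i, (2 * (χ * Dv (ex j) (Dv (ex i) (U k)) z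
          + Dv (ex j) (chi R p0) z * Dv (ex i) (U k) z) ^ 2
        + 2 * (χ * Dv (ex i) (U k) z) *
          (χ * Dv (ex j) (Dv (ex j) (Dv (ex i) (U k))) z
            + 2 * Dv (ex j) (chi R p0) z * Dv (ex j) (Dv (ex i) (U k)) z
            + (-2) * Dv (ex i) (U k) z)))
      + A * (∑ k, (2 * (Dv (ex j) (U k) z) ^ 2 + 2 * U k z * Dv (ex j) (Dv (ex j) (U k)) z)))) =
      ((∑ k, ∑ i, (2 * χ * Dv et (chi R p0) z * Dv (ex i) (U k) z ^ 2 + 2 * χ ^ 2 *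
        Dv (ex i) (U k) z * (Dv et (Dv (ex i) (U k)) z
          - ∑ j, Dv (ex j) (Dv (ex j) (Dv (ex i) (U k))) z)))
      + A * ∑ k, 2 * U k z * (Dv et (U k) z - ∑ j, Dv (ex j) (Dv (ex j) (U k)) z)
      - (∑ k, ∑ i, ∑ j, (2 * (Dv (ex j) (chi R p0) z * Dv (ex i) (U k) z
          + χ * Dv (ex j) (Dv (ex i) (U k)) z) ^ 2 + 2 * χ * (-2) * Dv (ex i) (U k) z ^ 2
          + 4 * χ * Dv (ex j) (chi R p0) z * Dv (ex i) (U k) z * Dv (ex j) (Dv (ex i) (U k)) z))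
      - 2 * A * ∑ k, ∑ i, Dv (ex i) (U k) z ^ 2) - c := by
      rw [Finset.sum_add_distrib, ← Finset.mul_sum]
      have c1 : ∀ f : Fin d → κ → Fin d → ℝ, ∑ j, ∑ k, ∑ i, f j k i = ∑ k, ∑ i, ∑ j, f j k i := by
        intro f
        rw [Finset.sum_comm]
        exact Finset.sum_congr rfl fun k _ => Finset.sum_comm
      have c2 : ∀ f : Fin d → κ → ℝ, ∑ j, ∑ k, f j k = ∑ k, ∑ j, f j k :=
        fun f => Finset.sum_comm
      rw [c1, c2 (fun (j : Fin d) (k : κ) => 2 * (Dv (ex j) (U k) z) ^ 2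
        + 2 * U k z * Dv (ex j) (Dv (ex j) (U k)) z)]
      have q1 : (∑ k, ∑ i, 2 * (χ * Dv (ex i) (U k) z) *
        (χ * Dv et (Dv (ex i) (U k)) z + Dv et (chi R p0) z * Dv (ex i) (U k) z))
        - (∑ k, ∑ i, ∑ j, (2 * (χ * Dv (ex j) (Dv (ex i) (U k)) z
          + Dv (ex j) (chi R p0) z * Dv (ex i) (U k) z) ^ 2
        + 2 * (χ * Dv (ex i) (U k) z) *
          (χ * Dv (ex j) (Dv (ex j) (Dv (ex i) (U k))) z
            + 2 * Dv (ex j) (chi R p0) z * Dv (ex j) (Dv (ex i) (U k)) z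
            + (-2) * Dv (ex i) (U k) z)))
        = (∑ k, ∑ i, (2 * χ * Dv et (chi R p0) z * Dv (ex i) (U k) z ^ 2 + 2 * χ ^ 2 *
        Dv (ex i) (U k) z * (Dv et (Dv (ex i) (U k)) z
          - ∑ j, Dv (ex j) (Dv (ex j) (Dv (ex i) (U k))) z)))
          - (∑ k, ∑ i, ∑ j, (2 * (Dv (ex j) (chi R p0) z * Dv (ex i) (U k) z
          + χ * Dv (ex j) (Dv (ex i) (U k)) z) ^ 2 + 2 * χ * (-2) * Dv (ex i) (U k) z ^ 2
          + 4 * χ * Dv (ex j) (chi R p0) z * Dv (ex i) (U k) z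
            * Dv (ex j) (Dv (ex i) (U k)) z)) := by
        rw [← Finset.sum_sub_distrib, ← Finset.sum_sub_distrib]
        refine Finset.sum_congr rfl fun k _ => ?_
        rw [← Finset.sum_sub_distrib, ← Finset.sum_sub_distrib]
        refine Finset.sum_congr rfl fun i _ => ?_
        have r1 : ∑ j, (2 * (χ * Dv (ex j) (Dv (ex i) (U k)) z
          + Dv (ex j) (chi R p0) z * Dv (ex i) (U k) z) ^ 2
        + 2 * (χ * Dv (ex i) (U k) z) *
          (χ * Dv (ex j) (Dv (ex j) (Dv (ex i) (U k))) z
            + 2 * Dv (ex j) (chi R p0) z * Dv (ex j) (Dv (ex i) (U k)) z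
            + (-2) * Dv (ex i) (U k) z)) =
          (∑ j, (2 * (Dv (ex j) (chi R p0) z * Dv (ex i) (U k) z
          + χ * Dv (ex j) (Dv (ex i) (U k)) z) ^ 2 + 2 * χ * (-2) * Dv (ex i) (U k) z ^ 2
          + 4 * χ * Dv (ex j) (chi R p0) z * Dv (ex i) (U k) z
            * Dv (ex j) (Dv (ex i) (U k)) z)) + 2 * χ ^ 2 * Dv (ex i) (U k) z *
              ∑ j, Dv (ex j) (Dv (ex j) (Dv (ex i) (U k))) z := by
          rw [Finset.mul_sum, ← Finset.sum_add_distrib]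
          exact Finset.sum_congr rfl fun j _ => by ring
        rw [r1]; ring
      have q2 : (∑ k, 2 * U k z * Dv et (U k) z)
        - (∑ k, ∑ j, (2 * (Dv (ex j) (U k) z) ^ 2 + 2 * U k z * Dv (ex j) (Dv (ex j) (U k)) z))
        = (∑ k, 2 * U k z * (Dv et (U k) z - ∑ j, Dv (ex j) (Dv (ex j) (U k)) z))
          - 2 * ∑ k, ∑ i, Dv (ex i) (U k) z ^ 2 := by
        rw [Finset.mul_sum, ← Finset.sum_sub_distrib, ← Finset.sum_sub_distrib]
        refine Finset.sum_congr rfl fun k _ => ?_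
        rw [Finset.sum_add_distrib, ← Finset.mul_sum, ← Finset.mul_sum]
        ring
      have q2' := congrArg (fun x => A * x) q2
      simp only [mul_sub] at q2' q1 ⊢
      linarith
    rw [ht] at key
    linarith

theorem bernstein (M R : ℝ) (hM : 0 ≤ M) (hR : 0 < R) (hR1 : R ≤ 1) :
    ∃ K : ℝ, ∀ (p0 : E2 d) (O : Set (E2 d)), IsOpen O → Metric.closedBall p0 R ⊆ O →
    ∀ (B : κ → κ → Fin d → E2 d → ℝ) (C : κ → κ → E2 d → ℝ) (U : κ → E2 d → ℝ),
    (∀ k l j, ContDiffOn ℝ ∞ (B k l j) O) → (∀ k l, ContDiffOn ℝ ∞ (C k l) O) →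
    (∀ k, ContDiffOn ℝ ∞ (U k) O) → PEq O B C U →
    (∀ z ∈ Metric.closedBall p0 R, (∀ k l j, |B k l j z| ≤ M) ∧ (∀ k l, |C k l z| ≤ M) ∧
      (∀ k l j i, |Dv (ex i) (B k l j) z| ≤ M) ∧ (∀ k l i, |Dv (ex i) (C k l) z| ≤ M) ∧
      (∀ k, |U k z| ≤ M)) →
    ∀ p ∈ Metric.closedBall p0 (R / (2 * (d + 1))), ∀ k i, |Dv (ex i) (U k) p| ≤ K := by
  obtain ⟨S, hS⟩ : ∃ S : ℝ, S = 2 * Fintype.card κ * (d + 1) * M := ⟨_, rfl⟩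
  obtain ⟨T, hT⟩ : ∃ T : ℝ, T = S * Fintype.card κ * (1 + d) := ⟨_, rfl⟩
  obtain ⟨A, hA⟩ : ∃ A : ℝ, A = 4 + 60 * d + 2 * T ^ 2 + 2 * T := ⟨_, rfl⟩
  obtain ⟨c, hc⟩ : ∃ c : ℝ, c = Fintype.card κ * M ^ 2 * (1 + A * T ^ 2 + 2 * A * T) + 1 :=
    ⟨_, rfl⟩
  have hSn : 0 ≤ S := by rw [hS]; positivity
  have hTn : 0 ≤ T := by rw [hT]; positivity
  have hAn : 0 ≤ A := by rw [hA]; positivity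
  have hcn : 0 ≤ c := by rw [hc]; positivity
  refine ⟨√((A * (Fintype.card κ * M ^ 2) + 2 * c * R) * (4 / R ^ 4)), ?_⟩
  intro p0 O hO hball B C U hB hC hU h hb p hp k i
  set ψ : E2 d → ℝ := fun p => (∑ k, ∑ i, (chi R p0 p * Dv (ex i) (U k) p) *
        (chi R p0 p * Dv (ex i) (U k) p)) + A * (∑ k, U k p * U k p) + (-c) * (p.2 - p0.2) with hψ
  let Q : Set (E2 d) := {p | 0 ≤ chi R p0 p}
  have hQb : Q ⊆ Metric.closedBall p0 R := fun q hq => chi_nonneg_ball hR.le hq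
  have hQc : IsCompact Q := (isCompact_closedBall p0 R).of_isClosed_subset
    (isClosed_le continuous_const (chi_smooth R p0).continuous) hQb
  have hpQ : p ∈ Q := le_trans (by positivity) (chi_lower hR hp)
  have hψc : ContinuousOn ψ Q := by
    have c1 : ∀ k i, ContinuousOn (fun p => chi R p0 p * Dv (ex i) (U k) p) Q := fun k i =>
      (chi_smooth R p0).continuous.continuousOn.mul
        ((Dv_smooth hO (hU k) _).continuousOn.mono (hQb.trans hball))
    have c2 : ∀ k, ContinuousOn (U k) Q := fun k => (hU k).continuousOn.mono (hQb.trans hball)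
    refine ContinuousOn.add (ContinuousOn.add ?_ ?_) (by fun_prop)
    · exact continuousOn_finsetSum _ fun k _ => continuousOn_finsetSum _ fun i _ =>
        (c1 k i).mul (c1 k i)
    · exact continuousOn_const.mul (continuousOn_finsetSum _ fun k _ => (c2 k).mul (c2 k))
  obtain ⟨z, hzQ, hzmax⟩ := hQc.exists_isMaxOn ⟨p, hpQ⟩ hψc
  have hUsum : ∀ q ∈ Q, ∑ k, U k q * U k q ≤ Fintype.card κ * M ^ 2 := fun q hq => by
    calc _ ≤ ∑ _k : κ, M ^ 2 := Finset.sum_le_sum fun k _ => by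
          have := (hb q (hQb hq)).2.2.2.2 k
          rw [← sq, ← sq_abs]; exact pow_le_pow_left₀ (abs_nonneg _) this 2
      _ = _ := by simp
  have hz0 : chi R p0 z = 0 := by
    by_contra hne
    have hpos : 0 < chi R p0 z := lt_of_le_of_ne hzQ (Ne.symm hne)
    have hloc : IsLocalMax ψ z := by
      have : ∀ᶠ q in 𝓝 z, 0 < chi R p0 q :=
        (chi_smooth R p0).continuous.continuousAt.eventually_const_lt hpos
      filter_upwards [this] with q hq
      exact hzmax (show q ∈ Q from hq.le)
    obtain ⟨g1, g2, g3, g4, g5⟩ := hb z (hQb hzQ)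
    have := bern_point M R c A S T hM hR hR1 hS hT hA p0 hO hB hC hU h (hball (hQb hzQ))
      g1 g2 g3 g4 g5 hpos.le hloc
    linarith
  have hle : ψ p ≤ ψ z := hzmax hpQ
  have hψz : ψ z ≤ A * (Fintype.card κ * M ^ 2) + c * R := by
    have h1 := mul_le_mul_of_nonneg_left (hUsum z hzQ) hAn
    have h2 : (-c) * (z.2 - p0.2) ≤ c * R := by
      have := (abs_le.1 (chi_nonneg_coord hR.le hzQ).2).1
      have := mul_le_mul_of_nonneg_left this hcn
      linarith
    simp only [hψ, hz0, zero_mul, Finset.sum_const_zero, zero_add]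
    linarith
  have hψp : (chi R p0 p * Dv (ex i) (U k) p) ^ 2 - c * R ≤ ψ p := by
    have h1 : 0 ≤ A * ∑ k, U k p * U k p :=
      mul_nonneg hAn (Finset.sum_nonneg fun k _ => mul_self_nonneg _)
    have h2 : -(c * R) ≤ (-c) * (p.2 - p0.2) := by
      have := (abs_le.1 (chi_nonneg_coord hR.le hpQ).2).2
      have := mul_le_mul_of_nonneg_left this hcn
      linarith
    have h3 : (chi R p0 p * Dv (ex i) (U k) p) * (chi R p0 p * Dv (ex i) (U k) p) ≤
        ∑ k, ∑ i, (chi R p0 p * Dv (ex i) (U k) p) * (chi R p0 p * Dv (ex i) (U k) p) :=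
      calc _ ≤ ∑ i, (chi R p0 p * Dv (ex i) (U k) p) * (chi R p0 p * Dv (ex i) (U k) p) :=
            Finset.single_le_sum
              (f := fun i => (chi R p0 p * Dv (ex i) (U k) p) * (chi R p0 p * Dv (ex i) (U k) p))
              (fun _ _ => mul_self_nonneg _) (Finset.mem_univ i)
        _ ≤ _ := Finset.single_le_sum (f := fun k => ∑ i, (chi R p0 p * Dv (ex i) (U k) p) *
              (chi R p0 p * Dv (ex i) (U k) p))
            (fun _ _ => Finset.sum_nonneg fun _ _ => mul_self_nonneg _) (Finset.mem_univ k)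
    simp only [hψ]
    rw [sq]; linarith
  refine Real.abs_le_sqrt ?_
  have hfin : (chi R p0 p * Dv (ex i) (U k) p) ^ 2 ≤ A * (Fintype.card κ * M ^ 2) + 2 * c * R := by
    linarith
  have hlow := chi_lower hR hp
  have hsq : (R ^ 2 / 2) ^ 2 ≤ chi R p0 p ^ 2 := pow_le_pow_left₀ (by positivity) hlow 2
  rw [mul_pow] at hfin
  have h4 : (R ^ 2 / 2) ^ 2 * Dv (ex i) (U k) p ^ 2 ≤ A * (Fintype.card κ * M ^ 2) + 2 * c * R :=
    (mul_le_mul_of_nonneg_right hsq (sq_nonneg _)).trans hfin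
  have e : Dv (ex i) (U k) p ^ 2 = ((R ^ 2 / 2) ^ 2 * Dv (ex i) (U k) p ^ 2) * (4 / R ^ 4) := by
    field_simp; ring
  rw [e]
  exact mul_le_mul_of_nonneg_right h4 (by positivity)

end PR
end


section
open scoped Topology ContDiff
open Filter Asymptotics
namespace PR

variable {d : ℕ} {κ : Type} [Fintype κ] {Λ : Type*}

/-- extended first order coefficients -/
noncomputable def xB (B : κ → κ → Fin d → E2 d → ℝ) :
    (κ ⊕ κ × Fin d) → (κ ⊕ κ × Fin d) → Fin d → E2 d → ℝ
  | .inl k, .inl l, j => B k l j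
  | .inr q, .inr q', j => if q'.2 = q.2 then B q.1 q'.1 j else fun _ => 0
  | .inl _, .inr _, _ => fun _ => 0
  | .inr _, .inl _, _ => fun _ => 0

/-- extended zeroth order coefficients -/
noncomputable def xC (B : κ → κ → Fin d → E2 d → ℝ) (C : κ → κ → E2 d → ℝ) :
    (κ ⊕ κ × Fin d) → (κ ⊕ κ × Fin d) → E2 d → ℝ
  | .inl k, .inl l => C k l
  | .inr q, .inr q' => fun p => Dv (ex q.2) (B q.1 q'.1 q'.2) p +
      (if q'.2 = q.2 then C q.1 q'.1 else fun _ => 0) p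
  | .inr q, .inl l => Dv (ex q.2) (C q.1 l)
  | .inl _, .inr _ => fun _ => 0

/-- extended unknown -/
noncomputable def xU (U : κ → E2 d → ℝ) : (κ ⊕ κ × Fin d) → E2 d → ℝ
  | .inl k => U k
  | .inr q => Dv (ex q.2) (U q.1)

theorem PEq.ext {O : Set (E2 d)} (hO : IsOpen O) {B : κ → κ → Fin d → E2 d → ℝ}
    {C : κ → κ → E2 d → ℝ} {U : κ → E2 d → ℝ} (hB : ∀ k l j, ContDiffOn ℝ ∞ (B k l j) O)
    (hC : ∀ k l, ContDiffOn ℝ ∞ (C k l) O) (hU : ∀ k, ContDiffOn ℝ ∞ (U k) O)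
    (h : PEq O B C U) : PEq O (xB B) (xC B C) (xU U) := by
  intro p hp k
  rcases k with k | ⟨k, i⟩
  · simp only [Fintype.sum_sum_type, xB, xC, xU, zero_mul, Finset.sum_const_zero, add_zero]
    exact h p hp k
  · simp only [Fintype.sum_sum_type, xB, xC, xU, zero_mul, Finset.sum_const_zero, zero_add]
    rw [h.deriv hO hB hC hU hp k i]
    rw [Fintype.sum_prod_type, Fintype.sum_prod_type]
    have e1 : ∀ l, ∑ i', ∑ j, (if i' = i then B k l j else fun _ => 0) p *
        Dv (ex j) (Dv (ex i') (U l)) p = ∑ j, B k l j p * Dv (ex j) (Dv (ex i) (U l)) p := by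
      intro l
      rw [Finset.sum_eq_single i]
      · simp
      · intro b _ hb; simp [hb]
      · simp
    have e2 : ∀ l, ∑ j, (Dv (ex i) (B k l j) p + (if j = i then C k l else fun _ => 0) p) *
        Dv (ex j) (U l) p = (∑ j, Dv (ex i) (B k l j) p * Dv (ex j) (U l) p)
          + C k l p * Dv (ex i) (U l) p := by
      intro l
      simp only [add_mul, Finset.sum_add_distrib]
      congr 1
      rw [Finset.sum_eq_single i]
      · simp
      · intro b _ hb; simp [hb]
      · simp
    simp only [e1, e2, Finset.sum_add_distrib]
    ring

theorem xB_LBI {l : Filter Λ} {O : Set (E2 d)}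
    {B : Λ → κ → κ → Fin d → E2 d → ℝ} (hB : ∀ k m j, LBI l O (fun a => B a k m j)) :
    ∀ k m j, LBI l O (fun a => xB (B a) k m j) := by
  rintro (k | q) (m | q') j
  · exact hB k m j
  · exact LBI.zero
  · exact LBI.zero
  · by_cases h : q'.2 = q.2
    · simpa [xB, h] using hB q.1 q'.1 j
    · simpa [xB, h] using LBI.zero

theorem xC_LBI {l : Filter Λ} {O : Set (E2 d)} (hO : IsOpen O)
    {B : Λ → κ → κ → Fin d → E2 d → ℝ} (hB : ∀ k m j, LBI l O (fun a => B a k m j))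
    {C : Λ → κ → κ → E2 d → ℝ} (hC : ∀ k m, LBI l O (fun a => C a k m)) :
    ∀ k m, LBI l O (fun a => xC (B a) (C a) k m) := by
  rintro (k | q) (m | q')
  · exact hC k m
  · exact LBI.zero
  · exact (hC q.1 m).Dv hO _
  · refine LBI.add hO ((hB q.1 q'.1 q'.2).Dv hO _) ?_
    by_cases h : q'.2 = q.2
    · simpa [h] using hC q.1 q'.1
    · simpa [h] using LBI.zero

theorem ev_all {ι : Type*} [Finite ι] {l : Filter Λ} {P : ι → Λ → Prop}
    (h : ∀ i, ∀ᶠ a in l, P i a) : ∀ᶠ a in l, ∀ i, P i a := eventually_all.2 h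

theorem unif_bound {E : Type*} [NormedAddCommGroup E] [NormedSpace ℝ E]
    [FiniteDimensional ℝ E] {ι : Type*} [Fintype ι] {l : Filter Λ}
    {p : E} {F : ι → E × Λ → ℝ}
    (h : ∀ i, F i =O[𝓝 p ×ˢ l] (fun _ => (1:ℝ))) :
    ∃ K : ℝ, 0 ≤ K ∧ ∃ δ > 0, ∀ᶠ a in l, ∀ q ∈ Metric.ball p δ, ∀ i, |F i (q, a)| ≤ K := by
  have : (fun z => ∑ i, |F i z|) =O[𝓝 p ×ˢ l] (fun _ => (1:ℝ)) :=
    IsBigO.fun_sum fun i _ => (h i).abs_left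
  obtain ⟨K, hK, δ, hδ, hev⟩ := bound_of_isBigO this
  refine ⟨K, hK, δ, hδ, hev.mono fun a ha q hq i => ?_⟩
  refine le_trans ?_ ((le_abs_self _).trans (ha q hq))
  exact Finset.single_le_sum (f := fun i => |F i (q, a)|) (fun _ _ => abs_nonneg _)
    (Finset.mem_univ i)

theorem bern_LB {l : Filter Λ} {O : Set (E2 d)} (hO : IsOpen O)
    {B : Λ → κ → κ → Fin d → E2 d → ℝ} (hB : ∀ k m j, LBI l O (fun a => B a k m j))
    {C : Λ → κ → κ → E2 d → ℝ} (hC : ∀ k m, LBI l O (fun a => C a k m))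
    {U : Λ → κ → E2 d → ℝ} (hU : ∀ k, ∀ᶠ a in l, ContDiffOn ℝ ∞ (U a k) O)
    (h : ∀ᶠ a in l, PEq O (B a) (C a) (U a)) (h0 : ∀ k, LB l O 0 (fun a => U a k)) (k : κ)
    (i : Fin d) : LB l O 0 (fun a => Dv (ex i) (U a k)) := by
  intro p hp
  obtain ⟨K1, n1, δ1, d1, b1⟩ := unif_bound (p := p) (l := l)
    (F := fun (x : κ × κ × Fin d) z => B z.2 x.1 x.2.1 x.2.2 z.1)
    fun x => (hB _ _ _).2 0 p hp
  obtain ⟨K2, n2, δ2, d2, b2⟩ := unif_bound (p := p) (l := l)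
    (F := fun (x : κ × κ) z => C z.2 x.1 x.2 z.1) fun x => (hC _ _).2 0 p hp
  obtain ⟨K3, n3, δ3, d3, b3⟩ := unif_bound (p := p) (l := l)
    (F := fun (x : κ × κ × Fin d × Fin d) z => Dv (ex x.2.2.2) (B z.2 x.1 x.2.1 x.2.2.1) z.1)
    fun x => ((hB x.1 x.2.1 x.2.2.1).Dv hO (ex x.2.2.2)).2 0 p hp
  obtain ⟨K4, n4, δ4, d4, b4⟩ := unif_bound (p := p) (l := l)
    (F := fun (x : κ × κ × Fin d) z => Dv (ex x.2.2) (C z.2 x.1 x.2.1) z.1)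
    fun x => ((hC x.1 x.2.1).Dv hO (ex x.2.2)).2 0 p hp
  obtain ⟨K5, n5, δ5, d5, b5⟩ := unif_bound (p := p) (l := l)
    (F := fun (x : κ) z => U z.2 x z.1) fun x => h0 x p hp
  obtain ⟨δ0, d0, hb0⟩ := Metric.isOpen_iff.1 hO p hp
  obtain ⟨δ, hδ, e⟩ : ∃ δ : ℝ, 0 < δ ∧ (δ ≤ δ0 ∧ δ ≤ δ1 ∧ δ ≤ δ2 ∧ δ ≤ δ3 ∧ δ ≤ δ4 ∧ δ ≤ δ5
      ∧ δ ≤ 1) := by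
    refine ⟨min δ0 (min δ1 (min δ2 (min δ3 (min δ4 (min δ5 1))))), ?_, ?_⟩
    · simp only [lt_min_iff]; exact ⟨d0, d1, d2, d3, d4, d5, one_pos⟩
    · simp
  obtain ⟨e0, e1, e2, e3, e4, e5, e6⟩ := e
  obtain ⟨K, hK⟩ := bernstein (d := d) (κ := κ) (K1 + K2 + K3 + K4 + K5) (δ / 2)
    (by positivity) (by positivity) (by linarith)
  have hsub : ∀ δ', δ ≤ δ' → ∀ z ∈ Metric.closedBall p (δ/2), z ∈ Metric.ball p δ' :=
    fun δ' h' z hz => Metric.mem_ball.2 (lt_of_le_of_lt (Metric.mem_closedBall.1 hz) (by linarith))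
  have main : ∀ᶠ a in l, ∀ q ∈ Metric.closedBall p (δ / 2 / (2 * (d + 1))),
      |Dv (ex i) (U a k) q| ≤ K := by
    filter_upwards [b1, b2, b3, b4, b5, h, ev_all hU,
      ev_all fun k => ev_all fun m => ev_all fun j => (hB k m j).1,
      ev_all fun k => ev_all fun m => (hC k m).1] with a a1 a2 a3 a4 a5 a6 a7 a8 a9 q hq
    refine hK p O hO (fun z hz => hb0 (hsub δ0 e0 z hz)) (B a) (C a) (U a) a8 a9 a7 a6 ?_ q hq k i
    intro z hz
    refine ⟨fun k m j => (a1 z (hsub _ e1 z hz) (k, m, j)).trans (by linarith),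
      fun k m => (a2 z (hsub _ e2 z hz) (k, m)).trans (by linarith),
      fun k m j i => (a3 z (hsub _ e3 z hz) (k, m, j, i)).trans (by linarith),
      fun k m i => (a4 z (hsub _ e4 z hz) (k, m, i)).trans (by linarith),
      fun k => (a5 z (hsub _ e5 z hz) k).trans (by linarith)⟩
  refine IsBigO.of_bound K ?_
  have hn : Metric.closedBall p (δ / 2 / (2 * (d + 1))) ∈ 𝓝 p :=
    Metric.closedBall_mem_nhds _ (by positivity)
  filter_upwards [prod_mem_prod hn main] with z hz
  simpa using hz.2 z.1 hz.1

theorem xU_smooth {O : Set (E2 d)} (hO : IsOpen O) {l : Filter Λ} {U : Λ → κ → E2 d → ℝ}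
    (hU : ∀ k, ∀ᶠ a in l, ContDiffOn ℝ ∞ (U a k) O) :
    ∀ k, ∀ᶠ a in l, ContDiffOn ℝ ∞ (xU (U a) k) O := by
  rintro (k | q)
  · exact hU k
  · exact (hU q.1).mono fun a ha => Dv_smooth hO ha _

theorem ext_ev {l : Filter Λ} {O : Set (E2 d)} (hO : IsOpen O)
    {B : Λ → κ → κ → Fin d → E2 d → ℝ} (hB : ∀ k m j, LBI l O (fun a => B a k m j))
    {C : Λ → κ → κ → E2 d → ℝ} (hC : ∀ k m, LBI l O (fun a => C a k m))
    {U : Λ → κ → E2 d → ℝ} (hU : ∀ k, ∀ᶠ a in l, ContDiffOn ℝ ∞ (U a k) O)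
    (h : ∀ᶠ a in l, PEq O (B a) (C a) (U a)) :
    ∀ᶠ a in l, PEq O (xB (B a)) (xC (B a) (C a)) (xU (U a)) := by
  filter_upwards [h, ev_all hU,
      ev_all fun k => ev_all fun m => ev_all fun j => (hB k m j).1,
      ev_all fun k => ev_all fun m => (hC k m).1] with a a6 a7 a8 a9
  exact a6.ext hO a8 a9 a7

theorem Dv_decomp (g : E2 d → ℝ) (v p : E2 d) :
    Dv v g p = (∑ i, v.1 i * Dv (ex i) g p) + v.2 * Dv et g p := by
  have : v = (∑ i, v.1 i • ex i) + v.2 • et := by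
    refine Prod.ext ?_ ?_
    · have h0 : ((et : E2 d)).1 = 0 := rfl
      simp only [Prod.fst_add, Prod.fst_sum, Prod.smul_fst, h0, smul_zero, add_zero]
      funext j
      simp [ex, Pi.single_apply, Finset.sum_apply]
    · simp [ex, et, Prod.snd_sum]
  conv_lhs => rw [this]
  simp only [Dv, map_add, map_sum, map_smul, smul_eq_mul]

theorem reg_LB (n : ℕ) : ∀ {κ : Type} [Fintype κ] {l : Filter Λ} {O : Set (E2 d)} (_ : IsOpen O)
    {B : Λ → κ → κ → Fin d → E2 d → ℝ} (_ : ∀ k m j, LBI l O (fun a => B a k m j))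
    {C : Λ → κ → κ → E2 d → ℝ} (_ : ∀ k m, LBI l O (fun a => C a k m))
    {U : Λ → κ → E2 d → ℝ} (_ : ∀ k, ∀ᶠ a in l, ContDiffOn ℝ ∞ (U a k) O)
    (_ : ∀ᶠ a in l, PEq O (B a) (C a) (U a)) (_ : ∀ k, LB l O 0 (fun a => U a k)) (k : κ),
    LB l O n (fun a => U a k) := by
  induction n with
  | zero => intro κ _ l O hO B hB C hC U hU h h0 k; exact h0 k
  | succ n ih =>
    intro κ _ l O hO B hB C hC U hU h h0 k
    have g1 := xB_LBI hB
    have g2 := xC_LBI hO hB hC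
    have g3 := xU_smooth hO hU
    have g4 := ext_ev hO hB hC hU h
    have g5 : ∀ k, LB l O 0 (fun a => xU (U a) k) := by
      rintro (k | q)
      · exact h0 k
      · exact bern_LB hO hB hC hU h h0 _ _
    have f1 := xB_LBI g1
    have f2 := xC_LBI hO g1 g2
    have f3 := xU_smooth hO g3
    have f4 := ext_ev hO g1 g2 g3 g4
    have f5 : ∀ k, LB l O 0 (fun a => xU (xU (U a)) k) := by
      rintro (k | q)
      · exact g5 k
      · exact bern_LB hO g1 g2 g3 g4 g5 _ _
    have R := ih hO f1 f2 f3 f4 f5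
    have r1 : ∀ i k, LB l O n (fun a => Dv (ex i) (U a k)) := fun i k => R (.inr (.inl k, i))
    have r2 : ∀ i k, LB l O n (fun a => Dv (ex i) (Dv (ex i) (U a k))) :=
      fun i k => R (.inr (.inr (k, i), i))
    have r0 : ∀ k, LB l O n (fun a => U a k) := fun k => R (.inl (.inl k))
    have s1 : ∀ i k, ∀ᶠ a in l, ContDiffOn ℝ ∞ (Dv (ex i) (U a k)) O := fun i k =>
      (hU k).mono fun a ha => Dv_smooth hO ha _
    have s2 : ∀ i k, ∀ᶠ a in l, ContDiffOn ℝ ∞ (Dv (ex i) (Dv (ex i) (U a k))) O := fun i k =>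
      (s1 i k).mono fun a ha => Dv_smooth hO ha _
    have t1 : ∀ m j, ∀ᶠ a in l, ContDiffOn ℝ ∞ (fun p => B a k m j p * Dv (ex j) (U a m) p) O :=
      fun m j => by filter_upwards [(hB k m j).1, s1 j m] with a h1 h2 using h1.mul h2
    have t2 : ∀ m, ∀ᶠ a in l, ContDiffOn ℝ ∞ (fun p => C a k m p * U a m p) O :=
      fun m => by filter_upwards [(hC k m).1, hU m] with a h1 h2 using h1.mul h2
    have rt : LB l O n (fun a => Dv et (U a k)) := by
      have : LB l O n (fun a p => ((∑ i, Dv (ex i) (Dv (ex i) (U a k)) p)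
          + (∑ m, ∑ j, B a k m j p * Dv (ex j) (U a m) p)) + ∑ m, C a k m p * U a m p) := by
        have w1 : ∀ᶠ a in l, ContDiffOn ℝ ∞ (fun p => ∑ i, Dv (ex i) (Dv (ex i) (U a k)) p) O :=
          (ev_all fun i => s2 i k).mono fun a ha => ContDiffOn.sum fun i _ => ha i
        have w2' : ∀ m, ∀ᶠ a in l, ContDiffOn ℝ ∞
            (fun p => ∑ j, B a k m j p * Dv (ex j) (U a m) p) O := fun m =>
          (ev_all fun j => t1 m j).mono fun a ha => ContDiffOn.sum fun i _ => ha i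
        have w2 : ∀ᶠ a in l, ContDiffOn ℝ ∞
            (fun p => ∑ m, ∑ j, B a k m j p * Dv (ex j) (U a m) p) O :=
          (ev_all w2').mono fun a ha => ContDiffOn.sum fun i _ => ha i
        have w3 : ∀ᶠ a in l, ContDiffOn ℝ ∞ (fun p => ∑ m, C a k m p * U a m p) O :=
          (ev_all t2).mono fun a ha => ContDiffOn.sum fun i _ => ha i
        refine LB.add hO (by filter_upwards [w1, w2] with a h1 h2 using h1.add h2) w3
          (LB.add hO w1 w2 ?_ ?_) ?_
        · exact LB.sum hO _ (f := fun i a => Dv (ex i) (Dv (ex i) (U a k)))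
            (fun i _ => s2 i k) (fun i _ => r2 i k)
        · refine LB.sum hO _ (f := fun m a p => ∑ j, B a k m j p * Dv (ex j) (U a m) p)
            (fun m _ => w2' m) (fun m _ => ?_)
          exact LB.sum hO _ (f := fun j a p => B a k m j p * Dv (ex j) (U a m) p)
            (fun j _ => t1 m j) (fun j _ => LB.mul hO (hB k m j).1 (s1 j m) ((hB k m j).2 n) (r1 j m))
        · exact LB.sum hO _ (f := fun m a p => C a k m p * U a m p)
            (fun m _ => t2 m) (fun m _ => LB.mul hO (hC k m).1 (hU m) ((hC k m).2 n) (r0 m))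
      refine this.congr hO (h.mono fun a ha p hp => (ha p hp k).symm)
    have st : ∀ᶠ a in l, ContDiffOn ℝ ∞ (Dv et (U a k)) O :=
      (hU k).mono fun a ha => Dv_smooth hO ha _
    refine ⟨h0 k, fun v => ?_⟩
    have cs : ∀ (c : ℝ) (g : Λ → E2 d → ℝ), (∀ᶠ a in l, ContDiffOn ℝ ∞ (g a) O) →
        LB l O n g → (∀ᶠ a in l, ContDiffOn ℝ ∞ (fun p => c * g a p) O) ∧
          LB l O n (fun a p => c * g a p) := by
      intro c g sg hg
      have hc : ∀ (n : ℕ) (c : ℝ), LB l O n (fun (_ : Λ) (_ : E2 d) => c) := by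
        intro n c
        have z : ∀ p ∈ O, (fun z : E2 d × Λ => c) =O[𝓝 p ×ˢ l] (fun _ => (1:ℝ)) :=
          fun p _ => isBigO_const_const _ one_ne_zero _
        cases n with
        | zero => exact z
        | succ n =>
          refine ⟨z, fun v => ?_⟩
          have : Dv v (fun _ : E2 d => c) = fun _ => 0 := funext fun p => Dv_const c v p
          simp only [this]; exact LB.zero_fun n
      exact ⟨sg.mono fun a ha => contDiffOn_const.mul ha,
        LB.mul hO (Eventually.of_forall fun _ => contDiffOn_const) sg (hc n c) hg⟩
    have : LB l O n (fun a p => (∑ i, v.1 i * Dv (ex i) (U a k) p) + v.2 * Dv et (U a k) p) := by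
      refine LB.add hO ?_ (cs _ _ st rt).1 ?_ (cs _ _ st rt).2
      · exact (ev_all fun i => (cs (v.1 i) _ (s1 i k) (r1 i k)).1).mono fun a ha =>
          ContDiffOn.sum fun i _ => ha i
      · exact LB.sum hO _ (f := fun i a p => v.1 i * Dv (ex i) (U a k) p)
            (fun i _ => (cs (v.1 i) _ (s1 i k) (r1 i k)).1)
            (fun i _ => (cs (v.1 i) _ (s1 i k) (r1 i k)).2)
    exact this.congr hO (Eventually.of_forall fun a p _ => (Dv_decomp _ _ _).symm)

theorem reg_LBI {l : Filter Λ} {O : Set (E2 d)} (hO : IsOpen O)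
    {B : Λ → κ → κ → Fin d → E2 d → ℝ} (hB : ∀ k m j, LBI l O (fun a => B a k m j))
    {C : Λ → κ → κ → E2 d → ℝ} (hC : ∀ k m, LBI l O (fun a => C a k m))
    {U : Λ → κ → E2 d → ℝ} (hU : ∀ k, ∀ᶠ a in l, ContDiffOn ℝ ∞ (U a k) O)
    (h : ∀ᶠ a in l, PEq O (B a) (C a) (U a)) (h0 : ∀ k, LB l O 0 (fun a => U a k)) (k : κ) :
    LBI l O (fun a => U a k) := ⟨hU k, fun n => reg_LB n hO hB hC hU h h0 k⟩

end PR
end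


section
open scoped Topology ContDiff
open Filter Asymptotics
set_option linter.unusedSectionVars false
namespace PR

/-- slice in the parameter -/
def sl {E : Type*} (F : E × ℝ → ℝ) (τ : ℝ) : E → ℝ := fun p => F (p, τ)

section gen
variable {E : Type*} [NormedAddCommGroup E] [NormedSpace ℝ E] [FiniteDimensional ℝ E]

/-- partial directional derivative -/
noncomputable def Dx (v : E) (F : E × ℝ → ℝ) : E × ℝ → ℝ := fun z => Dv v (sl F z.2) z.1

/-- parameter derivative -/
noncomputable def Dp (F : E × ℝ → ℝ) : E × ℝ → ℝ := fun z => deriv (fun s => F (z.1, s)) z.2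

variable {O : Set E} {J : Set ℝ}

theorem Dx_eq {F : E × ℝ → ℝ} {z : E × ℝ} (h : DifferentiableAt ℝ F z) (v : E) :
    Dx v F z = Dv (v, 0) F z := by
  have h1 : HasFDerivAt (fun p : E => (p, z.2)) (ContinuousLinearMap.inl ℝ E ℝ) z.1 :=
    hasFDerivAt_prodMk_left z.1 z.2
  have h2 : HasFDerivAt F (fderiv ℝ F z) (z.1, z.2) := h.hasFDerivAt
  have := HasFDerivAt.comp z.1 h2 h1
  have h3 : fderiv ℝ (sl F z.2) z.1 = _ := this.fderiv
  simp only [Dx, Dv]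
  rw [h3]; simp

theorem hasDeriv_p {F : E × ℝ → ℝ} {z : E × ℝ} (h : DifferentiableAt ℝ F z) :
    HasDerivAt (fun s => F (z.1, s)) (Dv (0, 1) F z) z.2 := by
  have h1 : HasFDerivAt (fun s : ℝ => (z.1, s)) (ContinuousLinearMap.inr ℝ E ℝ) z.2 :=
    hasFDerivAt_prodMk_right z.1 z.2
  have h2 : HasFDerivAt F (fderiv ℝ F z) (z.1, z.2) := h.hasFDerivAt
  have h3 : HasFDerivAt (fun s => F (z.1, s))
    ((fderiv ℝ F z).comp (ContinuousLinearMap.inr ℝ E ℝ)) z.2 := HasFDerivAt.comp z.2 h2 h1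
  exact h3.hasDerivAt.congr_deriv (by simp [Dv])

theorem Dp_eq {F : E × ℝ → ℝ} {z : E × ℝ} (h : DifferentiableAt ℝ F z) :
    Dp F z = Dv (0, 1) F z := (hasDeriv_p h).deriv

theorem Dx_smooth (hO : IsOpen O) (hJ : IsOpen J) {F : E × ℝ → ℝ}
    (hF : ContDiffOn ℝ ∞ F (O ×ˢ J)) (v : E) : ContDiffOn ℝ ∞ (Dx v F) (O ×ˢ J) :=
  (Dv_smooth (hO.prod hJ) hF (v, 0)).congr fun _ hz => Dx_eq (Sm.diff (hO.prod hJ) hF hz) v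

theorem Dp_smooth (hO : IsOpen O) (hJ : IsOpen J) {F : E × ℝ → ℝ}
    (hF : ContDiffOn ℝ ∞ F (O ×ˢ J)) : ContDiffOn ℝ ∞ (Dp F) (O ×ˢ J) :=
  (Dv_smooth (hO.prod hJ) hF (0, 1)).congr fun _ hz => Dp_eq (Sm.diff (hO.prod hJ) hF hz)

theorem Dp_contDiff (hO : IsOpen O) (hJ : IsOpen J) {F : E × ℝ → ℝ} {m : ℕ}
    (hF : ContDiffOn ℝ (m+1 : ℕ) F (O ×ˢ J)) : ContDiffOn ℝ m (Dp F) (O ×ˢ J) := by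
  have h1 : ContDiffOn ℝ m (fderiv ℝ F) (O ×ˢ J) :=
    hF.fderiv_of_isOpen (hO.prod hJ) (by norm_cast)
  have h2 : ContDiffOn ℝ m (Dv (0, 1) F) (O ×ˢ J) := h1.clm_apply contDiffOn_const
  refine h2.congr fun z hz => Dp_eq ?_
  exact (hF.contDiffAt ((hO.prod hJ).mem_nhds hz)).differentiableAt (by simp)

theorem sl_smooth {F : E × ℝ → ℝ} (hF : ContDiffOn ℝ ∞ F (O ×ˢ J)) {τ : ℝ} (hτ : τ ∈ J) :
    ContDiffOn ℝ ∞ (sl F τ) O := by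
  have : ContDiffOn ℝ ∞ (fun p : E => (p, τ)) O := by fun_prop
  exact hF.comp this fun p hp => ⟨hp, hτ⟩

theorem LB.comp_tendsto {Λ Λ' : Type*} {l : Filter Λ} {l' : Filter Λ'} {φ : Λ' → Λ}
    (hφ : Tendsto φ l' l) : ∀ (n : ℕ) {g : Λ → E → ℝ}, LB l O n g → LB l' O n (fun a => g (φ a)) := by
  have z : ∀ {g : Λ → E → ℝ}, LB l O 0 g → LB l' O 0 (fun a => g (φ a)) := by
    intro g h p hp
    exact (h p hp).comp_tendsto (k := fun z : E × Λ' => (z.1, φ z.2)) (tendsto_id.prodMap hφ)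
  intro n
  induction n with
  | zero => exact z
  | succ n ih => exact fun h => ⟨z (g := _) h.zero, fun v => ih (h.2 v)⟩

theorem LBI.comp_tendsto {Λ Λ' : Type*} {l : Filter Λ} {l' : Filter Λ'} {φ : Λ' → Λ}
    (hφ : Tendsto φ l' l) {g : Λ → E → ℝ} (h : LBI l O g) : LBI l' O (fun a => g (φ a)) :=
  ⟨hφ.eventually h.1, fun n => (h.2 n).comp_tendsto hφ⟩

theorem LB0_of_cont (hO : IsOpen O) (hJ : IsOpen J) {F : E × ℝ → ℝ} (hF : ContinuousOn F (O ×ˢ J))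
    {τ : ℝ} (hτ : τ ∈ J) : LB (𝓝 τ) O 0 (fun s => sl F s) := by
  intro p hp
  have h1 : ContinuousAt F (p, τ) := hF.continuousAt ((hO.prod hJ).mem_nhds ⟨hp, hτ⟩)
  have h2 : Tendsto F (𝓝 p ×ˢ 𝓝 τ) (𝓝 (F (p, τ))) := by rw [← nhds_prod_eq]; exact h1
  exact h2.isBigO_one ℝ

theorem coef_LBI (hO : IsOpen O) (hJ : IsOpen J) {F : E × ℝ → ℝ}
    (hF : ContDiffOn ℝ ∞ F (O ×ˢ J)) {τ : ℝ} (hτ : τ ∈ J) : LBI (𝓝 τ) O (fun s => sl F s) := by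
  refine ⟨(hJ.mem_nhds hτ |> fun h => Filter.mem_of_superset h fun s hs => sl_smooth hF hs), ?_⟩
  intro n
  induction n generalizing F with
  | zero => exact LB0_of_cont hO hJ hF.continuousOn hτ
  | succ n ih =>
    refine ⟨LB0_of_cont hO hJ hF.continuousOn hτ, fun v => ?_⟩
    exact ih (Dx_smooth hO hJ hF v)

/-- difference quotient -/
noncomputable def dq (F : E × ℝ → ℝ) (τ h : ℝ) : E → ℝ :=
  fun p => h⁻¹ * (F (p, τ + h) - F (p, τ))

theorem ev_J (hJ : IsOpen J) {τ : ℝ} (hτ : τ ∈ J) : ∀ᶠ h in 𝓝[≠] (0:ℝ), τ + h ∈ J := by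
  have : Tendsto (fun h : ℝ => τ + h) (𝓝[≠] 0) (𝓝 τ) := by
    have : Tendsto (fun h : ℝ => τ + h) (𝓝 0) (𝓝 (τ + 0)) := tendsto_const_nhds.add tendsto_id
    rw [add_zero] at this
    exact this.mono_left nhdsWithin_le_nhds
  exact this.eventually (hJ.mem_nhds hτ)

theorem dq_smooth {F : E × ℝ → ℝ} {τ h : ℝ} (h1 : ContDiffOn ℝ ∞ (sl F τ) O)
    (h2 : ContDiffOn ℝ ∞ (sl F (τ + h)) O) : ContDiffOn ℝ ∞ (dq F τ h) O :=
  contDiffOn_const.mul (h2.sub h1)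

theorem Dv_dq {F : E × ℝ → ℝ} {τ h : ℝ} {p : E} (h1 : DifferentiableAt ℝ (sl F τ) p)
    (h2 : DifferentiableAt ℝ (sl F (τ + h)) p) (v : E) :
    Dv v (dq F τ h) p = dq (Dx v F) τ h p := by
  have : HasFDerivAt (dq F τ h) (h⁻¹ • (fderiv ℝ (sl F (τ + h)) p - fderiv ℝ (sl F τ) p)) p :=
    (h2.hasFDerivAt.sub h1.hasFDerivAt).const_mul h⁻¹
  simp only [Dv, this.fderiv]
  simp [dq, Dx, Dv]

theorem dq_LB0 (hO : IsOpen O) (hJ : IsOpen J) {F : E × ℝ → ℝ} (hF : ContDiffOn ℝ 1 F (O ×ˢ J))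
    {τ : ℝ} (hτ : τ ∈ J) : LB (𝓝[≠] (0:ℝ)) O 0 (fun h => dq F τ h) := by
  intro p hp
  have h1 : ContDiffAt ℝ 1 F (p, τ) := hF.contDiffAt ((hO.prod hJ).mem_nhds ⟨hp, hτ⟩)
  obtain ⟨K, s, hs, hl⟩ := h1.exists_lipschitzOnWith
  have t1 : Tendsto (fun z : E × ℝ => (z.1, τ + z.2)) (𝓝 p ×ˢ 𝓝[≠] (0:ℝ)) (𝓝 (p, τ)) := by
    have : Tendsto (fun z : E × ℝ => (z.1, τ + z.2)) (𝓝 (p, 0)) (𝓝 (p, τ)) := by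
      have : Continuous (fun z : E × ℝ => (z.1, τ + z.2)) := by fun_prop
      simpa using this.tendsto (p, 0)
    refine this.mono_left ?_
    rw [nhds_prod_eq]; exact prod_mono_right _ nhdsWithin_le_nhds
  have t2 : Tendsto (fun z : E × ℝ => (z.1, τ)) (𝓝 p ×ˢ 𝓝[≠] (0:ℝ)) (𝓝 (p, τ)) := by
    rw [nhds_prod_eq]; exact tendsto_fst.prodMk tendsto_const_nhds
  have t3 : ∀ᶠ z : E × ℝ in 𝓝 p ×ˢ 𝓝[≠] (0:ℝ), z.2 ≠ 0 :=
    tendsto_snd.eventually self_mem_nhdsWithin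
  refine IsBigO.of_bound K ?_
  filter_upwards [t1.eventually hs, t2.eventually hs, t3] with z a1 a2 a3
  have := hl.dist_le_mul _ a1 _ a2
  rw [Prod.dist_eq, dist_self, max_eq_right dist_nonneg, Real.dist_eq, Real.dist_eq,
    add_sub_cancel_left] at this
  simp only [dq, norm_mul, norm_inv, Real.norm_eq_abs, abs_one, mul_one]
  rw [inv_mul_le_iff₀ (abs_pos.2 a3), mul_comm]; exact this

theorem dq_LBI (hO : IsOpen O) (hJ : IsOpen J) {F : E × ℝ → ℝ} (hF : ContDiffOn ℝ ∞ F (O ×ˢ J))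
    {τ : ℝ} (hτ : τ ∈ J) : LBI (𝓝[≠] (0:ℝ)) O (fun h => dq F τ h) := by
  refine ⟨(ev_J hJ hτ).mono fun h hh => dq_smooth (sl_smooth hF hτ) (sl_smooth hF hh), ?_⟩
  intro n
  induction n generalizing F with
  | zero => exact dq_LB0 hO hJ (hF.of_le (by exact_mod_cast le_top)) hτ
  | succ n ih =>
    refine ⟨dq_LB0 hO hJ (hF.of_le (by exact_mod_cast le_top)) hτ, fun v => ?_⟩
    refine (ih (Dx_smooth hO hJ hF v)).congr hO ((ev_J hJ hτ).mono fun h hh p hp => ?_)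
    exact (Dv_dq (Sm.diff hO (sl_smooth hF hτ) hp) (Sm.diff hO (sl_smooth hF hh) hp) v).symm

theorem dq_tendsto {F : E × ℝ → ℝ} {p : E} {τ c : ℝ} :
    Tendsto (fun h => dq F τ h p) (𝓝[≠] (0:ℝ)) (𝓝 c) ↔ HasDerivAt (fun s => F (p, s)) c τ := by
  rw [hasDerivAt_iff_tendsto_slope_zero]; rfl

/-- partial derivatives continuous gives joint regularity -/
theorem joint_succ (hO : IsOpen O) (hJ : IsOpen J) {m : ℕ} {G D : E × ℝ → ℝ}
    (h1 : ∀ τ ∈ J, ContDiffOn ℝ ∞ (sl G τ) O) (h2 : ∀ v, ContDiffOn ℝ m (Dx v G) (O ×ˢ J))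
    (h3 : ∀ p ∈ O, ∀ τ ∈ J, HasDerivAt (fun s => G (p, s)) (D (p, τ)) τ)
    (h4 : ContDiffOn ℝ m D (O ×ˢ J)) : ContDiffOn ℝ (m + 1 : ℕ) G (O ×ˢ J) := by
  have hOJ := hO.prod hJ
  have key : ∀ z ∈ O ×ˢ J, HasFDerivAt G ((fderiv ℝ (sl G z.2) z.1).coprod
      (ContinuousLinearMap.toSpanSingleton ℝ (D z))) z := by
    intro z hz
    have c1 : ContinuousAt (fun z : E × ℝ => fderiv ℝ (sl G z.2) z.1) z := by
      have : ContinuousOn (fun z : E × ℝ => fderiv ℝ (sl G z.2) z.1) (O ×ˢ J) :=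
        continuousOn_clm_apply.2 fun v => (h2 v).continuousOn
      exact this.continuousAt (hOJ.mem_nhds hz)
    have c2 : ContinuousAt (fun z : E × ℝ => ContinuousLinearMap.toSpanSingleton ℝ (D z)) z := by
      have : ContinuousOn (fun z : E × ℝ => ContinuousLinearMap.toSpanSingleton ℝ (D z)) (O ×ˢ J) :=
        continuousOn_clm_apply.2 fun v => by
          have h5 : ContinuousOn (fun z => v * D z) (O ×ˢ J) :=
            continuousOn_const.mul h4.continuousOn
          simpa using h5
      exact this.continuousAt (hOJ.mem_nhds hz)
    have := hasStrictFDerivAt_uncurry_coprod (𝕜 := ℝ) (u := z) (f := fun p τ => G (p, τ))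
      (f₁ := fun p τ => fderiv ℝ (sl G τ) p)
      (f₂ := fun p τ => ContinuousLinearMap.toSpanSingleton ℝ (D (p, τ)))
      (by
        filter_upwards [hOJ.mem_nhds hz] with w hw
        exact (Sm.diff hO (h1 w.2 hw.2) hw.1).hasFDerivAt)
      (by
        filter_upwards [hOJ.mem_nhds hz] with w hw
        exact (h3 w.1 hw.1 w.2 hw.2).hasFDerivAt) c1 c2
    exact this.hasFDerivAt
  push_cast
  refine contDiff_of_Dv hOJ (fun z hz => (key z hz).differentiableAt) fun w => ?_
  have : ContDiffOn ℝ m (fun z => Dx w.1 G z + w.2 * D z) (O ×ˢ J) :=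
    (h2 w.1).add (contDiffOn_const.mul h4)
  refine this.congr fun z hz => ?_
  simp only [Dv, (key z hz).fderiv]
  simp [Dx, Dv]

end gen
end PR
end


section
open scoped Topology ContDiff
open Filter Asymptotics
set_option linter.unusedSectionVars false
namespace PR

variable {d : ℕ} {κ : Type} [Fintype κ]

/-- a parametrised linear parabolic system with smooth coefficients -/
structure Sys (O : Set (E2 d)) (J : Set ℝ) (B : κ → κ → Fin d → E2 d × ℝ → ℝ)
    (C : κ → κ → E2 d × ℝ → ℝ) (U : κ → E2 d × ℝ → ℝ) : Prop where
  hB : ∀ k l j, ContDiffOn ℝ ∞ (B k l j) (O ×ˢ J)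
  hC : ∀ k l, ContDiffOn ℝ ∞ (C k l) (O ×ˢ J)
  hU : ∀ τ ∈ J, ∀ k, ContDiffOn ℝ ∞ (sl (U k) τ) O
  heq : ∀ τ ∈ J, PEq O (fun k l j => sl (B k l j) τ) (fun k l => sl (C k l) τ)
    (fun k => sl (U k) τ)

/-- joint version of `xB` -/
noncomputable def jB (B : κ → κ → Fin d → E2 d × ℝ → ℝ) :
    (κ ⊕ κ × Fin d) → (κ ⊕ κ × Fin d) → Fin d → E2 d × ℝ → ℝ :=
  fun k l j z => xB (fun k l j => sl (B k l j) z.2) k l j z.1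

/-- joint version of `xC` -/
noncomputable def jC (B : κ → κ → Fin d → E2 d × ℝ → ℝ) (C : κ → κ → E2 d × ℝ → ℝ) :
    (κ ⊕ κ × Fin d) → (κ ⊕ κ × Fin d) → E2 d × ℝ → ℝ :=
  fun k l z => xC (fun k l j => sl (B k l j) z.2) (fun k l => sl (C k l) z.2) k l z.1

/-- joint version of `xU` -/
noncomputable def jU (U : κ → E2 d × ℝ → ℝ) : (κ ⊕ κ × Fin d) → E2 d × ℝ → ℝ
  | .inl k => U k
  | .inr q => Dx (ex q.2) (U q.1)

variable {O : Set (E2 d)} {J : Set ℝ} {B : κ → κ → Fin d → E2 d × ℝ → ℝ}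
    {C : κ → κ → E2 d × ℝ → ℝ} {U : κ → E2 d × ℝ → ℝ}

theorem Sys.ext (hO : IsOpen O) (hJ : IsOpen J) (S : Sys O J B C U) :
    Sys O J (jB B) (jC B C) (jU U) where
  hB := by
    rintro (k | q) (m | q') j
    · exact S.hB k m j
    · exact contDiffOn_const
    · exact contDiffOn_const
    · by_cases h : q'.2 = q.2
      · have : jB B (.inr q) (.inr q') j = B q.1 q'.1 j := by
          funext z; simp [jB, xB, h, sl]
        rw [this]; exact S.hB _ _ _
      · have : jB B (.inr q) (.inr q') j = fun _ => 0 := by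
          funext z; simp [jB, xB, h]
        rw [this]; exact contDiffOn_const
  hC := by
    rintro (k | q) (m | q')
    · exact S.hC k m
    · exact contDiffOn_const
    · exact Dx_smooth hO hJ (S.hC q.1 m) (ex q.2)
    · by_cases h : q'.2 = q.2
      · have : jC B C (.inr q) (.inr q') = fun z => Dx (ex q.2) (B q.1 q'.1 q'.2) z
            + C q.1 q'.1 z := by
          funext z; simp [jC, xC, h, sl, Dx]
        rw [this]; exact (Dx_smooth hO hJ (S.hB _ _ _) _).add (S.hC _ _)
      · have : jC B C (.inr q) (.inr q') = fun z => Dx (ex q.2) (B q.1 q'.1 q'.2) z := by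
          funext z; simp [jC, xC, h, Dx]
        rw [this]; exact (Dx_smooth hO hJ (S.hB _ _ _) _)
  hU := by
    rintro τ hτ (k | q)
    · exact S.hU τ hτ k
    · exact Dv_smooth hO (S.hU τ hτ q.1) _
  heq := by
    intro τ hτ
    have := (S.heq τ hτ).ext hO (fun k l j => sl_smooth (S.hB k l j) hτ)
      (fun k l => sl_smooth (S.hC k l) hτ) (S.hU τ hτ)
    have e : (fun k => sl (jU U k) τ) = xU (fun k => sl (U k) τ) := by
      funext k; rcases k with k | q <;> rfl
    rw [e]; exact this

theorem Sys.U_LBI (hO : IsOpen O) (hJ : IsOpen J) (S : Sys O J B C U)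
    (hc : ∀ k, ContinuousOn (U k) (O ×ˢ J)) {τ : ℝ} (hτ : τ ∈ J) (k : κ) :
    LBI (𝓝 τ) O (fun s => sl (U k) s) := by
  have hev : ∀ᶠ s in 𝓝 τ, s ∈ J := hJ.mem_nhds hτ
  exact reg_LBI hO (B := fun s k l j => sl (B k l j) s) (C := fun s k l => sl (C k l) s)
    (U := fun s k => sl (U k) s)
    (fun k l j => coef_LBI hO hJ (S.hB k l j) hτ) (fun k l => coef_LBI hO hJ (S.hC k l) hτ)
    (fun k => hev.mono fun s hs => S.hU s hs k) (hev.mono fun s hs => S.heq s hs)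
    (fun k => LB0_of_cont hO hJ (hc k) hτ) k

theorem Sys.Dx_cont (hO : IsOpen O) (hJ : IsOpen J) (S : Sys O J B C U)
    (hc : ∀ k, ContinuousOn (U k) (O ×ˢ J)) (k : κ) (v : E2 d) :
    ContinuousOn (Dx v (U k)) (O ×ˢ J) := by
  rintro ⟨p, τ⟩ ⟨hp, hτ⟩
  refine ContinuousAt.continuousWithinAt ?_
  have h1 := S.U_LBI hO hJ hc hτ k
  have h2 : ∀ p ∈ O, Tendsto (fun s => sl (U k) s p) (𝓝 τ) (𝓝 (sl (U k) τ p)) := by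
    intro p hp
    have : ContinuousAt (U k) (p, τ) := (hc k).continuousAt ((hO.prod hJ).mem_nhds ⟨hp, hτ⟩)
    exact this.tendsto.comp (f := fun s => (p, s)) (Continuous.tendsto (by fun_prop) τ)
  have h3 := (limit_smooth hO h1 h2).2 p hp v
  have h4 := h1.Dv hO v
  have := tendsto_joint hO h4.1 (h4.2 1) hp h3
  rw [← nhds_prod_eq] at this
  exact this

/-- coefficients for the difference quotient system -/
noncomputable def qB (B : κ → κ → Fin d → E2 d × ℝ → ℝ) (τ h : ℝ) :
    (κ ⊕ κ) → (κ ⊕ κ) → Fin d → E2 d → ℝ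
  | .inl k, .inl l, j => sl (B k l j) τ
  | .inl k, .inr l, j => dq (B k l j) τ h
  | .inr k, .inr l, j => sl (B k l j) (τ + h)
  | .inr _, .inl _, _ => fun _ => 0

/-- coefficients for the difference quotient system -/
noncomputable def qC (C : κ → κ → E2 d × ℝ → ℝ) (τ h : ℝ) :
    (κ ⊕ κ) → (κ ⊕ κ) → E2 d → ℝ
  | .inl k, .inl l => sl (C k l) τ
  | .inl k, .inr l => dq (C k l) τ h
  | .inr k, .inr l => sl (C k l) (τ + h)
  | .inr _, .inl _ => fun _ => 0

/-- unknown for the difference quotient system -/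
noncomputable def qU (U : κ → E2 d × ℝ → ℝ) (τ h : ℝ) : (κ ⊕ κ) → E2 d → ℝ
  | .inl k => dq (U k) τ h
  | .inr k => sl (U k) (τ + h)

theorem Sys.qeq (hO : IsOpen O) (S : Sys O J B C U) {τ h : ℝ} (hτ : τ ∈ J)
    (hh : τ + h ∈ J) : PEq O (qB B τ h) (qC C τ h) (qU U τ h) := by
  intro p hp k
  rcases k with k | k
  · have D1 : ∀ k v, Set.EqOn (Dv v (dq (U k) τ h)) (dq (Dx v (U k)) τ h) O := fun k v p hp =>
      Dv_dq (Sm.diff hO (S.hU τ hτ k) hp) (Sm.diff hO (S.hU _ hh k) hp) v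
    have D2 : ∀ k v, Dv v (Dv v (dq (U k) τ h)) p = dq (Dx v (Dx v (U k))) τ h p := fun k v => by
      rw [Dv_congr hO (D1 k v) v hp]
      exact Dv_dq (F := Dx v (U k)) (Sm.diff hO (Dv_smooth hO (S.hU τ hτ k) v) hp)
        (Sm.diff hO (Dv_smooth hO (S.hU _ hh k) v) hp) v
    simp only [Fintype.sum_sum_type, qB, qC, qU, D2, D1 _ _ hp]
    have E1 := S.heq τ hτ p hp k
    have E2 := S.heq _ hh p hp k
    have T : dq (Dx et (U k)) τ h p = h⁻¹ * (Dv et (sl (U k) (τ + h)) p - Dv et (sl (U k) τ) p) :=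
      rfl
    rw [T, E1, E2]
    have e1 : ∑ x, dq (Dx (ex x) (Dx (ex x) (U k))) τ h p = h⁻¹ *
        ((∑ x, Dv (ex x) (Dv (ex x) (sl (U k) (τ + h))) p)
          - ∑ x, Dv (ex x) (Dv (ex x) (sl (U k) τ)) p) := by
      rw [← Finset.sum_sub_distrib, Finset.mul_sum]; rfl
    have e2 : (∑ l, ∑ j, sl (B k l j) τ p * dq (Dx (ex j) (U l)) τ h p)
        + (∑ l, ∑ j, dq (B k l j) τ h p * Dv (ex j) (sl (U l) (τ + h)) p) = h⁻¹ *
        ((∑ l, ∑ j, sl (B k l j) (τ + h) p * Dv (ex j) (sl (U l) (τ + h)) p)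
          - ∑ l, ∑ j, sl (B k l j) τ p * Dv (ex j) (sl (U l) τ) p) := by
      rw [← Finset.sum_sub_distrib, Finset.mul_sum, ← Finset.sum_add_distrib]
      refine Finset.sum_congr rfl fun l _ => ?_
      rw [← Finset.sum_sub_distrib, Finset.mul_sum, ← Finset.sum_add_distrib]
      refine Finset.sum_congr rfl fun j _ => ?_
      simp only [dq, Dx, sl]; ring
    have e3 : (∑ l, sl (C k l) τ p * dq (U l) τ h p)
        + (∑ l, dq (C k l) τ h p * sl (U l) (τ + h) p) = h⁻¹ *
        ((∑ l, sl (C k l) (τ + h) p * sl (U l) (τ + h) p)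
          - ∑ l, sl (C k l) τ p * sl (U l) τ p) := by
      rw [← Finset.sum_sub_distrib, Finset.mul_sum, ← Finset.sum_add_distrib]
      refine Finset.sum_congr rfl fun l _ => ?_
      simp only [dq, sl]; ring
    rw [e1, e2, e3]; ring
  · simp only [Fintype.sum_sum_type, qB, qC, qU, zero_mul, Finset.sum_const_zero, zero_add]
    exact S.heq _ hh p hp k

theorem Sys.dq_U_LBI (hO : IsOpen O) (hJ : IsOpen J) (S : Sys O J B C U)
    (hc : ∀ k, ContDiffOn ℝ 1 (U k) (O ×ˢ J)) {τ : ℝ} (hτ : τ ∈ J) (k : κ) :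
    LBI (𝓝[≠] (0:ℝ)) O (fun h => dq (U k) τ h) := by
  have hev := ev_J hJ hτ
  have t0 : Tendsto (fun _ : ℝ => τ) (𝓝[≠] (0:ℝ)) (𝓝 τ) := tendsto_const_nhds
  have t1 : Tendsto (fun h : ℝ => τ + h) (𝓝[≠] (0:ℝ)) (𝓝 τ) := by
    have : Tendsto (fun h : ℝ => τ + h) (𝓝 0) (𝓝 (τ + 0)) := tendsto_const_nhds.add tendsto_id
    rw [add_zero] at this
    exact this.mono_left nhdsWithin_le_nhds
  have := reg_LBI hO (l := 𝓝[≠] (0:ℝ)) (B := fun h => qB B τ h) (C := fun h => qC C τ h)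
    (U := fun h => qU U τ h) ?_ ?_ ?_ (hev.mono fun h hh => S.qeq hO hτ hh) ?_ (.inl k)
  · exact this
  · rintro (k | k) (l | l) j
    · exact (coef_LBI hO hJ (S.hB k l j) hτ).comp_tendsto t0
    · exact dq_LBI hO hJ (S.hB k l j) hτ
    · exact LBI.zero
    · exact (coef_LBI hO hJ (S.hB k l j) hτ).comp_tendsto t1
  · rintro (k | k) (l | l)
    · exact (coef_LBI hO hJ (S.hC k l) hτ).comp_tendsto t0
    · exact dq_LBI hO hJ (S.hC k l) hτ
    · exact LBI.zero
    · exact (coef_LBI hO hJ (S.hC k l) hτ).comp_tendsto t1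
  · rintro (k | k)
    · exact hev.mono fun h hh => dq_smooth (S.hU τ hτ k) (S.hU _ hh k)
    · exact hev.mono fun h hh => (S.hU _ hh k)
  · rintro (k | k)
    · exact dq_LB0 hO hJ (hc k) hτ
    · exact LB.comp_tendsto t1 0 (LB0_of_cont hO hJ (hc k).continuousOn hτ)

theorem Sys.dp (hO : IsOpen O) (hJ : IsOpen J) (S : Sys O J B C U)
    (hc : ∀ k, ContDiffOn ℝ 1 (U k) (O ×ˢ J)) {τ : ℝ} (hτ : τ ∈ J) (k : κ) :
    ContDiffOn ℝ ∞ (sl (Dp (U k)) τ) O ∧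
    ∀ p ∈ O, ∀ v, HasDerivAt (fun s => Dx v (U k) (p, s)) (Dx v (Dp (U k)) (p, τ)) τ ∧
      ∀ w, HasDerivAt (fun s => Dx w (Dx v (U k)) (p, s)) (Dx w (Dx v (Dp (U k))) (p, τ)) τ := by
  have h1 := S.dq_U_LBI hO hJ hc hτ k
  have hev := ev_J hJ hτ
  have hU0 : ∀ p ∈ O, HasDerivAt (fun s => U k (p, s)) (Dp (U k) (p, τ)) τ := by
    intro p hp
    have := ((hc k).contDiffAt ((hO.prod hJ).mem_nhds (show (p, τ) ∈ O ×ˢ J from ⟨hp, hτ⟩)))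
    have := this.differentiableAt (by simp)
    rw [Dp_eq this]; exact hasDeriv_p this
  have L1 := limit_smooth hO h1 (G := sl (Dp (U k)) τ) fun p hp => dq_tendsto.2 (hU0 p hp)
  refine ⟨L1.1, fun p hp v => ⟨?_, fun w => ?_⟩⟩
  · rw [← dq_tendsto]
    refine (L1.2 p hp v).congr' (hev.mono fun h hh => ?_)
    exact Dv_dq (Sm.diff hO (S.hU τ hτ k) hp) (Sm.diff hO (S.hU _ hh k) hp) v
  · have L2 := limit_smooth hO (h1.Dv hO v) (G := Dv v (sl (Dp (U k)) τ)) fun p hp => L1.2 p hp v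
    rw [← dq_tendsto]
    refine (L2.2 p hp w).congr' (hev.mono fun h hh => ?_)
    have D1 : Set.EqOn (Dv v (dq (U k) τ h)) (dq (Dx v (U k)) τ h) O := fun p hp =>
      Dv_dq (Sm.diff hO (S.hU τ hτ k) hp) (Sm.diff hO (S.hU _ hh k) hp) v
    rw [Dv_congr hO D1 w hp]
    exact Dv_dq (F := Dx v (U k)) (Sm.diff hO (Dv_smooth hO (S.hU τ hτ k) v) hp)
        (Sm.diff hO (Dv_smooth hO (S.hU _ hh k) v) hp) w

/-- coefficients of the differentiated system -/
noncomputable def tB (B : κ → κ → Fin d → E2 d × ℝ → ℝ) :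
    (κ ⊕ κ) → (κ ⊕ κ) → Fin d → E2 d × ℝ → ℝ
  | .inl k, .inl l, j => B k l j
  | .inl k, .inr l, j => Dp (B k l j)
  | .inr k, .inr l, j => B k l j
  | .inr _, .inl _, _ => fun _ => 0

/-- coefficients of the differentiated system -/
noncomputable def tC (C : κ → κ → E2 d × ℝ → ℝ) :
    (κ ⊕ κ) → (κ ⊕ κ) → E2 d × ℝ → ℝ
  | .inl k, .inl l => C k l
  | .inl k, .inr l => Dp (C k l)
  | .inr k, .inr l => C k l
  | .inr _, .inl _ => fun _ => 0

/-- unknown of the differentiated system -/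
noncomputable def tU (U : κ → E2 d × ℝ → ℝ) : (κ ⊕ κ) → E2 d × ℝ → ℝ
  | .inl k => Dp (U k)
  | .inr k => U k

theorem Sys.tsys (hO : IsOpen O) (hJ : IsOpen J) (S : Sys O J B C U)
    (hc : ∀ k, ContDiffOn ℝ 1 (U k) (O ×ˢ J)) : Sys O J (tB B) (tC C) (tU U) where
  hB := by
    rintro (k | k) (l | l) j
    · exact S.hB k l j
    · exact Dp_smooth hO hJ (S.hB k l j)
    · exact contDiffOn_const
    · exact S.hB k l j
  hC := by
    rintro (k | k) (l | l)
    · exact S.hC k l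
    · exact Dp_smooth hO hJ (S.hC k l)
    · exact contDiffOn_const
    · exact S.hC k l
  hU := by
    rintro τ hτ (k | k)
    · exact (S.dp hO hJ hc hτ k).1
    · exact S.hU τ hτ k
  heq := by
    rintro τ hτ p hp (k | k)
    · have hz : (p, τ) ∈ O ×ˢ J := ⟨hp, hτ⟩
      have dB : ∀ l j, HasDerivAt (fun s => B k l j (p, s)) (Dp (B k l j) (p, τ)) τ := fun l j => by
        have := Sm.diff (hO.prod hJ) (S.hB k l j) hz
        rw [Dp_eq this]; exact hasDeriv_p this
      have dC : ∀ l, HasDerivAt (fun s => C k l (p, s)) (Dp (C k l) (p, τ)) τ := fun l => by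
        have := Sm.diff (hO.prod hJ) (S.hC k l) hz
        rw [Dp_eq this]; exact hasDeriv_p this
      have dU : ∀ l, HasDerivAt (fun s => U l (p, s)) (Dp (U l) (p, τ)) τ := fun l => by
        have := ((hc l).contDiffAt ((hO.prod hJ).mem_nhds hz)).differentiableAt (by simp)
        rw [Dp_eq this]; exact hasDeriv_p this
      have R : HasDerivAt (fun s => (∑ i, Dx (ex i) (Dx (ex i) (U k)) (p, s))
          + (∑ l, ∑ j, B k l j (p, s) * Dx (ex j) (U l) (p, s)) + ∑ l, C k l (p, s) * U l (p, s))
          ((∑ i, Dx (ex i) (Dx (ex i) (Dp (U k))) (p, τ))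
          + (∑ l, ∑ j, (Dp (B k l j) (p, τ) * Dx (ex j) (U l) (p, τ)
              + B k l j (p, τ) * Dx (ex j) (Dp (U l)) (p, τ)))
          + ∑ l, (Dp (C k l) (p, τ) * U l (p, τ) + C k l (p, τ) * Dp (U l) (p, τ))) τ := by
        refine HasDerivAt.add (HasDerivAt.add ?_ ?_) ?_
        · exact HasDerivAt.fun_sum fun i _ => ((S.dp hO hJ hc hτ k).2 p hp (ex i)).2 (ex i)
        · exact HasDerivAt.fun_sum fun l _ => HasDerivAt.fun_sum fun j _ =>
            (dB l j).mul ((S.dp hO hJ hc hτ l).2 p hp (ex j)).1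
        · exact HasDerivAt.fun_sum fun l _ => (dC l).mul (dU l)
      have Lh := ((S.dp hO hJ hc hτ k).2 p hp et).1
      have ev : (fun s => Dx et (U k) (p, s)) =ᶠ[𝓝 τ] (fun s =>
          (∑ i, Dx (ex i) (Dx (ex i) (U k)) (p, s))
          + (∑ l, ∑ j, B k l j (p, s) * Dx (ex j) (U l) (p, s))
          + ∑ l, C k l (p, s) * U l (p, s)) := by
        filter_upwards [hJ.mem_nhds hτ] with s hs
        exact S.heq s hs p hp k
      have := (R.congr_of_eventuallyEq ev).unique Lh
      simp only [Fintype.sum_sum_type, tB, tC, tU]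
      change Dx et (Dp (U k)) (p, τ) = (∑ i, Dx (ex i) (Dx (ex i) (Dp (U k))) (p, τ))
        + ((∑ l, ∑ j, B k l j (p, τ) * Dx (ex j) (Dp (U l)) (p, τ))
          + (∑ l, ∑ j, Dp (B k l j) (p, τ) * Dx (ex j) (U l) (p, τ)))
        + ((∑ l, C k l (p, τ) * Dp (U l) (p, τ)) + ∑ l, Dp (C k l) (p, τ) * U l (p, τ))
      rw [← this]
      simp only [Finset.sum_add_distrib]
      ring
    · simp only [Fintype.sum_sum_type, tB, tC, tU, sl, zero_mul, Finset.sum_const_zero, zero_add]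
      exact S.heq _ hτ p hp k

theorem Dx_decomp (F : E2 d × ℝ → ℝ) (v : E2 d) (z : E2 d × ℝ) :
    Dx v F z = (∑ i, v.1 i * Dx (ex i) F z) + v.2 * Dx et F z := Dv_decomp _ _ _

/-- the property P(m) -/
def PP (d m : ℕ) : Prop := ∀ {κ : Type} [Fintype κ] {O : Set (E2 d)} {J : Set ℝ}
    {B : κ → κ → Fin d → E2 d × ℝ → ℝ} {C : κ → κ → E2 d × ℝ → ℝ} {U : κ → E2 d × ℝ → ℝ},
    IsOpen O → IsOpen J → Sys O J B C U → (∀ k, ContDiffOn ℝ m (U k) (O ×ˢ J)) →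
    ∀ k i, ContDiffOn ℝ m (Dx (ex i) (U k)) (O ×ˢ J)

theorem PP.jU {m : ℕ} (P : PP d m) (hO : IsOpen O) (hJ : IsOpen J) (S : Sys O J B C U)
    (h : ∀ k, ContDiffOn ℝ m (U k) (O ×ˢ J)) : ∀ k, ContDiffOn ℝ m (PR.jU U k) (O ×ˢ J) := by
  rintro (k | q)
  · exact h k
  · exact P hO hJ S h q.1 q.2

theorem PP.all {m : ℕ} (P : PP d m) (hO : IsOpen O) (hJ : IsOpen J) (S : Sys O J B C U)
    (h : ∀ k, ContDiffOn ℝ m (U k) (O ×ˢ J)) (k : κ) (v : E2 d) :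
    ContDiffOn ℝ m (Dx v (U k)) (O ×ˢ J) := by
  have h1 := P hO hJ S h
  have h2 : ∀ k i, ContDiffOn ℝ m (Dx (ex i) (Dx (ex i) (U k))) (O ×ˢ J) := fun k i =>
    P hO hJ (S.ext hO hJ) (P.jU hO hJ S h) (.inr (k, i)) i
  have h3 : ContDiffOn ℝ m (Dx et (U k)) (O ×ˢ J) := by
    have : ContDiffOn ℝ m (fun z => (∑ i, Dx (ex i) (Dx (ex i) (U k)) z)
          + (∑ l, ∑ j, B k l j z * Dx (ex j) (U l) z) + ∑ l, C k l z * U l z) (O ×ˢ J) := by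
      have hm : (m : WithTop ℕ∞) ≤ ∞ := by exact_mod_cast le_top
      refine ContDiffOn.add (ContDiffOn.add ?_ ?_) ?_
      · exact ContDiffOn.sum fun i _ => h2 k i
      · exact ContDiffOn.sum fun l _ => ContDiffOn.sum fun j _ =>
          ((S.hB k l j).of_le hm).mul (h1 l j)
      · exact ContDiffOn.sum fun l _ => ((S.hC k l).of_le hm).mul (h l)
    exact this.congr fun z hz => S.heq z.2 hz.2 z.1 hz.1 k
  have : ContDiffOn ℝ m (fun z => (∑ i, v.1 i * Dx (ex i) (U k) z) + v.2 * Dx et (U k) z)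
      (O ×ˢ J) :=
    (ContDiffOn.sum fun i _ => contDiffOn_const.mul (h1 k i)).add (contDiffOn_const.mul h3)
  exact this.congr fun z _ => Dx_decomp _ _ _

theorem PP_all (m : ℕ) : PP d m := by
  induction m with
  | zero =>
    intro κ _ O J B C U hO hJ S h k i
    simp only [Nat.cast_zero, contDiffOn_zero] at h ⊢
    exact S.Dx_cont hO hJ h k _
  | succ m ih =>
    intro κ _ O J B C U hO hJ S h k i
    have hm : ∀ k, ContDiffOn ℝ m (U k) (O ×ˢ J) := fun k => (h k).of_le (by norm_cast; omega)
    have h1 : ∀ k, ContDiffOn ℝ 1 (U k) (O ×ˢ J) := fun k => (h k).of_le (by norm_cast; omega)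
    refine joint_succ hO hJ (D := Dx (ex i) (Dp (U k)))
      (fun τ hτ => Dv_smooth hO (S.hU τ hτ k) _) ?_ ?_ ?_
    · exact ih.all hO hJ (S.ext hO hJ) (ih.jU hO hJ S hm) (.inr (k, i))
    · exact fun p hp τ hτ => ((S.dp hO hJ h1 hτ k).2 p hp (ex i)).1
    · refine ih hO hJ (S.tsys hO hJ h1) ?_ (.inl k) i
      rintro (k | k)
      · exact Dp_contDiff hO hJ (h k)
      · exact hm k

/-- iterated spatial derivatives -/
noncomputable def DxL : List (Fin d) → (E2 d × ℝ → ℝ) → (E2 d × ℝ → ℝ)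
  | [] => id
  | i :: l => fun F => Dx (ex i) (DxL l F)

theorem DxL_append (l : List (Fin d)) (i : Fin d) (F : E2 d × ℝ → ℝ) :
    DxL (l ++ [i]) F = DxL l (Dx (ex i) F) := by
  induction l with
  | nil => rfl
  | cons j l ih => simp only [List.cons_append, DxL, ih]

theorem DxL_reg (m : ℕ) (n : ℕ) : ∀ {κ : Type} [Fintype κ] {O : Set (E2 d)} {J : Set ℝ}
    {B : κ → κ → Fin d → E2 d × ℝ → ℝ} {C : κ → κ → E2 d × ℝ → ℝ} {U : κ → E2 d × ℝ → ℝ},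
    IsOpen O → IsOpen J → Sys O J B C U → (∀ k, ContDiffOn ℝ m (U k) (O ×ˢ J)) →
    ∀ k (l : List (Fin d)), l.length = n → ContDiffOn ℝ m (DxL l (U k)) (O ×ˢ J) := by
  induction n with
  | zero =>
    intro κ _ O J B C U hO hJ S h k l hl
    rw [List.length_eq_zero_iff] at hl
    subst hl; exact h k
  | succ n ih =>
    intro κ _ O J B C U hO hJ S h k l hl
    rcases List.eq_nil_or_concat l with rfl | ⟨l', i, rfl⟩
    · simp at hl
    · rw [List.concat_eq_append, DxL_append]
      have P : PP d m := PP_all m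
      refine ih hO hJ (S.ext hO hJ) (P.jU hO hJ S h) (.inr (k, i)) l' (by simpa using hl)

/-- all directional derivatives of iterated derivatives -/
theorem DxL_slice_smooth {O : Set (E2 d)} (hO : IsOpen O) {F : E2 d × ℝ → ℝ} {τ : ℝ}
    (h : ContDiffOn ℝ ∞ (sl F τ) O) (l : List (Fin d)) : ContDiffOn ℝ ∞ (sl (DxL l F) τ) O := by
  induction l with
  | nil => exact h
  | cons i l ih => exact Dv_smooth hO ih _

end PR
end


section
open scoped Topology ContDiff
open Filter
set_option linter.unusedSectionVars false
namespace PR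

theorem extend_global {E G : Type*} [NormedAddCommGroup E] [NormedSpace ℝ E] [FiniteDimensional ℝ E]
    [NormedAddCommGroup G] [NormedSpace ℝ G] {r : ℕ} {Ψ : E → G} {n0 : E}
    (h : ContDiffAt ℝ r Ψ n0) : ∃ Θ : E → G, ContDiff ℝ r Θ ∧ Θ =ᶠ[𝓝 n0] Ψ := by
  obtain ⟨u, hu, hΨ⟩ := h.contDiffOn le_rfl (by simp)
  obtain ⟨ε, hε, hb⟩ := Metric.mem_nhds_iff.1 hu
  let f : ContDiffBump n0 := ⟨ε/4, ε/2, by positivity, by linarith⟩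
  refine ⟨fun x => f x • Ψ x, ?_, ?_⟩
  · rw [contDiff_iff_contDiffAt]
    intro x
    by_cases hx : x ∈ Metric.ball n0 ε
    · exact f.contDiff.contDiffAt.smul
        ((hΨ.mono hb).contDiffAt (Metric.isOpen_ball.mem_nhds hx))
    · have : (fun x => f x • Ψ x) =ᶠ[𝓝 x] fun _ => 0 := by
        have h1 : x ∉ tsupport f := by
          rw [f.tsupport_eq]
          intro h2
          apply hx
          rw [Metric.mem_closedBall] at h2
          rw [Metric.mem_ball]
          have : f.rOut = ε/2 := rfl
          linarith
        have h2 := notMem_tsupport_iff_eventuallyEq.1 h1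
        filter_upwards [h2] with y hy
        simp [hy]
      exact contDiffAt_const.congr_of_eventuallyEq this
  · filter_upwards [f.eventuallyEq_one] with y hy
    simp [hy]

theorem implicit {E : Type*} [NormedAddCommGroup E] [NormedSpace ℝ E] [FiniteDimensional ℝ E]
    (π : E →L[ℝ] ℝ × ℝ) (σ : ℝ × ℝ →L[ℝ] E) (hπσ : ∀ y, π (σ y) = y) {r : ℕ} (hr : 1 ≤ r)
    {F : E → ℝ × ℝ} {p0 : E} (hF : ContDiffAt ℝ r F p0) (hF0 : F p0 = 0)
    (hinj : ∀ y, fderiv ℝ F p0 (σ y) = 0 → y = 0) :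
    ∃ ρ > (0:ℝ), ∃ Φ : E → ℝ × ℝ, ContDiff ℝ r Φ ∧
      (∀ p q, p - σ (π p) = q - σ (π q) → Φ p = Φ q) ∧
      ∀ p ∈ Metric.ball p0 ρ, F p = 0 → π p = Φ p := by
  have : CompleteSpace E := FiniteDimensional.complete ℝ E
  let H : E → E := fun p => p - σ (π p) + σ (F p)
  have hH : ContDiffAt ℝ r H p0 :=
    (contDiffAt_id.sub (σ.contDiff.contDiffAt.comp p0 π.contDiff.contDiffAt)).add
      (σ.contDiff.contDiffAt.comp p0 hF)
  have hr0 : (r : WithTop ℕ∞) ≠ 0 := by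
    have : r ≠ 0 := by omega
    exact_mod_cast this
  have hFd := (hF.differentiableAt hr0).hasFDerivAt
  let A : E →L[ℝ] E := ContinuousLinearMap.id ℝ E - σ.comp π + σ.comp (fderiv ℝ F p0)
  have hHd : HasFDerivAt H A p0 :=
    ((hasFDerivAt_id p0).sub (σ.hasFDerivAt.comp p0 π.hasFDerivAt)).add
      (σ.hasFDerivAt.comp p0 hFd)
  have hAi : Function.Injective (A : E →ₗ[ℝ] E) := by
    rw [injective_iff_map_eq_zero]
    intro w hw
    have hw' : w - σ (π w) + σ (fderiv ℝ F p0 w) = 0 := hw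
    have h1 := congrArg π hw'
    simp only [map_add, map_sub, hπσ, map_zero, sub_self, zero_add] at h1
    rw [h1, map_zero, add_zero, sub_eq_zero] at hw'
    rw [hw'] at h1
    have := hinj _ h1
    rw [hw', this, map_zero]
  let e : E ≃L[ℝ] E := (LinearEquiv.ofInjectiveEndo _ hAi).toContinuousLinearEquiv
  have he : (e : E →L[ℝ] E) = A := by ext w; rfl
  have hHd' : HasFDerivAt H (e : E →L[ℝ] E) p0 := by rw [he]; exact hHd
  have hst := hH.hasStrictFDerivAt' hHd' hr0
  let g := hH.localInverse hHd' hr0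
  have hg : ContDiffAt ℝ r g (H p0) := hH.to_localInverse hHd' hr0
  have hinv : ∀ᶠ p in 𝓝 p0, g (H p) = p := hst.eventually_left_inverse
  obtain ⟨Θ, hΘ, hΘe⟩ := extend_global (Ψ := fun n => π (g n))
    (π.contDiff.contDiffAt.comp (H p0) hg)
  have hc : Tendsto (fun p => p - σ (π p)) (𝓝 p0) (𝓝 (H p0)) := by
    have : Continuous (fun p => p - σ (π p)) := by fun_prop
    have h2 := this.tendsto p0
    have : H p0 = p0 - σ (π p0) := by simp [H, hF0]
    rw [this]; exact h2
  have hev : ∀ᶠ p in 𝓝 p0, g (H p) = p ∧ Θ (p - σ (π p)) = π (g (p - σ (π p))) :=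
    hinv.and (hc.eventually hΘe)
  obtain ⟨ρ, hρ, hb⟩ := Metric.eventually_nhds_iff_ball.1 hev
  refine ⟨ρ, hρ, fun p => Θ (p - σ (π p)), hΘ.comp (by fun_prop), ?_, ?_⟩
  · intro p q h; simp only [h]
  · intro p hp h0
    obtain ⟨h1, h2⟩ := hb p hp
    simp only
    rw [h2]
    have : H p = p - σ (π p) := by simp [H, h0]
    rw [← this, h1]

end PR
end


section
open scoped Topology ContDiff
open Filter
set_option linter.unusedSectionVars false
namespace PR

variable {d : ℕ}

/-- iterated spatial derivatives of a function on space-time -/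
noncomputable def DL : List (Fin d) → (E2 d → ℝ) → (E2 d → ℝ)
  | [] => id
  | i :: l => fun F => Dv (ex i) (DL l F)

theorem DL_append (l : List (Fin d)) (i : Fin d) (F : E2 d → ℝ) :
    DL (l ++ [i]) F = DL l (Dv (ex i) F) := by
  induction l with
  | nil => rfl
  | cons j l ih => simp only [List.cons_append, DL, ih]

theorem sl_DxL (l : List (Fin d)) (F : E2 d × ℝ → ℝ) (τ : ℝ) : sl (DxL l F) τ = DL l (sl F τ) := by
  induction l with
  | nil => rfl
  | cons i l ih => simp only [DL, ← ih]; rfl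

variable {O : Set (E2 d)}

theorem DL_smooth (hO : IsOpen O) {u : E2 d → ℝ} (hu : ContDiffOn ℝ ∞ u O) (l : List (Fin d)) :
    ContDiffOn ℝ ∞ (DL l u) O := by
  induction l with
  | nil => exact hu
  | cons i l ih => exact Dv_smooth hO ih _

theorem DL_congr (hO : IsOpen O) {u w : E2 d → ℝ} (h : Set.EqOn u w O) (l : List (Fin d)) :
    Set.EqOn (DL l u) (DL l w) O := by
  induction l with
  | nil => exact h
  | cons i l ih => exact Dv_congr hO ih _

theorem DL_comm (hO : IsOpen O) {u : E2 d → ℝ} (hu : ContDiffOn ℝ ∞ u O) (w : E2 d)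
    (l : List (Fin d)) : Set.EqOn (Dv w (DL l u)) (DL l (Dv w u)) O := by
  induction l with
  | nil => exact fun _ _ => rfl
  | cons i l ih =>
    exact (Dv_comm hO (DL_smooth hO hu l) w (ex i)).trans (Dv_congr hO ih _)

theorem DL_add (hO : IsOpen O) {u w : E2 d → ℝ} (hu : ContDiffOn ℝ ∞ u O)
    (hw : ContDiffOn ℝ ∞ w O) (l : List (Fin d)) :
    Set.EqOn (DL l (fun p => u p + w p)) (fun p => DL l u p + DL l w p) O := by
  induction l with
  | nil => exact fun _ _ => rfl
  | cons i l ih =>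
    intro p hp
    have := Dv_congr hO ih (ex i) hp
    simp only [DL]
    rw [this, Dv_add (Sm.diff hO (DL_smooth hO hu l) hp) (Sm.diff hO (DL_smooth hO hw l) hp)]

theorem DL_sum (hO : IsOpen O) {ι : Type*} (s : Finset ι) {u : ι → E2 d → ℝ}
    (hu : ∀ i, ContDiffOn ℝ ∞ (u i) O) (l : List (Fin d)) :
    Set.EqOn (DL l (fun p => ∑ i ∈ s, u i p)) (fun p => ∑ i ∈ s, DL l (u i) p) O := by
  induction l with
  | nil => exact fun _ _ => rfl
  | cons i l ih =>
    intro p hp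
    have := Dv_congr hO ih (ex i) hp
    simp only [DL]
    rw [this, Dv_sum _ fun j _ => Sm.diff hO (DL_smooth hO (hu j) l) hp]

theorem DL_vanish (hO : IsOpen O) {p : E2 d} (hp : p ∈ O) (n : ℕ) : ∀ {f g : E2 d → ℝ},
    ContDiffOn ℝ ∞ f O → ContDiffOn ℝ ∞ g O → (∀ l, l.length ≤ n → DL l g p = 0) →
    ∀ l, l.length ≤ n → DL l (fun p => f p * g p) p = 0 := by
  induction n with
  | zero =>
    intro f g hf hg h l hl
    have : l = [] := List.length_eq_zero_iff.1 (Nat.le_zero.1 hl)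
    subst this
    have h0 : g p = 0 := h [] le_rfl
    simp [DL, h0]
  | succ n ih =>
    intro f g hf hg h l hl
    rcases List.eq_nil_or_concat l with rfl | ⟨l', i, rfl⟩
    · have h0 : g p = 0 := h [] (Nat.zero_le _)
      simp [DL, h0]
    · rw [List.concat_eq_append] at hl ⊢
      rw [DL_append]
      have e : Set.EqOn (Dv (ex i) (fun p => f p * g p))
          (fun p => f p * Dv (ex i) g p + Dv (ex i) f p * g p) O := fun q hq =>
        Dv_mul (Sm.diff hO hf hq) (Sm.diff hO hg hq) _
      have hl' : l'.length ≤ n := by simpa using hl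
      have g' := Dv_smooth hO hg (ex i)
      have f' := Dv_smooth hO hf (ex i)
      rw [DL_congr hO e l' hp, DL_add hO (hf.mul g') (f'.mul hg) l' hp]
      simp only
      rw [ih hf g' (fun l hl => ?_) l' hl', ih f' hg (fun l hl => h l (by omega)) l' hl', add_zero]
      rw [← DL_append]; exact h _ (by simpa using hl)

theorem core (hO : IsOpen O) {u : E2 d → ℝ} (hu : ContDiffOn ℝ ∞ u O) {b : Fin d → E2 d → ℝ}
    {c : E2 d → ℝ} (hb : ∀ j, ContDiffOn ℝ ∞ (b j) O) (hc : ContDiffOn ℝ ∞ c O)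
    (heq : ∀ p ∈ O, Dv et u p = (∑ i, Dv (ex i) (Dv (ex i) u) p)
      + (∑ j, b j p * Dv (ex j) u p) + c p * u p) {p : E2 d} (hp : p ∈ O) {q : ℕ} (hq : 1 ≤ q)
    (hv : ∀ l, l.length ≤ q → DL l u p = 0) (hn : ∃ l, l.length = q + 1 ∧ DL l u p ≠ 0) :
    (∃ β β' : List (Fin d), ∃ i j, i ≠ j ∧ β.length = q ∧ β'.length = q ∧
      DL (i :: β) u p * DL (j :: β') u p - DL (j :: β) u p * DL (i :: β') u p ≠ 0) ∨
    (∃ γ : List (Fin d), ∃ i m, γ.length + 1 = q ∧ DL (i :: m :: γ) u p ≠ 0 ∧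
      Dv et (DL γ u) p ≠ 0) := by
  by_cases hmin : ∃ β β' : List (Fin d), ∃ i j, i ≠ j ∧ β.length = q ∧ β'.length = q ∧
      DL (i :: β) u p * DL (j :: β') u p - DL (j :: β) u p * DL (i :: β') u p ≠ 0
  · exact Or.inl hmin
  right
  have M : ∀ β β' : List (Fin d), ∀ i j, β.length = q → β'.length = q →
      DL (i :: β) u p * DL (j :: β') u p = DL (j :: β) u p * DL (i :: β') u p := by
    intro β β' i j h1 h2
    by_cases hij : i = j
    · subst hij; rfl
    · by_contra h3
      exact hmin ⟨β, β', i, j, hij, h1, h2, sub_ne_zero.2 h3⟩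
  obtain ⟨α, hα, hne⟩ := hn
  match α, hα, hne with
  | [], hα, _ => simp at hα
  | [i], hα, _ => simp at hα; omega
  | i :: m :: γ, hα, hne =>
    have hγ : γ.length + 1 = q := by simpa using hα
    refine ⟨γ, i, m, hγ, hne, ?_⟩
    -- time derivative
    have ht : Dv et (DL γ u) p = ∑ j, DL (j :: j :: γ) u p := by
      rw [DL_comm hO hu et γ hp]
      have s1 : ∀ i, ContDiffOn ℝ ∞ (Dv (ex i) u) O := fun i => Dv_smooth hO hu _
      have s2 : ∀ i, ContDiffOn ℝ ∞ (Dv (ex i) (Dv (ex i) u)) O := fun i => Dv_smooth hO (s1 i) _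
      have s3 : ∀ j, ContDiffOn ℝ ∞ (fun p => b j p * Dv (ex j) u p) O := fun j =>
        (hb j).mul (s1 j)
      have s4 : ContDiffOn ℝ ∞ (fun p => c p * u p) O := hc.mul hu
      have s5 : ContDiffOn ℝ ∞ (fun p => ∑ i, Dv (ex i) (Dv (ex i) u) p) O :=
        ContDiffOn.sum fun i _ => s2 i
      have s6 : ContDiffOn ℝ ∞ (fun p => ∑ j, b j p * Dv (ex j) u p) O :=
        ContDiffOn.sum fun i _ => s3 i
      rw [DL_congr hO (w := fun p => ((∑ i, Dv (ex i) (Dv (ex i) u) p)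
        + (∑ j, b j p * Dv (ex j) u p)) + c p * u p) (fun p hp => heq p hp) γ hp,
        DL_add hO (s5.add s6) s4 γ hp]
      simp only
      rw [DL_add hO s5 s6 γ hp]
      simp only
      rw [DL_sum hO _ s2 γ hp, DL_sum hO _ s3 γ hp]
      simp only
      rw [DL_vanish hO hp (q-1) hc hu (fun l hl => hv l (by omega)) γ (by omega), add_zero]
      have z : ∑ j, DL γ (fun p => b j p * Dv (ex j) u p) p = 0 := by
        refine Finset.sum_eq_zero fun j _ => ?_
        refine DL_vanish hO hp (q-1) (hb j) (s1 j) (fun l hl => ?_) γ (by omega)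
        rw [← DL_append]; exact hv _ (by simp; omega)
      rw [z, add_zero]
      refine Finset.sum_congr rfl fun j _ => ?_
      rw [← DL_comm hO (s1 j) (ex j) γ hp]
      simp only [DL]
      exact (Dv_congr hO (DL_comm hO hu (ex j) γ) (ex j) hp).symm
    rw [ht]
    have sym : ∀ a b, DL (a :: b :: γ) u p = DL (b :: a :: γ) u p := fun a b =>
      Dv_comm hO (DL_smooth hO hu γ) _ _ hp
    have R : ∀ a b c e, DL (a :: b :: γ) u p * DL (c :: e :: γ) u p =
        DL (c :: b :: γ) u p * DL (a :: e :: γ) u p := fun a b c e =>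
      M (b :: γ) (e :: γ) a c (by simpa using hγ) (by simpa using hγ)
    set S : Fin d → Fin d → ℝ := fun a b => DL (a :: b :: γ) u p with hS
    have hS0 : S i m ≠ 0 := hne
    have R' : ∀ a b c e, S a b * S c e = S c b * S a e := R
    have sym' : ∀ a b, S a b = S b a := sym
    have hii : S i i ≠ 0 := by
      intro h
      have := R' i m m i
      rw [h, mul_zero, sym' m i] at this
      exact hS0 (by simpa using this)
    have key : S i m ^ 2 * ∑ j, S j j = S i i * ∑ j, S j m ^ 2 := by
      rw [Finset.mul_sum, Finset.mul_sum]
      refine Finset.sum_congr rfl fun j _ => ?_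
      have r1 := R' i m j j
      have r2 := R' i m j i
      have r3 := sym' i j
      calc S i m ^ 2 * S j j = S i m * (S i m * S j j) := by ring
        _ = S j m * (S i m * S j i) := by rw [r1, r3]; ring
        _ = _ := by rw [r2]; ring
    have hpos : 0 < ∑ j, S j m ^ 2 :=
      lt_of_lt_of_le (by positivity) (Finset.single_le_sum (f := fun j => S j m ^ 2)
        (fun _ _ => sq_nonneg _) (Finset.mem_univ i))
    change ∑ j, S j j ≠ 0
    intro h
    rw [h, mul_zero] at key
    rcases mul_eq_zero.1 key.symm with h1 | h1
    · exact hii h1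
    · exact hpos.ne' h1

end PR
end

section
open scoped Topology ContDiff
namespace PR

theorem Dv_slice_x {d : ℕ} {f : E2 d → ℝ} {x : Fin d → ℝ} {t : ℝ}
    (hf : DifferentiableAt ℝ f (x, t)) (i : Fin d) :
    pd i (fun y => f (y, t)) x = Dv (ex i) f (x, t) := by
  have h1 : HasFDerivAt (fun y : Fin d → ℝ => (y, t))
      ((ContinuousLinearMap.id ℝ (Fin d → ℝ)).prod 0) x :=
    (hasFDerivAt_id x).prodMk (hasFDerivAt_const t x)
  have h2 := HasFDerivAt.comp (g := f) x hf.hasFDerivAt h1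
  have h3 : (f ∘ fun y : Fin d → ℝ => (y, t)) = fun y => f (y, t) := rfl
  rw [h3] at h2
  simp only [pd, Dv, h2.fderiv]
  rfl

theorem Dv_slice_t {d : ℕ} {f : E2 d → ℝ} {x : Fin d → ℝ} {t : ℝ}
    (hf : DifferentiableAt ℝ f (x, t)) :
    deriv (fun s => f (x, s)) t = Dv et f (x, t) := by
  have h1 : HasDerivAt (fun s : ℝ => ((x, s) : E2 d)) (0, 1) t :=
    (hasDerivAt_const t x).prodMk (hasDerivAt_id t)
  exact (HasFDerivAt.comp_hasDerivAt (l := f) t hf.hasFDerivAt h1).deriv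

theorem pdList_eq {d : ℕ} {Ω : Set (Fin d → ℝ)} {I : Set ℝ} (hΩ : IsOpen Ω) (hI : IsOpen I)
    {u : E2 d → ℝ} (hu : ContDiffOn ℝ ∞ u (Ω ×ˢ I)) {t : ℝ} (ht : t ∈ I) (α : List (Fin d)) :
    ∀ x ∈ Ω, pdList α (fun y => u (y, t)) x = DL α u (x, t) := by
  induction α with
  | nil => intro x _; rfl
  | cons i l ih =>
    intro x hx
    have hd := Sm.diff (hΩ.prod hI) (DL_smooth (hΩ.prod hI) hu l) (Set.mk_mem_prod hx ht)
    have h1 := Dv_slice_x hd i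
    have h2 : pdList l (fun y => u (y, t)) =ᶠ[𝓝 x] fun y => DL l u (y, t) := by
      filter_upwards [hΩ.mem_nhds hx] with y hy using ih y hy
    simp only [pdList, DL, pd]
    rw [h2.fderiv_eq]
    exact h1

/-- reordering of the variables -/
noncomputable def reorder (d : ℕ) : ((Fin d → ℝ) × ℝ × ℝ) →L[ℝ] (E2 d × ℝ) :=
  ((ContinuousLinearMap.fst ℝ (Fin d → ℝ) (ℝ × ℝ)).prod
    ((ContinuousLinearMap.fst ℝ ℝ ℝ).comp (ContinuousLinearMap.snd ℝ (Fin d → ℝ) (ℝ × ℝ)))).prod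
    ((ContinuousLinearMap.snd ℝ ℝ ℝ).comp (ContinuousLinearMap.snd ℝ (Fin d → ℝ) (ℝ × ℝ)))

theorem reorder_apply {d : ℕ} (p : (Fin d → ℝ) × ℝ × ℝ) : reorder d p = ((p.1, p.2.1), p.2.2) := rfl

/-- pair-valued map and its derivative -/
theorem pair_map {d : ℕ} {O : Set (E2 d)} {J : Set ℝ} (hO : IsOpen O) (hJ : IsOpen J)
    {r : ℕ} (hr : 1 ≤ r) {G1 G2 : E2 d × ℝ → ℝ} (h1 : ContDiffOn ℝ r G1 (O ×ˢ J))
    (h2 : ContDiffOn ℝ r G2 (O ×ˢ J)) {p : (Fin d → ℝ) × ℝ × ℝ} (hp : reorder d p ∈ O ×ˢ J) :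
    ContDiffAt ℝ r (fun p => (G1 (reorder d p), G2 (reorder d p))) p ∧
    ∀ x t, fderiv ℝ (fun p => (G1 (reorder d p), G2 (reorder d p))) p (x, t, 0) =
      (Dv (x, t) (sl G1 p.2.2) (p.1, p.2.1), Dv (x, t) (sl G2 p.2.2) (p.1, p.2.1)) := by
  have hn := (hO.prod hJ).mem_nhds hp
  have c1 := h1.contDiffAt hn
  have c2 := h2.contDiffAt hn
  have hr0 : ((r : ℕ) : WithTop ℕ∞) ≠ 0 := by
    have : r ≠ 0 := by omega
    exact_mod_cast this
  have d1 := c1.differentiableAt hr0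
  have d2 := c2.differentiableAt hr0
  refine ⟨(c1.comp p (reorder d).contDiff.contDiffAt).prodMk
    (c2.comp p (reorder d).contDiff.contDiffAt), fun x t => ?_⟩
  have f1 := HasFDerivAt.comp (g := G1) p d1.hasFDerivAt (reorder d).hasFDerivAt
  have f2 := HasFDerivAt.comp (g := G2) p d2.hasFDerivAt (reorder d).hasFDerivAt
  have f3 := (f1.prodMk f2).fderiv
  have f4 : (fun p => (G1 (reorder d p), G2 (reorder d p))) =
    fun x => ((G1 ∘ reorder d) x, (G2 ∘ reorder d) x) := rfl
  rw [f4, f3]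
  have e1 := Dx_eq d1 (x, t)
  have e2 := Dx_eq d2 (x, t)
  exact Prod.ext e1.symm e2.symm

end PR
end

/-- local structure step in the proof of Theorem `th-nodalset`:
near each point of the stratum `M_q`, the stratum is contained in a `d`-dimensional
embedded `C^r` graph of one of two possible types. -/
theorem stratum_local_graph_structure
    (d : ℕ) (hd : 2 ≤ d)
    (Ω : Set (Fin d → ℝ)) (hΩo : IsOpen Ω) (hΩc : IsConnected Ω)
    (hΩb : Bornology.IsBounded Ω)
    (I J : Set ℝ) (hIo : IsOpen I) (hIc : I.OrdConnected)
    (hJo : IsOpen J) (hJc : J.OrdConnected)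
    (a : (Fin d → ℝ) → ℝ → ℝ → ℝ) (b : (Fin d → ℝ) → ℝ → ℝ → Fin d → ℝ)
    (ha : ContDiffOn ℝ (⊤ : ℕ∞)
      (fun p : (Fin d → ℝ) × ℝ × ℝ => a p.1 p.2.1 p.2.2) (Ω ×ˢ (I ×ˢ J)))
    (hb : ContDiffOn ℝ (⊤ : ℕ∞)
      (fun p : (Fin d → ℝ) × ℝ × ℝ => b p.1 p.2.1 p.2.2) (Ω ×ˢ (I ×ˢ J)))
    (hab : ∃ C : ℝ, ∀ x ∈ Ω, ∀ t ∈ I, ∀ τ ∈ J, |a x t τ| ≤ C ∧ ‖b x t τ‖ ≤ C)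
    (r : ℕ) (hr : 1 ≤ r)
    (v : (Fin d → ℝ) → ℝ → ℝ → ℝ)
    (hv_xt : ∀ τ ∈ J, ContDiffOn ℝ (⊤ : ℕ∞)
      (fun p : (Fin d → ℝ) × ℝ => v p.1 p.2 τ) (Ω ×ˢ I))
    (hv_r : ContDiffOn ℝ r
      (fun p : (Fin d → ℝ) × ℝ × ℝ => v p.1 p.2.1 p.2.2) (Ω ×ˢ (I ×ˢ J)))
    (hv_eq : ∀ τ ∈ J, ∀ x ∈ Ω, ∀ t ∈ I,
      deriv (fun s => v x s τ) t
        = lap (fun y => v y t τ) x + a x t τ * v x t τ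
          + ∑ i, b x t τ i * pd i (fun y => v y t τ) x)
    (q : ℕ) (hq : 1 ≤ q) :
    ∀ p₀ ∈ Mstratum Ω I J v q, ∃ ρ > (0:ℝ),
      (∃ i j : Fin d, i ≠ j ∧ ∃ Φ : ((Fin d → ℝ) × ℝ × ℝ) → ℝ × ℝ,
          ContDiff ℝ r Φ ∧
          (∀ (x : Fin d → ℝ) (t τ s s' : ℝ),
            Φ (Function.update (Function.update x i s) j s', t, τ) = Φ (x, t, τ)) ∧
          Mstratum Ω I J v q ∩ Metric.ball p₀ ρ ⊆
            {p : (Fin d → ℝ) × ℝ × ℝ | p.1 i = (Φ p).1 ∧ p.1 j = (Φ p).2})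
      ∨
      (∃ i : Fin d, ∃ Φ : ((Fin d → ℝ) × ℝ) → ℝ × ℝ,
          ContDiff ℝ r Φ ∧
          (∀ (x : Fin d → ℝ) (τ s : ℝ), Φ (Function.update x i s, τ) = Φ (x, τ)) ∧
          Mstratum Ω I J v q ∩ Metric.ball p₀ ρ ⊆
            {p : (Fin d → ℝ) × ℝ × ℝ |
              p.1 i = (Φ (p.1, p.2.2)).1 ∧ p.2.1 = (Φ (p.1, p.2.2)).2}) := by
  classical
  have hO : IsOpen (Ω ×ˢ I) := hΩo.prod hIo
  -- functions on the reordered space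
  let Uv : PR.E2 d × ℝ → ℝ := fun z => v z.1.1 z.1.2 z.2
  let A : PR.E2 d × ℝ → ℝ := fun z => a z.1.1 z.1.2 z.2
  let Bf : Fin d → PR.E2 d × ℝ → ℝ := fun j z => b z.1.1 z.1.2 z.2 j
  have hm : MapsTo (fun z : PR.E2 d × ℝ => (z.1.1, z.1.2, z.2)) ((Ω ×ˢ I) ×ˢ J)
      (Ω ×ˢ (I ×ˢ J)) := fun z hz => ⟨hz.1.1, hz.1.2, hz.2⟩
  have hcd : ∀ n : WithTop ℕ∞, ContDiffOn ℝ n (fun z : PR.E2 d × ℝ => (z.1.1, z.1.2, z.2))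
      ((Ω ×ˢ I) ×ˢ J) := fun n => ContDiff.contDiffOn (by fun_prop)
  have hUv : ContDiffOn ℝ r Uv ((Ω ×ˢ I) ×ˢ J) := hv_r.comp (hcd _) hm
  have hA : ContDiffOn ℝ (⊤ : ℕ∞) A ((Ω ×ˢ I) ×ˢ J) := ha.comp (hcd _) hm
  have hBf : ∀ j, ContDiffOn ℝ (⊤ : ℕ∞) (Bf j) ((Ω ×ˢ I) ×ˢ J) := fun j =>
    contDiffOn_pi.1 (hb.comp (hcd _) hm) j
  have hUs : ∀ τ ∈ J, ContDiffOn ℝ (⊤ : ℕ∞) (PR.sl Uv τ) (Ω ×ˢ I) := hv_xt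
  have hsl : ∀ (G : PR.E2 d × ℝ → ℝ), ContDiffOn ℝ (⊤ : ℕ∞) G ((Ω ×ˢ I) ×ˢ J) → ∀ τ ∈ J,
      ContDiffOn ℝ (⊤ : ℕ∞) (PR.sl G τ) (Ω ×ˢ I) := fun G hG τ hτ =>
    hG.comp (ContDiff.contDiffOn (by fun_prop)) fun p hp => ⟨hp, hτ⟩
  have bridge : ∀ τ ∈ J, ∀ t ∈ I, ∀ x ∈ Ω, ∀ α, pdList α (fun y => v y t τ) x =
      PR.DL α (PR.sl Uv τ) (x, t) := fun τ hτ t ht x hx α =>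
    PR.pdList_eq hΩo hIo (hUs τ hτ) ht α x hx
  have heq : ∀ τ ∈ J, ∀ p ∈ Ω ×ˢ I, PR.Dv PR.et (PR.sl Uv τ) p =
      (∑ i, PR.Dv (PR.ex i) (PR.Dv (PR.ex i) (PR.sl Uv τ)) p)
      + (∑ j, PR.sl (Bf j) τ p * PR.Dv (PR.ex j) (PR.sl Uv τ) p)
      + PR.sl A τ p * PR.sl Uv τ p := by
    rintro τ hτ ⟨x, t⟩ ⟨hx, ht⟩
    have h0 := hv_eq τ hτ x hx t ht
    have h1 := PR.Dv_slice_t (PR.Sm.diff hO (hUs τ hτ) (Set.mk_mem_prod hx ht))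
    have h2 : lap (fun y => v y t τ) x =
        ∑ i, PR.Dv (PR.ex i) (PR.Dv (PR.ex i) (PR.sl Uv τ)) (x, t) :=
      Finset.sum_congr rfl fun i _ => bridge τ hτ t ht x hx [i, i]
    have h3 : ∑ i, b x t τ i * pd i (fun y => v y t τ) x =
        ∑ j, PR.sl (Bf j) τ (x, t) * PR.Dv (PR.ex j) (PR.sl Uv τ) (x, t) :=
      Finset.sum_congr rfl fun i _ =>
        congrArg (fun w => b x t τ i * w) (bridge τ hτ t ht x hx [i])
    rw [← h1, ← h2, ← h3]
    refine Eq.trans h0 ?_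
    show _ = _ + _ + a x t τ * v x t τ
    ring
  have S : PR.Sys (κ := Unit) (Ω ×ˢ I) J (fun _ _ j => Bf j) (fun _ _ => A) (fun _ => Uv) :=
    ⟨fun _ _ j => hBf j, fun _ _ => hA, fun τ hτ _ => hUs τ hτ, fun τ hτ p hp k => by
      have := heq τ hτ p hp
      simpa using this⟩
  have hreg : ∀ l : List (Fin d), ContDiffOn ℝ r (PR.DxL l Uv) ((Ω ×ˢ I) ×ˢ J) := fun l =>
    PR.DxL_reg r l.length hO hJo S (fun _ => hUv) () l rfl
  rintro p₀ ⟨⟨hx0, ht0, hτ0⟩, hv0, hn0⟩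
  have hp0 : PR.reorder d p₀ ∈ (Ω ×ˢ I) ×ˢ J := ⟨⟨hx0, ht0⟩, hτ0⟩
  have hzero : ∀ p ∈ Mstratum Ω I J v q, ∀ l : List (Fin d), l.length ≤ q →
      PR.DxL l Uv (PR.reorder d p) = 0 := by
    rintro p ⟨⟨hx, ht, hτ⟩, hp, -⟩ l hl
    have e1 := bridge _ hτ _ ht _ hx l
    rw [hp l hl, ← PR.sl_DxL] at e1
    exact e1.symm
  have hmem : p₀ ∈ Mstratum Ω I J v q := ⟨⟨hx0, ht0, hτ0⟩, hv0, hn0⟩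
  have hvan : ∀ l : List (Fin d), l.length ≤ q →
      PR.DL l (PR.sl Uv p₀.2.2) (p₀.1, p₀.2.1) = 0 := fun l hl => by
    rw [← bridge _ hτ0 _ ht0 _ hx0]; exact hv0 l hl
  have hex : ∀ (i : Fin d), (PR.ex i : PR.E2 d) = (Pi.single i 1, 0) := fun _ => rfl
  have het : (PR.et : PR.E2 d) = (0, 1) := rfl
  have hcore := PR.core hO (hUs _ hτ0) (fun j => hsl _ (hBf j) _ hτ0) (hsl _ hA _ hτ0)
    (heq _ hτ0) (p := (p₀.1, p₀.2.1)) ⟨hx0, ht0⟩ hq hvan (by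
      obtain ⟨l, hl, hne⟩ := hn0
      exact ⟨l, hl, by rwa [← bridge _ hτ0 _ ht0 _ hx0]⟩)
  rcases hcore with ⟨β, β', i, j, hij, hβ, hβ', hdet⟩ | ⟨γ, i, m, hγ, hn1, hn2⟩
  · -- two space variables
    let π : ((Fin d → ℝ) × ℝ × ℝ) →L[ℝ] ℝ × ℝ :=
      ((ContinuousLinearMap.proj i).prod (ContinuousLinearMap.proj j)).comp
        (ContinuousLinearMap.fst ℝ (Fin d → ℝ) (ℝ × ℝ))
    let σ : (ℝ × ℝ) →L[ℝ] ((Fin d → ℝ) × ℝ × ℝ) :=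
      (ContinuousLinearMap.inl ℝ (Fin d → ℝ) (ℝ × ℝ)).comp
        ((ContinuousLinearMap.fst ℝ ℝ ℝ).smulRight (Pi.single i (1:ℝ) : Fin d → ℝ) +
         (ContinuousLinearMap.snd ℝ ℝ ℝ).smulRight (Pi.single j (1:ℝ) : Fin d → ℝ))
    have hπ : ∀ p, π p = (p.1 i, p.1 j) := fun _ => rfl
    have hσ : ∀ y, σ y = (y.1 • (Pi.single i (1:ℝ) : Fin d → ℝ) +
      y.2 • (Pi.single j (1:ℝ) : Fin d → ℝ), 0, 0) := fun _ => rfl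
    obtain ⟨hc, hf⟩ := PR.pair_map hO hJo hr (hreg β) (hreg β') hp0
    obtain ⟨ρ, hρ, Φ, hΦ, hinv, hsol⟩ := PR.implicit π σ (fun y => by
        rw [hπ, hσ]; ext <;> simp [hij, hij.symm]) hr hc
      (Prod.ext (hzero _ hmem β hβ.le) (hzero _ hmem β' hβ'.le)) (fun y hy => by
        rw [hσ, hf] at hy
        have key : ∀ g : PR.E2 d → ℝ, PR.Dv (y.1 • (Pi.single i (1:ℝ) : Fin d → ℝ) +
            y.2 • (Pi.single j (1:ℝ) : Fin d → ℝ), 0) g (p₀.1, p₀.2.1) =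
            y.1 * PR.Dv (PR.ex i) g (p₀.1, p₀.2.1) + y.2 * PR.Dv (PR.ex j) g (p₀.1, p₀.2.1) := by
          intro g
          have : ((y.1 • (Pi.single i (1:ℝ) : Fin d → ℝ) +
            y.2 • (Pi.single j (1:ℝ) : Fin d → ℝ), 0) : PR.E2 d) =
              y.1 • PR.ex i + y.2 • PR.ex j := by
            rw [hex, hex]; ext <;> simp
          rw [this]
          simp only [PR.Dv, map_add, map_smul, smul_eq_mul]
        rw [key, key, PR.sl_DxL, PR.sl_DxL] at hy
        have hy1 := congrArg Prod.fst hy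
        have hy2 := congrArg Prod.snd hy
        simp only [Prod.fst_zero, Prod.snd_zero] at hy1 hy2
        simp only [PR.DL] at hdet
        set g1 := PR.DL β (PR.sl Uv p₀.2.2)
        set g2 := PR.DL β' (PR.sl Uv p₀.2.2)
        set P := PR.Dv (PR.ex i) g1 (p₀.1, p₀.2.1)
        set Q := PR.Dv (PR.ex j) g1 (p₀.1, p₀.2.1)
        set P' := PR.Dv (PR.ex i) g2 (p₀.1, p₀.2.1)
        set Q' := PR.Dv (PR.ex j) g2 (p₀.1, p₀.2.1)
        have z1 : y.1 * (P * Q' - Q * P') = 0 := by linear_combination Q' * hy1 - Q * hy2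
        have z2 : y.2 * (P * Q' - Q * P') = 0 := by linear_combination P * hy2 - P' * hy1
        exact Prod.ext ((mul_eq_zero.1 z1).resolve_right hdet)
          ((mul_eq_zero.1 z2).resolve_right hdet))
    refine ⟨ρ, hρ, Or.inl ⟨i, j, hij, Φ, hΦ, fun x t τ s s' => ?_, ?_⟩⟩
    · apply hinv
      rw [hσ, hσ, hπ, hπ]
      refine Prod.ext (funext fun k => ?_) rfl
      by_cases hkj : k = j
      · subst hkj; simp [hij.symm]
      · by_cases hki : k = i
        · subst hki; simp [hij]
        · simp [hki, hkj]
    · rintro p ⟨hpM, hpb⟩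
      have := hsol p hpb (Prod.ext (hzero _ hpM β hβ.le) (hzero _ hpM β' hβ'.le))
      rw [hπ] at this
      exact ⟨congrArg Prod.fst this, congrArg Prod.snd this⟩
  · -- one space variable and time
    let π : ((Fin d → ℝ) × ℝ × ℝ) →L[ℝ] ℝ × ℝ :=
      ((ContinuousLinearMap.proj i).comp (ContinuousLinearMap.fst ℝ (Fin d → ℝ) (ℝ × ℝ))).prod
        ((ContinuousLinearMap.fst ℝ ℝ ℝ).comp (ContinuousLinearMap.snd ℝ (Fin d → ℝ) (ℝ × ℝ)))
    let σ : (ℝ × ℝ) →L[ℝ] ((Fin d → ℝ) × ℝ × ℝ) :=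
      ((ContinuousLinearMap.fst ℝ ℝ ℝ).smulRight (Pi.single i (1:ℝ) : Fin d → ℝ)).prod
        ((ContinuousLinearMap.snd ℝ ℝ ℝ).prod 0)
    have hπ : ∀ p, π p = (p.1 i, p.2.1) := fun _ => rfl
    have hσ : ∀ y, σ y = (y.1 • (Pi.single i (1:ℝ) : Fin d → ℝ), y.2, 0) := fun _ => rfl
    have hl1 : (m :: γ).length ≤ q := by simp; omega
    have hl2 : γ.length ≤ q := by omega
    have hl3 : (i :: γ).length ≤ q := by simp; omega
    obtain ⟨hc, hf⟩ := PR.pair_map hO hJo hr (hreg (m :: γ)) (hreg γ) hp0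
    obtain ⟨ρ, hρ, Φ, hΦ, hinv, hsol⟩ := PR.implicit π σ (fun y => by
        rw [hπ, hσ]; ext <;> simp) hr hc
      (Prod.ext (hzero _ hmem _ hl1) (hzero _ hmem _ hl2)) (fun y hy => by
        rw [hσ, hf] at hy
        have key : ∀ g : PR.E2 d → ℝ, PR.Dv (y.1 • (Pi.single i (1:ℝ) : Fin d → ℝ), y.2)
            g (p₀.1, p₀.2.1) =
            y.1 * PR.Dv (PR.ex i) g (p₀.1, p₀.2.1) + y.2 * PR.Dv PR.et g (p₀.1, p₀.2.1) := by
          intro g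
          have : ((y.1 • (Pi.single i (1:ℝ) : Fin d → ℝ), y.2) : PR.E2 d) =
              y.1 • PR.ex i + y.2 • PR.et := by
            rw [hex, het]; ext <;> simp
          rw [this]
          simp only [PR.Dv, map_add, map_smul, smul_eq_mul]
        rw [key, key, PR.sl_DxL, PR.sl_DxL] at hy
        have hy1 := congrArg Prod.fst hy
        have hy2 := congrArg Prod.snd hy
        simp only [Prod.fst_zero, Prod.snd_zero] at hy1 hy2
        have h3 : PR.Dv (PR.ex i) (PR.DL γ (PR.sl Uv p₀.2.2)) (p₀.1, p₀.2.1) = 0 :=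
          hvan (i :: γ) hl3
        rw [h3, mul_zero, zero_add] at hy2
        have z2 := (mul_eq_zero.1 hy2).resolve_right hn2
        rw [z2, zero_mul, add_zero] at hy1
        exact Prod.ext ((mul_eq_zero.1 hy1).resolve_right hn1) z2)
    have hup : ∀ (x : Fin d → ℝ) (t t' τ s : ℝ), Φ (Function.update x i s, t, τ) =
        Φ (x, t', τ) := by
      intro x t t' τ s
      apply hinv
      rw [hσ, hσ, hπ, hπ]
      refine Prod.ext (funext fun k => ?_) (by simp)
      by_cases hki : k = i
      · subst hki; simp
      · simp [hki]
    refine ⟨ρ, hρ, Or.inr ⟨i, fun w => Φ (w.1, 0, w.2), hΦ.comp (by fun_prop),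
      fun x τ s => hup x 0 0 τ s, ?_⟩⟩
    rintro p ⟨hpM, hpb⟩
    have := hsol p hpb (Prod.ext (hzero _ hpM _ hl1) (hzero _ hpM _ hl2))
    have e : Φ p = Φ (p.1, 0, p.2.2) := by
      have := hup p.1 p.2.1 0 p.2.2 (p.1 i)
      rwa [Function.update_eq_self] at this
    rw [hπ, e] at this
    exact ⟨congrArg Prod.fst this, congrArg Prod.snd this⟩
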